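/- Let d ≥ 2 and 1 ≤ n < d. For Lebesgue-almost-every choice of the coefficient tuples defining n convex PL functions f_1, …, f_n on ℝ^d (each a maximum of r_j ≥ 2 affine functions) and of the affine functionals defining a full-dimensional polyhedron P = {x ∈ ℝ^d : ⟨x, c_k⟩ + e_k ≤ 0, k = 1, …, s}, the pair (X ∩ P, X ∩ ∂P) is (d−n−1)-connected, where X = X_1 ∩ ⋯ ∩ X_n is the intersection of the bend loci X_j of the f_j and ∂P is the topological boundary of P. -/

import Mathlib

open scoped RealInnerProductSpace
open MeasureTheory

/-- The convex PL function `x ↦ max_{1 ≤ i ≤ r} (⟪x, b i⟫ + a i)` (an `iSup` over the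
nonempty finite index type `Fin r`, hence a maximum). -/
noncomputable def plMax {d r : ℕ} (b : Fin r → EuclideanSpace ℝ (Fin d)) (a : Fin r → ℝ) :
    EuclideanSpace ℝ (Fin d) → ℝ :=
  fun x => ⨆ i : Fin r, (⟪x, b i⟫ + a i)

/-- The bend locus of a convex PL function: the set of points where it is not differentiable. -/
def bendLocus {d r : ℕ} (b : Fin r → EuclideanSpace ℝ (Fin d)) (a : Fin r → ℝ) :
    Set (EuclideanSpace ℝ (Fin d)) :=
  {x | ¬ DifferentiableAt ℝ (plMax b a) x}

/-- The polyhedron `{x : ⟪x, c k⟫ + e k ≤ 0 for all k}`. -/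
def polyhedron {d s : ℕ} (q : Fin s → EuclideanSpace ℝ (Fin d) × ℝ) :
    Set (EuclideanSpace ℝ (Fin d)) :=
  {x | ∀ k, ⟪x, (q k).1⟫ + (q k).2 ≤ 0}

/-- The map on `GenLoop`s induced by postcomposition with a continuous map. -/
def GenLoop.map (N : Type*) {X Y : Type*} [TopologicalSpace X] [TopologicalSpace Y]
    (f : C(X, Y)) (x : X) (p : GenLoop N X x) : GenLoop N Y (f x) :=
  ⟨f.comp p.1, fun y hy => by simp [p.2 y hy]⟩

/-- The induced map on homotopy groups of a continuous map. -/
noncomputable def HomotopyGroup.map (N : Type*) {X Y : Type*} [TopologicalSpace X]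
    [TopologicalSpace Y] (f : C(X, Y)) (x : X) :
    HomotopyGroup N X x → HomotopyGroup N Y (f x) :=
  Quotient.map (GenLoop.map N f x) (fun p q h => by
    obtain ⟨H⟩ := h
    exact ⟨H.compContinuousMap f⟩)

/-- The pair `(Y, A)` is `m`-connected: for every basepoint in `A`, the inclusion `A ↪ Y`
induces a bijection on `π_k` for all `0 ≤ k < m` and a surjection on `π_m`. -/
def PairMConnected (m : ℕ) {Y : Type*} [TopologicalSpace Y] (A : Set Y) : Prop :=
  ∀ a : A,
    (∀ k : ℕ, k < m →
      Function.Bijective (HomotopyGroup.map (Fin k) ⟨Subtype.val, continuous_subtype_val⟩ a)) ∧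
    Function.Surjective (HomotopyGroup.map (Fin m) ⟨Subtype.val, continuous_subtype_val⟩ a)

open Set Topology Filter

/-! ### Thin compact sets -/

/-- A compact set of covering dimension less than `m`, witnessed by an embedding in a Euclidean
space all of whose points have fewer than `m` coordinates outside a fixed finite set. -/
structure Thin (m : ℕ) {X : Type} [MetricSpace X] (D : Set X) : Prop where
  isCompact : IsCompact D
  exists_embedding : ∃ (N : ℕ) (φ : X → Fin N → ℝ) (F : Finset ℝ), Continuous φ ∧ InjOn φ D ∧
    ∀ x ∈ D, (Finset.univ.filter fun i => φ x i ∉ F).card < m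

namespace Thin

variable {X : Type} [MetricSpace X] {m : ℕ} {D E : Set X}

theorem isClosed (h : Thin m D) : IsClosed D := h.isCompact.isClosed

theorem subset (h : Thin m D) (hE : IsClosed E) (hED : E ⊆ D) : Thin m E := by
  obtain ⟨hc, N, φ, F, h1, h2, h3⟩ := h
  exact ⟨hc.of_isClosed_subset hE hED, N, φ, F, h1, h2.mono hED, fun x hx => h3 x (hED hx)⟩

theorem mono {n : ℕ} (h : Thin m D) (hmn : m ≤ n) : Thin n D := by
  obtain ⟨hc, N, φ, F, h1, h2, h3⟩ := h
  exact ⟨hc, N, φ, F, h1, h2, fun x hx => (h3 x hx).trans_le hmn⟩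

theorem eq_empty (h : Thin 0 D) : D = ∅ := by
  obtain ⟨hc, N, φ, F, h1, h2, h3⟩ := h
  exact eq_empty_of_forall_notMem fun x hx => absurd (h3 x hx) (by simp)

theorem prod_Icc (h : Thin m D) : Thin (m + 1) (D ×ˢ Icc (0 : ℝ) 1) := by
  obtain ⟨hc, N, φ, F, h1, h2, h3⟩ := h
  refine ⟨hc.prod isCompact_Icc, N + 1, fun p => Fin.cons p.2 (φ p.1), F, ?_, ?_, ?_⟩
  · refine continuous_pi fun i => ?_
    refine Fin.cases ?_ (fun i => ?_) i
    · simpa using continuous_snd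
    · exact (continuous_apply i).comp (h1.comp continuous_fst)
  · rintro ⟨x, t⟩ hx ⟨y, u⟩ hy hxy
    have hxy' := Fin.cons_injective2 hxy
    exact Prod.ext (h2 hx.1 hy.1 hxy'.2) hxy'.1
  · rintro ⟨x, t⟩ hx
    have := h3 x hx.1
    rw [Fin.card_filter_univ_succ]
    simp only [Fin.cons_succ]
    split_ifs <;> omega

/-- Thin sets have thin separators. -/
theorem exists_separator (h : Thin (m + 1) D) (hE : IsClosed E) (hED : E ⊆ D) {O : Set X}
    (hO : IsOpen O) (hEO : E ⊆ O) :
    ∃ K L : Set X, IsClosed K ∧ IsClosed L ∧ K ∪ L = D ∧ E ⊆ K ∧ K ⊆ O ∧ Thin m (K ∩ L) := by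
  obtain ⟨hc, N, φ, F, h1, h2, h3⟩ := h
  have hEc : IsCompact E := hc.of_isClosed_subset hE hED
  have hRc : IsCompact (D \ O) := hc.diff hO
  obtain ⟨ε, hε, hεd⟩ : ∃ ε > 0, ∀ x ∈ E, ∀ y ∈ D \ O, ε ≤ dist (φ x) (φ y) := by
    have hcont : ContinuousOn (fun p : X × X => dist (φ p.1) (φ p.2)) (E ×ˢ (D \ O)) := by
      fun_prop
    have hpos : ∀ p ∈ E ×ˢ (D \ O), 0 < dist (φ p.1) (φ p.2) := by
      rintro ⟨x, y⟩ ⟨hx, hy⟩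
      refine dist_pos.2 fun hxy => hy.2 ?_
      rw [← h2 (hED hx) hy.1 hxy]
      exact hEO hx
    rcases (E ×ˢ (D \ O)).eq_empty_or_nonempty with he | hne
    · refine ⟨1, one_pos, fun x hx y hy => ?_⟩
      have : (x, y) ∈ E ×ˢ (D \ O) := ⟨hx, hy⟩
      simp [he] at this
    · obtain ⟨p, hp, hmin⟩ := (hEc.prod hRc).exists_isMinOn hne hcont
      exact ⟨_, hpos p hp, fun x hx y hy => hmin (show (x, y) ∈ E ×ˢ (D \ O) from ⟨hx, hy⟩)⟩
  have hend : ∀ u v : ℝ, u < v → ∃ w, u < w ∧ w < v ∧ w ∉ F := by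
    intro u v huv
    obtain ⟨w, hw, hwF⟩ := (Ioo_infinite huv).exists_notMem_finset F
    exact ⟨w, hw.1, hw.2, hwF⟩
  choose! w hw1 hw2 hw3 using hend
  let lo : X → Fin N → ℝ := fun x i => w (φ x i - ε) (φ x i)
  let hi : X → Fin N → ℝ := fun x i => w (φ x i) (φ x i + ε)
  have hlo : ∀ x i, φ x i - ε < lo x i ∧ lo x i < φ x i ∧ lo x i ∉ F := fun x i =>
    ⟨hw1 _ _ (by linarith), hw2 _ _ (by linarith), hw3 _ _ (by linarith)⟩
  have hhi : ∀ x i, φ x i < hi x i ∧ hi x i < φ x i + ε ∧ hi x i ∉ F := fun x i =>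
    ⟨hw1 _ _ (by linarith), hw2 _ _ (by linarith), hw3 _ _ (by linarith)⟩
  let box : X → Set X := fun x => {y | ∀ i, lo x i < φ y i ∧ φ y i < hi x i}
  let cbox : X → Set X := fun x => {y | ∀ i, lo x i ≤ φ y i ∧ φ y i ≤ hi x i}
  have hφi : ∀ i, Continuous fun y => φ y i := fun i => (continuous_apply i).comp h1
  have hbox : ∀ x, IsOpen (box x) := fun x => by
    simp only [box, ofPred_forall]
    exact isOpen_iInter_of_finite fun i =>
      (isOpen_lt continuous_const (hφi i)).inter (isOpen_lt (hφi i) continuous_const)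
  have hcbox : ∀ x, IsClosed (cbox x) := fun x => by
    simp only [cbox, ofPred_forall]
    exact isClosed_iInter fun i =>
      (isClosed_le continuous_const (hφi i)).inter (isClosed_le (hφi i) continuous_const)
  obtain ⟨T, hTE, hT⟩ := hEc.elim_nhds_subcover box fun x _ =>
    (hbox x).mem_nhds fun i => ⟨(hlo x i).2.1, (hhi x i).1⟩
  refine ⟨D ∩ ⋃ x ∈ T, cbox x, D \ ⋃ x ∈ T, box x, ?_, ?_, ?_, ?_, ?_, ?_, ?_⟩
  · exact hc.isClosed.inter (T.finite_toSet.isClosed_biUnion fun x _ => hcbox x)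
  · exact hc.isClosed.sdiff (isOpen_biUnion fun x _ => hbox x)
  · have : (⋃ x ∈ T, box x) ⊆ ⋃ x ∈ T, cbox x :=
      iUnion₂_mono fun x _ y hy i => ⟨(hy i).1.le, (hy i).2.le⟩
    ext y
    constructor
    · rintro (hy | hy) <;> exact hy.1
    · intro hy
      by_cases hb : y ∈ ⋃ x ∈ T, box x
      · exact Or.inl ⟨hy, this hb⟩
      · exact Or.inr ⟨hy, hb⟩
  · intro y hy
    refine ⟨hED hy, ?_⟩
    obtain ⟨x, hx, hxy⟩ := mem_iUnion₂.1 (hT hy)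
    exact mem_iUnion₂.2 ⟨x, hx, fun i => ⟨(hxy i).1.le, (hxy i).2.le⟩⟩
  · rintro y ⟨hyD, hy⟩
    obtain ⟨x, hx, hxy⟩ := mem_iUnion₂.1 hy
    by_contra hyO
    have h4 := hεd x (hTE x hx) y ⟨hyD, hyO⟩
    have h5 : dist (φ x) (φ y) < ε := by
      rw [dist_pi_lt_iff hε]
      intro i
      rw [Real.dist_eq, abs_lt]
      have := hlo x i
      have := hhi x i
      have := hxy i
      constructor <;> linarith
    linarith
  · exact hc.of_isClosed_subset ((hc.isClosed.inter (T.finite_toSet.isClosed_biUnion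
      fun x _ => hcbox x)).inter (hc.isClosed.sdiff (isOpen_biUnion fun x _ => hbox x)))
      fun y hy => hy.1.1
  · classical
    refine ⟨N, φ, F ∪ T.biUnion fun x => Finset.univ.image (lo x) ∪ Finset.univ.image (hi x), h1,
      h2.mono fun y hy => hy.1.1, ?_⟩
    rintro y ⟨⟨hyD, hy⟩, -, hy'⟩
    obtain ⟨x, hx, hxy⟩ := mem_iUnion₂.1 hy
    have hxy' : y ∉ box x := fun h => hy' (mem_iUnion₂.2 ⟨x, hx, h⟩)
    simp only [box, mem_ofPred_eq, not_forall, not_and_or, not_lt] at hxy'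
    obtain ⟨i, hi'⟩ := hxy'
    have hmem : φ y i ∉ F ∧ (φ y i ∈ Finset.univ.image (lo x) ∪ Finset.univ.image (hi x)) := by
      rcases hi' with hi' | hi'
      · have he : φ y i = lo x i := le_antisymm hi' (hxy i).1
        rw [he]
        exact ⟨(hlo x i).2.2, by simp⟩
      · have he : φ y i = hi x i := le_antisymm (hxy i).2 hi'
        rw [he]
        exact ⟨(hhi x i).2.2, by simp⟩
    have := h3 y hyD
    refine lt_of_lt_of_le (Finset.card_lt_card ?_) (Nat.lt_succ_iff.1 this)
    refine Finset.ssubset_iff_of_subset ?_ |>.2 ⟨i, by simp [hmem.1], ?_⟩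
    · intro l hl
      simp only [Finset.mem_filter, Finset.mem_union, not_or] at hl ⊢
      exact ⟨hl.1, hl.2.1⟩
    · simp only [Finset.mem_filter, Finset.mem_union, not_or, not_and, Finset.mem_biUnion]
      intro _ _ h
      exact h ⟨x, hx, by simpa using hmem.2⟩

end Thin

/-! ### Extension and compression of maps from thin sets -/

theorem continuousOn_of_inter_isClosed {X Y : Type*} [TopologicalSpace X] [TopologicalSpace Y]
    {f : X → Y} {s A B : Set X} (hA : IsClosed A) (hB : IsClosed B) (hs : s ⊆ A ∪ B)
    (hfA : ContinuousOn f (s ∩ A)) (hfB : ContinuousOn f (s ∩ B)) : ContinuousOn f s := by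
  have key : ∀ C : Set X, IsClosed C → ContinuousOn f (s ∩ C) → ∀ x ∈ s,
      ContinuousWithinAt f (s ∩ C) x := by
    intro C hC hf x hx
    by_cases hxC : x ∈ C
    · exact hf x ⟨hx, hxC⟩
    · refine continuousWithinAt_of_notMem_closure fun h => hxC ?_
      exact hC.closure_subset_iff.2 inter_subset_right h
  intro x hx
  have h := (key A hA hfA x hx).union (key B hB hfB x hx)
  rwa [← inter_union_distrib_left, inter_eq_self_of_subset_left hs] at h

/-- Gluing of two continuous maps that agree on the overlap of two closed sets. -/
theorem exists_glue {X Y : Type*} [TopologicalSpace X] [TopologicalSpace Y]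
    {f g : X → Y} {s A B : Set X} (hA : IsClosed A) (hB : IsClosed B) (hs : s ⊆ A ∪ B)
    (hf : ContinuousOn f (s ∩ A)) (hg : ContinuousOn g (s ∩ B))
    (hfg : ∀ x ∈ s, x ∈ A → x ∈ B → f x = g x) :
    ∃ h : X → Y, ContinuousOn h s ∧ EqOn h f (s ∩ A) ∧ EqOn h g (s ∩ B) := by
  classical
  have h1 : EqOn (A.piecewise f g) f (s ∩ A) := fun x hx => by simp [hx.2]
  have h2 : EqOn (A.piecewise f g) g (s ∩ B) := fun x hx => by
    by_cases hxA : x ∈ A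
    · simp [hxA, hfg x hx.1 hxA hx.2]
    · simp [hxA]
  exact ⟨A.piecewise f g, continuousOn_of_inter_isClosed hA hB hs (hf.congr h1) (hg.congr h2),
    h1, h2⟩

section Extensors

variable {V : Type} [NormedAddCommGroup V]

/-- `Z` is an absolute extensor for thin sets of dimension less than `m`. -/
def IsExtensor (m : ℕ) {V : Type} [NormedAddCommGroup V] (Z : Set V) : Prop :=
  ∀ (X : Type) [MetricSpace X] (D E : Set X) (f : X → V), Thin m D → IsClosed E → E ⊆ D →
    ContinuousOn f E → MapsTo f E Z → ∃ g : X → V, ContinuousOn g D ∧ MapsTo g D Z ∧ EqOn g f E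

/-- `Z` is an absolute neighbourhood extensor for metric spaces. -/
def IsNhdExtensor {V : Type} [NormedAddCommGroup V] (Z : Set V) : Prop :=
  ∀ (X : Type) [MetricSpace X] (E : Set X) (f : X → V), IsClosed E →
    ContinuousOn f E → MapsTo f E Z →
    ∃ (O : Set X) (g : X → V), IsOpen O ∧ E ⊆ O ∧ ContinuousOn g O ∧ MapsTo g O Z ∧ EqOn g f E

/-- Every map of a thin set of dimension less than `m` in `Z` can be deformed into `A`, relative
to a closed set already mapped into `A`. -/
def Compressible (m : ℕ) {V : Type} [NormedAddCommGroup V] (Z A : Set V) : Prop :=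
  ∀ (X : Type) [MetricSpace X] (D E : Set X) (g : X → V), Thin m D → IsClosed E → E ⊆ D →
    ContinuousOn g D → MapsTo g D Z → MapsTo g E A →
    ∃ H : X × ℝ → V, ContinuousOn H (D ×ˢ Icc (0 : ℝ) 1) ∧ MapsTo H (D ×ˢ Icc (0 : ℝ) 1) Z ∧
      (∀ x ∈ D, H (x, 0) = g x) ∧ (∀ x ∈ D, H (x, 1) ∈ A) ∧
      ∀ x ∈ E, ∀ t ∈ Icc (0 : ℝ) 1, H (x, t) = g x

theorem isExtensor_zero (Z : Set V) : IsExtensor 0 Z := by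
  intro X _ D E f hD _ hED _ _
  have := hD.eq_empty
  subst this
  exact ⟨f, by simp, by simp [MapsTo], fun x hx => (hED hx).elim⟩

theorem IsExtensor.mono {m n : ℕ} {Z : Set V} (h : IsExtensor n Z) (hmn : m ≤ n) :
    IsExtensor m Z := fun X _ D E f hD => h X D E f (hD.mono hmn)

theorem Compressible.mono {m n : ℕ} {Z A : Set V} (h : Compressible n Z A) (hmn : m ≤ n) :
    Compressible m Z A := fun X _ D E f hD => h X D E f (hD.mono hmn)

theorem compressible_refl (m : ℕ) (Z : Set V) : Compressible m Z Z := by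
  intro X _ D E g hD hE hED hg hgZ _
  exact ⟨fun p => g p.1, hg.comp continuousOn_fst fun p hp => hp.1, fun p hp => hgZ hp.1,
    fun x hx => rfl, fun x hx => hgZ hx, fun x hx t ht => rfl⟩

theorem Compressible.trans {m : ℕ} {Y Z A : Set V} (h1 : Compressible m Y Z)
    (h2 : Compressible m Z A) (hAZ : A ⊆ Z) (hZY : Z ⊆ Y) : Compressible m Y A := by
  intro X _ D E g hD hE hED hg hgY hgA
  obtain ⟨H, hHc, hHY, hH0, hH1, hHE⟩ :=
    h1 X D E g hD hE hED hg hgY fun x hx => hAZ (hgA hx)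
  have hone : (1 : ℝ) ∈ Icc (0 : ℝ) 1 := by simp
  have hzero : (0 : ℝ) ∈ Icc (0 : ℝ) 1 := by simp
  obtain ⟨K, hKc, hKZ, hK0, hK1, hKE⟩ := h2 X D E (fun x => H (x, 1)) hD hE hED
    (hHc.comp (by fun_prop) fun x hx => ⟨hx, hone⟩) (fun x hx => hH1 x hx) fun x hx => by
      simp only [hHE x hx 1 hone]
      exact hgA hx
  have hA : IsClosed {p : X × ℝ | p.2 ≤ 1 / 2} := isClosed_le continuous_snd continuous_const
  have hB : IsClosed {p : X × ℝ | 1 / 2 ≤ p.2} := isClosed_le continuous_const continuous_snd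
  have hmA : ∀ p ∈ (D ×ˢ Icc (0 : ℝ) 1) ∩ {p : X × ℝ | p.2 ≤ 1 / 2},
      (p.1, 2 * p.2) ∈ D ×ˢ Icc (0 : ℝ) 1 := by
    rintro ⟨x, t⟩ ⟨⟨hx, ht⟩, ht'⟩
    simp only [mem_Icc, mem_ofPred_eq] at ht ht'
    exact ⟨hx, by constructor <;> simp <;> linarith⟩
  have hmB : ∀ p ∈ (D ×ˢ Icc (0 : ℝ) 1) ∩ {p : X × ℝ | 1 / 2 ≤ p.2},
      (p.1, 2 * p.2 - 1) ∈ D ×ˢ Icc (0 : ℝ) 1 := by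
    rintro ⟨x, t⟩ ⟨⟨hx, ht⟩, ht'⟩
    simp only [mem_Icc, mem_ofPred_eq] at ht ht'
    exact ⟨hx, by constructor <;> simp <;> linarith⟩
  obtain ⟨L, hLc, hLA, hLB⟩ := exists_glue (s := D ×ˢ Icc (0 : ℝ) 1)
    (f := fun p => H (p.1, 2 * p.2)) (g := fun p => K (p.1, 2 * p.2 - 1)) hA hB
    (fun p _ => le_total p.2 (1 / 2)) (hHc.comp (by fun_prop) hmA) (hKc.comp (by fun_prop) hmB)
    (by
      rintro ⟨x, t⟩ ⟨hx, -⟩ ht ht'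
      have : t = 1 / 2 := le_antisymm ht ht'
      subst this
      norm_num
      rw [hK0 x hx])
  refine ⟨L, hLc, ?_, ?_, ?_, ?_⟩
  · intro p hp
    rcases le_total p.2 (1 / 2) with h | h
    · rw [hLA ⟨hp, h⟩]
      exact hHY (hmA p ⟨hp, h⟩)
    · rw [hLB ⟨hp, h⟩]
      exact hZY (hKZ (hmB p ⟨hp, h⟩))
  · intro x hx
    rw [hLA ⟨⟨hx, hzero⟩, by simp⟩]
    simp [hH0 x hx]
  · intro x hx
    rw [hLB ⟨⟨hx, hone⟩, by norm_num⟩]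
    have := hK1 x hx
    norm_num
    exact this
  · intro x hx t ht
    rcases le_total t (1 / 2) with h | h
    · rw [hLA ⟨⟨hED hx, ht⟩, h⟩]
      exact hHE x hx _ (hmA (x, t) ⟨⟨hED hx, ht⟩, h⟩).2
    · rw [hLB ⟨⟨hED hx, ht⟩, h⟩]
      exact (hKE x hx _ (hmB (x, t) ⟨⟨hED hx, ht⟩, h⟩).2).trans (hHE x hx 1 hone)

theorem Compressible.union {m : ℕ} {Z₁ Z₂ : Set V} (h₁ : IsClosed Z₁) (h₂ : IsClosed Z₂)
    (h : Compressible m Z₂ (Z₁ ∩ Z₂)) : Compressible m (Z₁ ∪ Z₂) Z₁ := by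
  intro X _ D E g hD hE hED hg hgY hgA
  have hD1 : IsClosed (D ∩ g ⁻¹' Z₁) := hg.preimage_isClosed_of_isClosed hD.isClosed h₁
  have hD2 : IsClosed (D ∩ g ⁻¹' Z₂) := hg.preimage_isClosed_of_isClosed hD.isClosed h₂
  obtain ⟨H, hHc, hHZ, hH0, hH1, hHE⟩ := h X (D ∩ g ⁻¹' Z₂) ((D ∩ g ⁻¹' Z₁) ∩ (D ∩ g ⁻¹' Z₂)) g
    (hD.subset hD2 inter_subset_left) (hD1.inter hD2) inter_subset_right
    (hg.mono inter_subset_left) (fun x hx => hx.2) (fun x hx => ⟨hx.1.2, hx.2.2⟩)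
  have hzero : (0 : ℝ) ∈ Icc (0 : ℝ) 1 := by simp
  have hone : (1 : ℝ) ∈ Icc (0 : ℝ) 1 := by simp
  have hcov : D ×ˢ Icc (0 : ℝ) 1 ⊆ (D ∩ g ⁻¹' Z₁) ×ˢ (univ : Set ℝ) ∪
      (D ∩ g ⁻¹' Z₂) ×ˢ (univ : Set ℝ) := by
    rintro ⟨x, t⟩ ⟨hx, ht⟩
    exact (hgY hx).imp (fun h => ⟨⟨hx, h⟩, trivial⟩) fun h => ⟨⟨hx, h⟩, trivial⟩
  obtain ⟨L, hLc, hLA, hLB⟩ := exists_glue (s := D ×ˢ Icc (0 : ℝ) 1)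
    (f := fun p => g p.1) (g := H) (hD1.prod isClosed_univ) (hD2.prod isClosed_univ) hcov
    (hg.comp continuousOn_fst fun p hp => hp.1.1) (hHc.mono fun p hp => ⟨hp.2.1, hp.1.2⟩)
    (by
      rintro ⟨x, t⟩ ⟨hx, ht⟩ h1 h2
      exact (hHE x ⟨h1.1, h2.1⟩ t ht).symm)
  refine ⟨L, hLc, ?_, ?_, ?_, ?_⟩
  · intro p hp
    rcases hcov hp with h | h
    · rw [hLA ⟨hp, h⟩]
      exact Or.inl h.1.2
    · rw [hLB ⟨hp, h⟩]
      exact Or.inr (hHZ ⟨h.1, hp.2⟩)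
  · intro x hx
    have hp : (x, (0 : ℝ)) ∈ D ×ˢ Icc (0 : ℝ) 1 := ⟨hx, hzero⟩
    rcases hcov hp with h | h
    · rw [hLA ⟨hp, h⟩]
    · rw [hLB ⟨hp, h⟩]
      exact hH0 x h.1
  · intro x hx
    have hp : (x, (1 : ℝ)) ∈ D ×ˢ Icc (0 : ℝ) 1 := ⟨hx, hone⟩
    rcases hcov hp with h | h
    · rw [hLA ⟨hp, h⟩]
      exact h.1.2
    · rw [hLB ⟨hp, h⟩]
      exact (hH1 x h.1).1
  · intro x hx t ht
    have hp : (x, t) ∈ D ×ˢ Icc (0 : ℝ) 1 := ⟨hED hx, ht⟩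
    rw [hLA ⟨hp, ⟨hED hx, hgA hx⟩, trivial⟩]

theorem Compressible.isExtensor {m : ℕ} {Z A : Set V} (h : Compressible m Z A)
    (hZ : IsExtensor m Z) (hAZ : A ⊆ Z) : IsExtensor m A := by
  intro X _ D E f hD hE hED hf hfA
  obtain ⟨g, hg, hgZ, hgf⟩ := hZ X D E f hD hE hED hf fun x hx => hAZ (hfA hx)
  obtain ⟨H, hHc, hHZ, hH0, hH1, hHE⟩ := h X D E g hD hE hED hg hgZ fun x hx => by
    rw [hgf hx]
    exact hfA hx
  have hone : (1 : ℝ) ∈ Icc (0 : ℝ) 1 := by simp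
  refine ⟨fun x => H (x, 1), hHc.comp (by fun_prop) fun x hx => ⟨hx, hone⟩, hH1, fun x hx => ?_⟩
  simp only [hHE x hx 1 hone, hgf hx]

theorem IsExtensor.compressible {m : ℕ} {Z A : Set V} (hA : IsExtensor m A)
    (hZ : IsExtensor (m + 1) Z) (hAZ : A ⊆ Z) : Compressible m Z A := by
  intro X _ D E g hD hE hED hg hgZ hgA
  obtain ⟨g', hg', hgA', hgg'⟩ := hA X D E g hD hE hED (hg.mono hED) hgA
  have hzero : (0 : ℝ) ∈ Icc (0 : ℝ) 1 := by simp
  have hone : (1 : ℝ) ∈ Icc (0 : ℝ) 1 := by simp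
  have hc0 : IsClosed (D ×ˢ {(0 : ℝ)} ∪ E ×ˢ Icc (0 : ℝ) 1) :=
    (hD.isClosed.prod isClosed_singleton).union (hE.prod isClosed_Icc)
  have hc1 : IsClosed (D ×ˢ {(1 : ℝ)}) := hD.isClosed.prod isClosed_singleton
  have hs0 : D ×ˢ {(0 : ℝ)} ∪ E ×ˢ Icc (0 : ℝ) 1 ⊆ D ×ˢ univ := by
    rintro ⟨x, t⟩ (h | h)
    · exact ⟨h.1, trivial⟩
    · exact ⟨hED h.1, trivial⟩
  obtain ⟨f, hf, hfA, hfB⟩ := exists_glue (X := X × ℝ)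
    (s := (D ×ˢ {(0 : ℝ)} ∪ E ×ˢ Icc (0 : ℝ) 1) ∪ D ×ˢ {(1 : ℝ)})
    (f := fun p => g p.1) (g := fun p => g' p.1) hc0 hc1 Subset.rfl
    (hg.comp continuousOn_fst fun p hp => (hs0 hp.2).1)
    (hg'.comp continuousOn_fst fun p hp => hp.2.1) (by
      rintro ⟨x, t⟩ _ (h | h) h'
      · have h1 : t = 0 := h.2
        have h2 : t = 1 := h'.2
        linarith
      · exact (hgg' h.1).symm)
  obtain ⟨H, hHc, hHZ, hHf⟩ := hZ (X × ℝ) (D ×ˢ Icc (0 : ℝ) 1)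
    ((D ×ˢ {(0 : ℝ)} ∪ E ×ˢ Icc (0 : ℝ) 1) ∪ D ×ˢ {(1 : ℝ)}) f hD.prod_Icc (hc0.union hc1)
    (by
      rintro ⟨x, t⟩ ((h | h) | h)
      · exact ⟨h.1, by rw [show t = 0 from h.2]; exact hzero⟩
      · exact ⟨hED h.1, h.2⟩
      · exact ⟨h.1, by rw [show t = 1 from h.2]; exact hone⟩) hf
    (by
      rintro p (h | h)
      · rw [hfA ⟨Or.inl h, h⟩]
        exact hgZ (hs0 h).1
      · rw [hfB ⟨Or.inr h, h⟩]
        exact hAZ (hgA' h.1))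
  refine ⟨H, hHc, hHZ, fun x hx => ?_, fun x hx => ?_, fun x hx t ht => ?_⟩
  · have h : (x, (0 : ℝ)) ∈ D ×ˢ {(0 : ℝ)} ∪ E ×ˢ Icc (0 : ℝ) 1 := Or.inl ⟨hx, rfl⟩
    rw [hHf (Or.inl h), hfA ⟨Or.inl h, h⟩]
  · have h : (x, (1 : ℝ)) ∈ D ×ˢ {(1 : ℝ)} := ⟨hx, rfl⟩
    rw [hHf (Or.inr h), hfB ⟨Or.inr h, h⟩]
    exact hgA' hx
  · have h : (x, t) ∈ D ×ˢ {(0 : ℝ)} ∪ E ×ˢ Icc (0 : ℝ) 1 := Or.inr ⟨hx, ht⟩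
    rw [hHf (Or.inl h), hfA ⟨Or.inl h, h⟩]

section Halves

variable {X : Type} [MetricSpace X]

/-- The closed set of points at least as close to `A` as to `B`. -/
def nearer (A B : Set X) : Set X := {x | Metric.infDist x A ≤ Metric.infDist x B}

theorem isClosed_nearer (A B : Set X) : IsClosed (nearer A B) :=
  isClosed_le (Metric.continuous_infDist_pt A) (Metric.continuous_infDist_pt B)

theorem mem_nearer_or (A B : Set X) (x : X) : x ∈ nearer A B ∨ x ∈ nearer B A :=
  le_total (Metric.infDist x A) (Metric.infDist x B)

theorem subset_nearer (A B : Set X) : A ⊆ nearer A B := fun x hx => by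
  simp only [nearer, mem_ofPred_eq, Metric.infDist_zero_of_mem hx]
  exact Metric.infDist_nonneg

theorem mem_of_mem_nearer {A B : Set X} (hA : IsClosed A) (hne : A.Nonempty) {x : X} (hx : x ∈ B)
    (h : x ∈ nearer A B) : x ∈ A := by
  rw [hA.mem_iff_infDist_zero hne]
  simp only [nearer, mem_ofPred_eq, Metric.infDist_zero_of_mem hx] at h
  exact le_antisymm h Metric.infDist_nonneg

end Halves

theorem IsExtensor.union {m : ℕ} {A B : Set V} (hAc : IsClosed A) (hBc : IsClosed B)
    (hA : IsExtensor m A) (hB : IsExtensor m B) (hAB : IsExtensor m (A ∩ B)) :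
    IsExtensor m (A ∪ B) := by
  intro X _ D E f hD hE hED hf hfAB
  set EA := E ∩ f ⁻¹' A with hEA
  set EB := E ∩ f ⁻¹' B with hEB
  have hEAc : IsClosed EA := hf.preimage_isClosed_of_isClosed hE hAc
  have hEBc : IsClosed EB := hf.preimage_isClosed_of_isClosed hE hBc
  have hcov : ∀ x ∈ E, x ∈ EA ∨ x ∈ EB := fun x hx =>
    (hfAB hx).imp (fun h => ⟨hx, h⟩) fun h => ⟨hx, h⟩
  rcases EA.eq_empty_or_nonempty with hAe | hAne
  · obtain ⟨g, hg, hgB, hgf⟩ := hB X D E f hD hE hED hf fun x hx =>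
      ((hcov x hx).resolve_left (by simp [hAe])).2
    exact ⟨g, hg, fun x hx => Or.inr (hgB hx), hgf⟩
  rcases EB.eq_empty_or_nonempty with hBe | hBne
  · obtain ⟨g, hg, hgB, hgf⟩ := hA X D E f hD hE hED hf fun x hx =>
      ((hcov x hx).resolve_right (by simp [hBe])).2
    exact ⟨g, hg, fun x hx => Or.inl (hgB hx), hgf⟩
  set DA := D ∩ nearer EA EB
  set DB := D ∩ nearer EB EA
  have hDA : IsClosed DA := hD.isClosed.inter (isClosed_nearer _ _)
  have hDB : IsClosed DB := hD.isClosed.inter (isClosed_nearer _ _)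
  have hDAE : ∀ x ∈ E, x ∈ DA → x ∈ EA := fun x hx h =>
    (hcov x hx).elim id fun h' => mem_of_mem_nearer hEAc hAne h' h.2
  have hDBE : ∀ x ∈ E, x ∈ DB → x ∈ EB := fun x hx h =>
    (hcov x hx).elim (fun h' => mem_of_mem_nearer hEBc hBne h' h.2) id
  have hEDA : EA ⊆ DA := fun x hx => ⟨hED hx.1, subset_nearer _ _ hx⟩
  have hEDB : EB ⊆ DB := fun x hx => ⟨hED hx.1, subset_nearer _ _ hx⟩
  obtain ⟨g0, hg0, hg0AB, hg0f⟩ := hAB X (DA ∩ DB) (EA ∩ EB) f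
    (hD.subset (hDA.inter hDB) fun x hx => hx.1.1) (hEAc.inter hEBc)
    (inter_subset_inter hEDA hEDB) (hf.mono fun x hx => hx.1.1) fun x hx => ⟨hx.1.2, hx.2.2⟩
  have side : ∀ (C : Set V) (DC EC : Set X), IsExtensor m C → A ∩ B ⊆ C → IsClosed DC → DC ⊆ D →
      IsClosed EC → EC ⊆ DC → EC ⊆ E → MapsTo f EC C → DA ∩ DB ⊆ DC →
      ∃ g : X → V, ContinuousOn g DC ∧ MapsTo g DC C ∧ EqOn g f EC ∧ EqOn g g0 (DA ∩ DB) := by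
    intro C DC EC hC hABC hDC hDCD hEC hECD hECE hfC hDD
    obtain ⟨h, hh, hh1, hh2⟩ := exists_glue (s := EC ∪ DA ∩ DB) hEC (hDA.inter hDB) Subset.rfl
      (hf.mono fun x hx => hECE hx.2) (hg0.mono fun x hx => hx.2)
      fun x _ h1 h2 => (hg0f ⟨hDAE x (hECE h1) h2.1, hDBE x (hECE h1) h2.2⟩).symm
    obtain ⟨g, hg, hgC, hgh⟩ := hC X DC (EC ∪ DA ∩ DB) h (hD.subset hDC hDCD)
      (hEC.union (hDA.inter hDB)) (union_subset hECD hDD) hh (by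
        rintro x (hx | hx)
        · rw [hh1 ⟨Or.inl hx, hx⟩]
          exact hfC hx
        · rw [hh2 ⟨Or.inr hx, hx⟩]
          exact hABC (hg0AB hx))
    refine ⟨g, hg, hgC, fun x hx => ?_, fun x hx => ?_⟩
    · rw [hgh (Or.inl hx), hh1 ⟨Or.inl hx, hx⟩]
    · rw [hgh (Or.inr hx), hh2 ⟨Or.inr hx, hx⟩]
  obtain ⟨gA, hgA, hgAA, hgAf, hgA0⟩ := side A DA EA hA inter_subset_left hDA inter_subset_left
    hEAc hEDA inter_subset_left (fun x hx => hx.2) inter_subset_left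
  obtain ⟨gB, hgB, hgBB, hgBf, hgB0⟩ := side B DB EB hB inter_subset_right hDB inter_subset_left
    hEBc hEDB inter_subset_left (fun x hx => hx.2) inter_subset_right
  have hDcov : ∀ x ∈ D, x ∈ DA ∨ x ∈ DB := fun x hx =>
    (mem_nearer_or EA EB x).imp (fun h => ⟨hx, h⟩) fun h => ⟨hx, h⟩
  obtain ⟨g, hg, hg1, hg2⟩ := exists_glue (s := D) hDA hDB hDcov (hgA.mono inter_subset_right)
    (hgB.mono inter_subset_right) fun x _ h1 h2 => by rw [hgA0 ⟨h1, h2⟩, hgB0 ⟨h1, h2⟩]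
  refine ⟨g, hg, fun x hx => ?_, fun x hx => ?_⟩
  · rcases hDcov x hx with h | h
    · rw [hg1 ⟨hx, h⟩]
      exact Or.inl (hgAA h)
    · rw [hg2 ⟨hx, h⟩]
      exact Or.inr (hgBB h)
  · rcases hcov x hx with h | h
    · rw [hg1 ⟨hED hx, hEDA h⟩, hgAf h]
    · rw [hg2 ⟨hED hx, hEDB h⟩, hgBf h]

theorem IsNhdExtensor.union {A B : Set V} (hAc : IsClosed A) (hBc : IsClosed B)
    (hA : IsNhdExtensor A) (hB : IsNhdExtensor B) (hAB : IsNhdExtensor (A ∩ B)) :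
    IsNhdExtensor (A ∪ B) := by
  intro X _ E f hE hf hfAB
  set EA := E ∩ f ⁻¹' A with hEA
  set EB := E ∩ f ⁻¹' B with hEB
  have hEAc : IsClosed EA := hf.preimage_isClosed_of_isClosed hE hAc
  have hEBc : IsClosed EB := hf.preimage_isClosed_of_isClosed hE hBc
  have hcov : ∀ x ∈ E, x ∈ EA ∨ x ∈ EB := fun x hx =>
    (hfAB hx).imp (fun h => ⟨hx, h⟩) fun h => ⟨hx, h⟩
  rcases EA.eq_empty_or_nonempty with hAe | hAne
  · obtain ⟨O, g, hO, hEO, hg, hgB, hgf⟩ := hB X E f hE hf fun x hx =>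
      ((hcov x hx).resolve_left (by simp [hAe])).2
    exact ⟨O, g, hO, hEO, hg, fun x hx => Or.inr (hgB hx), hgf⟩
  rcases EB.eq_empty_or_nonempty with hBe | hBne
  · obtain ⟨O, g, hO, hEO, hg, hgB, hgf⟩ := hA X E f hE hf fun x hx =>
      ((hcov x hx).resolve_right (by simp [hBe])).2
    exact ⟨O, g, hO, hEO, hg, fun x hx => Or.inl (hgB hx), hgf⟩
  set DA := nearer EA EB
  set DB := nearer EB EA
  have hDA : IsClosed DA := isClosed_nearer _ _
  have hDB : IsClosed DB := isClosed_nearer _ _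
  have hDAE : ∀ x ∈ E, x ∈ DA → x ∈ EA := fun x hx h =>
    (hcov x hx).elim id fun h' => mem_of_mem_nearer hEAc hAne h' h
  have hDBE : ∀ x ∈ E, x ∈ DB → x ∈ EB := fun x hx h =>
    (hcov x hx).elim (fun h' => mem_of_mem_nearer hEBc hBne h' h) id
  have hEDA : EA ⊆ DA := fun x hx => subset_nearer _ _ hx
  have hEDB : EB ⊆ DB := fun x hx => subset_nearer _ _ hx
  obtain ⟨O0, g0, hO0, hEO0, hg0, hg0AB, hg0f⟩ := hAB X (EA ∩ EB) f (hEAc.inter hEBc)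
    (hf.mono fun x hx => hx.1.1) fun x hx => ⟨hx.1.2, hx.2.2⟩
  obtain ⟨U, hU, hEU, hUO⟩ := normal_exists_closure_subset (hEAc.inter hEBc) hO0 hEO0
  set K := (DA ∩ DB) ∩ closure U
  have hK : IsClosed K := (hDA.inter hDB).inter isClosed_closure
  have hKO : K ⊆ O0 := fun x hx => hUO hx.2
  have side : ∀ (C : Set V) (EC : Set X), IsNhdExtensor C → A ∩ B ⊆ C →
      IsClosed EC → EC ⊆ E → MapsTo f EC C →
      ∃ (O : Set X) (g : X → V), IsOpen O ∧ EC ∪ K ⊆ O ∧ ContinuousOn g O ∧ MapsTo g O C ∧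
        EqOn g f EC ∧ EqOn g g0 K := by
    intro C EC hC hABC hEC hECE hfC
    obtain ⟨h, hh, hh1, hh2⟩ := exists_glue (s := EC ∪ K) hEC hK Subset.rfl
      (hf.mono fun x hx => hECE hx.2) (hg0.mono fun x hx => hKO hx.2)
      fun x _ h1 h2 => (hg0f ⟨hDAE x (hECE h1) h2.1.1, hDBE x (hECE h1) h2.1.2⟩).symm
    obtain ⟨O, g, hO, hEO, hg, hgC, hgh⟩ := hC X (EC ∪ K) h (hEC.union hK) hh (by
        rintro x (hx | hx)
        · rw [hh1 ⟨Or.inl hx, hx⟩]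
          exact hfC hx
        · rw [hh2 ⟨Or.inr hx, hx⟩]
          exact hABC (hg0AB (hKO hx)))
    refine ⟨O, g, hO, hEO, hg, hgC, fun x hx => ?_, fun x hx => ?_⟩
    · rw [hgh (Or.inl hx), hh1 ⟨Or.inl hx, hx⟩]
    · rw [hgh (Or.inr hx), hh2 ⟨Or.inr hx, hx⟩]
  obtain ⟨OA, gA, hOA, hEOA, hgA, hgAA, hgAf, hgA0⟩ := side A EA hA inter_subset_left
    hEAc inter_subset_left (fun x hx => hx.2)
  obtain ⟨OB, gB, hOB, hEOB, hgB, hgBB, hgBf, hgB0⟩ := side B EB hB inter_subset_right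
    hEBc inter_subset_left (fun x hx => hx.2)
  set O := (DAᶜ ∪ OA) ∩ (DBᶜ ∪ OB) ∩ ((DA ∩ DB)ᶜ ∪ U)
  have hO : IsOpen O := ((hDA.isOpen_compl.union hOA).inter (hDB.isOpen_compl.union hOB)).inter
    ((hDA.inter hDB).isOpen_compl.union hU)
  have hOA' : O ∩ DA ⊆ OA := fun x hx => hx.1.1.1.resolve_left fun h => h hx.2
  have hOB' : O ∩ DB ⊆ OB := fun x hx => hx.1.1.2.resolve_left fun h => h hx.2
  obtain ⟨g, hg, hg1, hg2⟩ := exists_glue (s := O) hDA hDB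
    (fun x _ => mem_nearer_or EA EB x) (hgA.mono hOA') (hgB.mono hOB') fun x hx h1 h2 => by
      have hxK : x ∈ K := ⟨⟨h1, h2⟩, subset_closure (hx.2.resolve_left fun h => h ⟨h1, h2⟩)⟩
      rw [hgA0 hxK, hgB0 hxK]
  have hEO : E ⊆ O := by
    intro x hx
    refine ⟨⟨?_, ?_⟩, ?_⟩
    · by_cases h : x ∈ DA
      · exact Or.inr (hEOA (Or.inl (hDAE x hx h)))
      · exact Or.inl h
    · by_cases h : x ∈ DB
      · exact Or.inr (hEOB (Or.inl (hDBE x hx h)))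
      · exact Or.inl h
    · by_cases h : x ∈ DA ∩ DB
      · exact Or.inr (hEU ⟨hDAE x hx h.1, hDBE x hx h.2⟩)
      · exact Or.inl h
  refine ⟨O, g, hO, hEO, hg, fun x hx => ?_, fun x hx => ?_⟩
  · rcases mem_nearer_or EA EB x with h | h
    · rw [hg1 ⟨hx, h⟩]
      exact Or.inl (hgAA (hOA' ⟨hx, h⟩))
    · rw [hg2 ⟨hx, h⟩]
      exact Or.inr (hgBB (hOB' ⟨hx, h⟩))
  · rcases hcov x hx with h | h
    · rw [hg1 ⟨hEO hx, hEDA h⟩, hgAf h]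
    · rw [hg2 ⟨hEO hx, hEDB h⟩, hgBf h]

theorem isClosed_biUnion_finset_of {ι : Type*} {s : Finset ι} {C : ι → Set V}
    (hc : ∀ i ∈ s, IsClosed (C i)) : IsClosed (⋃ i ∈ s, C i) :=
  s.finite_toSet.isClosed_biUnion hc

/-- If `W` compresses to an extensor `B` in dimensions less than `m`, then `W` is an extensor in
one more dimension. -/
theorem IsNhdExtensor.isExtensor_succ {m : ℕ} {W B : Set V} (hW : IsNhdExtensor W) (hBW : B ⊆ W)
    (hB : IsExtensor (m + 1) B) (h : Compressible m W B) : IsExtensor (m + 1) W := by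
  intro X _ D E f hD hE hED hf hfW
  obtain ⟨O, f', hO, hEO, hf', hfW', hff'⟩ := hW X E f hE hf hfW
  obtain ⟨K, L, hK, hL, hKL, hEK, hKO, hS⟩ := hD.exists_separator hE hED hO hEO
  have hLD : L ⊆ D := hKL ▸ subset_union_right
  obtain ⟨H, hHc, hHW, hH0, hH1, -⟩ := h X (K ∩ L) ∅ f' hS isClosed_empty (empty_subset _)
    (hf'.mono fun x hx => hKO hx.1) (fun x hx => hfW' (hKO hx.1)) fun x hx => hx.elim
  have hzero : (0 : ℝ) ∈ Icc (0 : ℝ) 1 := by simp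
  have hone : (1 : ℝ) ∈ Icc (0 : ℝ) 1 := by simp
  obtain ⟨b, hb, hbB, hbH⟩ := hB X L (K ∩ L) (fun x => H (x, 1)) (hD.subset hL hLD)
    (hK.inter hL) inter_subset_right (hHc.comp (by fun_prop) fun x hx => ⟨hx, hone⟩) hH1
  have hc1 : IsClosed (L ×ˢ {(1 : ℝ)}) := hL.prod isClosed_singleton
  have hc2 : IsClosed ((K ∩ L) ×ˢ Icc (0 : ℝ) 1) := (hK.inter hL).prod isClosed_Icc
  obtain ⟨c, hc, hcb, hcH⟩ := exists_glue (s := L ×ˢ {(1 : ℝ)} ∪ (K ∩ L) ×ˢ Icc (0 : ℝ) 1)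
    (f := fun p => b p.1) (g := H) hc1 hc2 Subset.rfl
    (hb.comp continuousOn_fst fun p hp => hp.2.1) (hHc.mono fun p hp => hp.2) (by
      rintro ⟨x, t⟩ _ h1 h2
      have ht : t = 1 := h1.2
      subst ht
      exact hbH h2.1)
  obtain ⟨O', G, hO', hCO', hG, hGW, hGc⟩ := hW (X × ℝ) _ c (hc1.union hc2) hc (by
    rintro p (hp | hp)
    · rw [hcb ⟨Or.inl hp, hp⟩]
      exact hBW (hbB hp.1)
    · rw [hcH ⟨Or.inr hp, hp⟩]
      exact hHW hp)
  have hT : IsOpen {x : X | ∀ t ∈ Icc (0 : ℝ) 1, (x, t) ∈ O'} := by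
    rw [isOpen_iff_mem_nhds]
    intro x hx
    have := isCompact_Icc.eventually_forall_of_forall_eventually (x₀ := x)
      (P := fun x t => (x, t) ∈ O') (K := Icc (0 : ℝ) 1) fun t ht => by
        have := hO'.mem_nhds (hx t ht)
        exact this
    exact this
  obtain ⟨τ, hτ0, hτ1, hτ⟩ := exists_continuous_zero_one_of_isClosed (hK.inter hL)
    hT.isClosed_compl (by
      refine disjoint_left.2 fun x hx hx' => hx' fun t ht => hCO' (Or.inr ⟨hx, ht⟩))
  have hτO : ∀ x ∈ L, (x, τ x) ∈ O' := by
    intro x hx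
    by_cases hxT : x ∈ {x : X | ∀ t ∈ Icc (0 : ℝ) 1, (x, t) ∈ O'}
    · exact hxT _ (hτ x)
    · have h1 : τ x = 1 := hτ1 hxT
      rw [h1]
      exact hCO' (Or.inl ⟨hx, rfl⟩)
  obtain ⟨g, hg, hgK, hgL⟩ := exists_glue (s := D) (f := f') (g := fun x => G (x, τ x)) hK hL
    hKL.ge (hf'.mono fun x hx => hKO hx.2)
    (hG.comp (by fun_prop) fun x hx => hτO x hx.2) (by
      intro x _ h1 h2
      have hx : (x, (0 : ℝ)) ∈ (K ∩ L) ×ˢ Icc (0 : ℝ) 1 := ⟨⟨h1, h2⟩, hzero⟩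
      have h0 : τ x = 0 := hτ0 ⟨h1, h2⟩
      simp only [h0]
      rw [hGc (Or.inr hx), hcH ⟨Or.inr hx, hx⟩, hH0 x ⟨h1, h2⟩])
  refine ⟨g, hg, fun x hx => ?_, fun x hx => ?_⟩
  · rcases hKL.ge hx with h | h
    · rw [hgK ⟨hx, h⟩]
      exact hfW' (hKO h)
    · rw [hgL ⟨hx, h⟩]
      exact hGW (hτO x h)
  · rw [hgK ⟨hED hx, hEK hx⟩, hff' hx]

/-! ### Expansions along convex cells -/

/-- `Z` arises from `A` by attaching extensors along extensors. -/
def Expands (Z A : Set V) : Prop :=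
  A ⊆ Z ∧ ∀ m, Compressible m Z A ∧ (IsExtensor m A → IsExtensor m Z)

theorem Expands.refl (A : Set V) : Expands A A :=
  ⟨Subset.rfl, fun m => ⟨compressible_refl m A, id⟩⟩

theorem Expands.trans {Y Z A : Set V} (h₁ : Expands Y Z) (h₂ : Expands Z A) : Expands Y A :=
  ⟨h₂.1.trans h₁.1, fun m => ⟨(h₁.2 m).1.trans (h₂.2 m).1 h₂.1 h₁.1,
    fun h => (h₁.2 m).2 ((h₂.2 m).2 h)⟩⟩

theorem Expands.isExtensor_iff {Z A : Set V} (h : Expands Z A) (m : ℕ) :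
    IsExtensor m Z ↔ IsExtensor m A :=
  ⟨fun hZ => (h.2 m).1.isExtensor hZ h.1, (h.2 m).2⟩

theorem expands_union {A C : Set V} (hA : IsClosed A) (hC : IsClosed C)
    (hCe : ∀ m, IsExtensor m C) (hAC : ∀ m, IsExtensor m (A ∩ C)) : Expands (A ∪ C) A :=
  ⟨subset_union_left, fun m => ⟨Compressible.union hA hC
    ((hAC m).compressible (hCe (m + 1)) inter_subset_right),
    fun h => IsExtensor.union hA hC h (hCe m) (hAC m)⟩⟩

end Extensors

/-! ### Unions of convex sets -/

section ConvexUnions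

variable {V : Type} [NormedAddCommGroup V] [InnerProductSpace ℝ V] [FiniteDimensional ℝ V]

theorem exists_convex_retraction {C : Set V} (hc : IsClosed C) (hconv : Convex ℝ C)
    (hne : C.Nonempty) : ∃ p : V → V, Continuous p ∧ (∀ x, p x ∈ C) ∧ ∀ x ∈ C, p x = x := by
  have h : ∀ x : V, ∃ v ∈ C, ∀ w ∈ C, ⟪x - v, w - v⟫ ≤ 0 := by
    intro x
    obtain ⟨v, hv, hv'⟩ := exists_norm_eq_iInf_of_complete_convex hne hc.isComplete hconv x
    exact ⟨v, hv, (norm_eq_iInf_iff_real_inner_le_zero hconv hv).1 hv'⟩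
  choose p hpC hp using h
  have hlip : ∀ x y, dist (p x) (p y) ≤ dist x y := by
    intro x y
    rw [dist_eq_norm, dist_eq_norm]
    have h1 := hp x (p y) (hpC y)
    have h2 := hp y (p x) (hpC x)
    have h3 : ⟪x - y, p x - p y⟫ = ⟪p x - p y, p x - p y⟫ - ⟪x - p x, p y - p x⟫
        - ⟪y - p y, p x - p y⟫ := by
      simp only [inner_sub_left, inner_sub_right]
      ring
    have h4 := real_inner_le_norm (x - y) (p x - p y)
    rw [real_inner_self_eq_norm_sq] at h3
    by_contra hlt
    push Not at hlt
    nlinarith [norm_nonneg (x - y), norm_nonneg (p x - p y)]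
  refine ⟨p, (LipschitzWith.of_dist_le_mul (K := 1) (by simpa using hlip)).continuous, hpC,
    fun x hx => ?_⟩
  have := hp x x hx
  rw [real_inner_self_eq_norm_sq] at this
  have h0 : ‖x - p x‖ = 0 := by nlinarith [norm_nonneg (x - p x)]
  exact (sub_eq_zero.1 (norm_eq_zero.1 h0)).symm

theorem Convex.exists_extension {C : Set V} (hconv : Convex ℝ C) (hc : IsClosed C)
    (hne : C.Nonempty) {X : Type} [MetricSpace X] {E : Set X} {f : X → V} (hE : IsClosed E)
    (hf : ContinuousOn f E) (hfC : MapsTo f E C) :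
    ∃ g : X → V, Continuous g ∧ (∀ x, g x ∈ C) ∧ EqOn g f E := by
  obtain ⟨p, hp, hpC, hpid⟩ := exists_convex_retraction hc hconv hne
  obtain ⟨g, hg⟩ := ContinuousMap.exists_restrict_eq hE (⟨E.domRestrict f, hf.domRestrict⟩ : C(E, V))
  refine ⟨p ∘ g, hp.comp g.continuous, fun x => hpC _, fun x hx => ?_⟩
  have : g x = f x := congrArg (fun h : C(E, V) => h ⟨x, hx⟩) hg
  simp [this, hpid _ (hfC hx)]

theorem Convex.isExtensor {C : Set V} (hconv : Convex ℝ C) (hc : IsClosed C)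
    (hne : C.Nonempty) (m : ℕ) : IsExtensor m C := by
  intro X _ D E f hD hE hED hf hfC
  obtain ⟨g, hg, hgC, hgf⟩ := hconv.exists_extension hc hne hE hf hfC
  exact ⟨g, hg.continuousOn, fun x _ => hgC x, hgf⟩

theorem Convex.isNhdExtensor {C : Set V} (hconv : Convex ℝ C) (hc : IsClosed C) :
    IsNhdExtensor C := by
  intro X _ E f hE hf hfC
  rcases C.eq_empty_or_nonempty with he | hne
  · subst he
    have : E = ∅ := eq_empty_of_forall_notMem fun x hx => hfC hx
    subst this
    exact ⟨∅, f, isOpen_empty, Subset.rfl, hf, hfC, fun x hx => rfl⟩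
  · obtain ⟨g, hg, hgC, hgf⟩ := hconv.exists_extension hc hne hE hf hfC
    exact ⟨univ, g, isOpen_univ, subset_univ _, hg.continuousOn, fun x _ => hgC x, hgf⟩

/-- A finite union of closed convex sets is a neighbourhood extensor. -/
theorem isNhdExtensor_biUnion {ι : Type*} (s : Finset ι) (C : ι → Set V)
    (hc : ∀ i ∈ s, IsClosed (C i)) (hconv : ∀ i ∈ s, Convex ℝ (C i)) :
    IsNhdExtensor (⋃ i ∈ s, C i) := by
  classical
  induction s using Finset.induction_on generalizing C with
  | empty => simpa using (convex_empty (𝕜 := ℝ) (E := V)).isNhdExtensor isClosed_empty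
  | insert a s ha ih =>
    rw [Finset.set_biUnion_insert]
    have hcs : ∀ i ∈ s, IsClosed (C i) := fun i hi => hc i (Finset.mem_insert_of_mem hi)
    have hvs : ∀ i ∈ s, Convex ℝ (C i) := fun i hi => hconv i (Finset.mem_insert_of_mem hi)
    have hca := hc a (Finset.mem_insert_self _ _)
    have hva := hconv a (Finset.mem_insert_self _ _)
    refine IsNhdExtensor.union hca (isClosed_biUnion_finset_of hcs) (hva.isNhdExtensor hca)
      (ih C hcs hvs) ?_
    rw [inter_iUnion₂]
    exact ih _ (fun i hi => hca.inter (hcs i hi)) fun i hi => hva.inter (hvs i hi)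

/-- A finite union of closed convex sets with a common point is an extensor. -/
theorem isExtensor_biUnion_of_mem {ι : Type*} (s : Finset ι) (hs : s.Nonempty) (C : ι → Set V)
    (hc : ∀ i ∈ s, IsClosed (C i)) (hconv : ∀ i ∈ s, Convex ℝ (C i)) (v : V)
    (hv : ∀ i ∈ s, v ∈ C i) (m : ℕ) : IsExtensor m (⋃ i ∈ s, C i) := by
  classical
  induction hs using Finset.Nonempty.cons_induction generalizing C with
  | singleton a =>
    simp only [Finset.mem_singleton, iUnion_iUnion_eq_left]
    exact (hconv a (by simp)).isExtensor (hc a (by simp)) ⟨v, hv a (by simp)⟩ m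
  | cons a s ha _ ih =>
    rw [Finset.cons_eq_insert, Finset.set_biUnion_insert]
    have hsub : ∀ i ∈ s, i ∈ Finset.cons a s ha := fun i hi => Finset.mem_cons_of_mem hi
    have hcs : ∀ i ∈ s, IsClosed (C i) := fun i hi => hc i (hsub i hi)
    have hvs : ∀ i ∈ s, Convex ℝ (C i) := fun i hi => hconv i (hsub i hi)
    have hvv : ∀ i ∈ s, v ∈ C i := fun i hi => hv i (hsub i hi)
    have hca := hc a (Finset.mem_cons_self _ _)
    have hva := hconv a (Finset.mem_cons_self _ _)
    have hvva := hv a (Finset.mem_cons_self _ _)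
    refine IsExtensor.union hca (isClosed_biUnion_finset_of hcs) (hva.isExtensor hca ⟨v, hvva⟩ m)
      (ih C hcs hvs hvv) ?_
    rw [inter_iUnion₂]
    exact ih _ (fun i hi => hca.inter (hcs i hi)) (fun i hi => hva.inter (hvs i hi))
      fun i hi => ⟨hvva, hvv i hi⟩

end ConvexUnions

/-! ### Cell systems -/

/-- The cell of `Q` on which the constraints in `S` are active. -/
def cell {V τ : Type*} (Q : Set V) (H : τ → Set V) (S : Set τ) : Set V := Q ∩ ⋂ t ∈ S, H t

/-- The union of a family of cells. -/
def cells {V τ : Type*} (Q : Set V) (H : τ → Set V) (𝓕 : Set (Set τ)) : Set V :=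
  ⋃ S ∈ 𝓕, cell Q H S

section Cells

variable {V τ : Type*} {Q : Set V} {H : τ → Set V} {S T : Set τ} {𝓕 𝓖 : Set (Set τ)} {x : V}

theorem mem_cell : x ∈ cell Q H S ↔ x ∈ Q ∧ ∀ t ∈ S, x ∈ H t := by
  simp [cell]

theorem mem_cells_of_mem (hS : S ∈ 𝓕) (hx : x ∈ cell Q H S) : x ∈ cells Q H 𝓕 :=
  mem_iUnion₂.2 ⟨S, hS, hx⟩

theorem mem_cells' : x ∈ cells Q H 𝓕 ↔ ∃ S ∈ 𝓕, x ∈ cell Q H S := by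
  simp [cells]

theorem mem_cells (h : IsUpperSet 𝓕) : x ∈ cells Q H 𝓕 ↔ x ∈ Q ∧ {t | x ∈ H t} ∈ 𝓕 := by
  rw [mem_cells']
  constructor
  · rintro ⟨S, hS, hx⟩
    rw [mem_cell] at hx
    exact ⟨hx.1, h (fun t ht => hx.2 t ht) hS⟩
  · rintro ⟨hx, hS⟩
    exact ⟨_, hS, mem_cell.2 ⟨hx, fun t ht => ht⟩⟩

theorem cell_anti (h : S ⊆ T) : cell Q H T ⊆ cell Q H S := fun x hx => by
  rw [mem_cell] at hx ⊢
  exact ⟨hx.1, fun t ht => hx.2 t (h ht)⟩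

theorem cells_mono (h : 𝓕 ⊆ 𝓖) : cells Q H 𝓕 ⊆ cells Q H 𝓖 :=
  biUnion_subset_biUnion_left h

theorem isClosed_cell [TopologicalSpace V] (hQ : IsClosed Q) (hH : ∀ t, IsClosed (H t))
    (S : Set τ) : IsClosed (cell Q H S) :=
  hQ.inter (isClosed_biInter fun t _ => hH t)

theorem isClosed_cells [TopologicalSpace V] [Finite τ] (hQ : IsClosed Q)
    (hH : ∀ t, IsClosed (H t)) (𝓕 : Set (Set τ)) : IsClosed (cells Q H 𝓕) :=
  (toFinite 𝓕).isClosed_biUnion fun S _ => isClosed_cell hQ hH S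

theorem convex_cell [AddCommGroup V] [Module ℝ V] (hQ : Convex ℝ Q) (hH : ∀ t, Convex ℝ (H t))
    (S : Set τ) : Convex ℝ (cell Q H S) :=
  hQ.inter (convex_iInter₂ fun t _ => hH t)

end Cells

section CellExpansion

variable {V : Type} [NormedAddCommGroup V] [InnerProductSpace ℝ V] [FiniteDimensional ℝ V]
  {τ : Type*} [Finite τ] {Q F : Set V} {H : τ → Set V}

/-- A family of faces of a cell, together with a convex piece of it meeting all these faces, is
an extensor. -/
theorem isExtensor_cells_union (hQc : IsClosed Q) (hQ : Convex ℝ Q) (hHc : ∀ t, IsClosed (H t))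
    (hH : ∀ t, Convex ℝ (H t)) (hFc : IsClosed F) (hF : Convex ℝ F) (m : ℕ) (𝓤 : Set (Set τ))
    (h𝓤 : IsUpperSet 𝓤) (S : Set τ) (hS : ∀ T ∈ 𝓤, S ⊆ T) (hSne : (cell Q H S).Nonempty)
    (hmeet : ∀ T, S ⊆ T → (cell Q H T).Nonempty → (cell Q H T ∩ F).Nonempty) :
    IsExtensor m (cells Q H 𝓤 ∪ cell Q H S ∩ F) := by
  induction hn : 𝓤.ncard using Nat.strong_induction_on generalizing 𝓤 S with
  | _ n ih =>
  subst hn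
  have hSF : IsClosed (cell Q H S ∩ F) := (isClosed_cell hQc hHc S).inter hFc
  rcases 𝓤.eq_empty_or_nonempty with he | hne
  · subst he
    simp only [cells, mem_empty_iff_false, iUnion_of_empty, iUnion_empty, empty_union]
    exact ((convex_cell hQ hH S).inter hF).isExtensor hSF (hmeet S Subset.rfl hSne) m
  obtain ⟨T, hTmin⟩ := (toFinite 𝓤).exists_minimal hne
  have hT := hTmin.1
  have hrem : IsUpperSet (𝓤 \ {T}) := fun A B hAB hA =>
    ⟨h𝓤 hAB hA.1, fun h => hA.2 (by
      rw [mem_singleton_iff] at h ⊢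
      subst h
      exact le_antisymm hAB (hTmin.2 hA.1 hAB))⟩
  have hcard : (𝓤 \ {T}).ncard < 𝓤.ncard := ncard_sdiff_singleton_lt_of_mem hT (toFinite _)
  have hrec := ih _ hcard (𝓤 \ {T}) hrem S (fun U hU => hS U hU.1) hSne hmeet rfl
  have hsplit : cells Q H 𝓤 ∪ cell Q H S ∩ F =
      (cells Q H (𝓤 \ {T}) ∪ cell Q H S ∩ F) ∪ cell Q H T := by
    rw [union_right_comm]
    congr 1
    ext x
    simp only [mem_union, mem_cells']
    constructor
    · rintro ⟨U, hU, hx⟩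
      by_cases hUT : U = T
      · exact Or.inr (hUT ▸ hx)
      · exact Or.inl ⟨U, ⟨hU, hUT⟩, hx⟩
    · rintro (⟨U, hU, hx⟩ | hx)
      · exact ⟨U, hU.1, hx⟩
      · exact ⟨T, hT, hx⟩
  rw [hsplit]
  rcases (cell Q H T).eq_empty_or_nonempty with hTe | hTne
  · rw [hTe, union_empty]
    exact hrec
  refine IsExtensor.union ((isClosed_cells hQc hHc _).union hSF) (isClosed_cell hQc hHc T) hrec
    ((convex_cell hQ hH T).isExtensor (isClosed_cell hQc hHc T) hTne m) ?_
  have hinter : (cells Q H (𝓤 \ {T}) ∪ cell Q H S ∩ F) ∩ cell Q H T =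
      cells Q H {U | T ⊂ U} ∪ cell Q H T ∩ F := by
    ext x
    simp only [mem_inter_iff, mem_union, mem_cells']
    constructor
    · rintro ⟨⟨U, hU, hx⟩ | hx, hxT⟩
      · refine Or.inl ⟨T ∪ U, ?_, ?_⟩
        · refine ⟨subset_union_left, fun h => hU.2 ?_⟩
          have hUT : U ⊆ T := (subset_union_right).trans h
          exact hUT.antisymm (hTmin.2 hU.1 hUT)
        · rw [mem_cell] at *
          exact ⟨hx.1, fun t ht => ht.elim (hxT.2 t) (hx.2 t)⟩
      · exact Or.inr ⟨hxT, hx.2⟩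
    · rintro (⟨U, hU, hx⟩ | hx)
      · exact ⟨Or.inl ⟨U, ⟨h𝓤 hU.1 hT, fun h => hU.2 (h ▸ Subset.rfl)⟩, hx⟩, cell_anti hU.1 hx⟩
      · exact ⟨Or.inr ⟨cell_anti (hS T hT) hx.1, hx.2⟩, hx.1⟩
  rw [hinter]
  refine ih _ ?_ {U | T ⊂ U} (fun A B hAB hA => lt_of_lt_of_le hA hAB) T (fun U hU => hU.1) hTne
    (fun U hTU => hmeet U ((hS T hT).trans hTU)) rfl
  refine lt_of_le_of_lt (ncard_le_ncard ?_ (toFinite _)) hcard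
  exact fun U hU => ⟨h𝓤 hU.1 hT, fun h => hU.2 (h ▸ Subset.rfl)⟩

/-- A union of cells expands from a subfamily together with a convex piece meeting all the other
cells. -/
theorem expands_cells (hQc : IsClosed Q) (hQ : Convex ℝ Q) (hHc : ∀ t, IsClosed (H t))
    (hH : ∀ t, Convex ℝ (H t)) (hFc : IsClosed F) (hF : Convex ℝ F) {𝓦 𝓦' : Set (Set τ)}
    (h𝓦 : IsUpperSet 𝓦) (h𝓦' : IsUpperSet 𝓦') (hsub : 𝓦 ⊆ 𝓦')
    (hmeet : ∀ S ∈ 𝓦', S ∉ 𝓦 → ∀ T, S ⊆ T → (cell Q H T).Nonempty →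
      (cell Q H T ∩ F).Nonempty) :
    Expands (cells Q H 𝓦') (cells Q H 𝓦 ∪ cells Q H 𝓦' ∩ F) := by
  have hFcl : IsClosed (cells Q H 𝓦' ∩ F) := (isClosed_cells hQc hHc _).inter hFc
  have key : ∀ n, ∀ 𝓥 : Set (Set τ), IsUpperSet 𝓥 → 𝓦 ⊆ 𝓥 → 𝓥 ⊆ 𝓦' → (𝓥 \ 𝓦).ncard = n →
      Expands (cells Q H 𝓥 ∪ cells Q H 𝓦' ∩ F) (cells Q H 𝓦 ∪ cells Q H 𝓦' ∩ F) := by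
    intro n
    induction n with
    | zero =>
      intro 𝓥 _ h1 _ h0
      rw [ncard_eq_zero (toFinite _), sdiff_eq_empty] at h0
      rw [h0.antisymm h1]
      exact Expands.refl _
    | succ n ih =>
      intro 𝓥 h𝓥 h1 h2 h0
      have hne : (𝓥 \ 𝓦).Nonempty := nonempty_of_ncard_ne_zero (by omega)
      obtain ⟨S, hSmin⟩ := (toFinite (𝓥 \ 𝓦)).exists_minimal hne
      have hS := hSmin.1
      have hrem : IsUpperSet (𝓥 \ {S}) := fun A B hAB hA =>
        ⟨h𝓥 hAB hA.1, fun h => hA.2 (by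
          rw [mem_singleton_iff] at h ⊢
          subst h
          have hA𝓦 : A ∉ 𝓦 := fun h' => hS.2 (h𝓦 hAB h')
          exact le_antisymm hAB (hSmin.2 ⟨hA.1, hA𝓦⟩ hAB))⟩
      have hrec := ih (𝓥 \ {S}) hrem (fun A hA => ⟨h1 hA, fun h => hS.2 (h ▸ hA)⟩)
        (sdiff_subset.trans h2) (by
          have : (𝓥 \ {S}) \ 𝓦 = (𝓥 \ 𝓦) \ {S} := by
            rw [Set.sdiff_sdiff_comm]
          rw [this, ncard_sdiff_singleton_of_mem hS, h0]
          rfl)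
      refine Expands.trans ?_ hrec
      have hsplit : cells Q H 𝓥 ∪ cells Q H 𝓦' ∩ F =
          (cells Q H (𝓥 \ {S}) ∪ cells Q H 𝓦' ∩ F) ∪ cell Q H S := by
        rw [union_right_comm]
        congr 1
        ext x
        simp only [mem_union, mem_cells']
        constructor
        · rintro ⟨U, hU, hx⟩
          by_cases hUT : U = S
          · exact Or.inr (hUT ▸ hx)
          · exact Or.inl ⟨U, ⟨hU, hUT⟩, hx⟩
        · rintro (⟨U, hU, hx⟩ | hx)
          · exact ⟨U, hU.1, hx⟩
          · exact ⟨S, hS.1, hx⟩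
      rw [hsplit]
      rcases (cell Q H S).eq_empty_or_nonempty with hSe | hSne
      · rw [hSe, union_empty]
        exact Expands.refl _
      refine expands_union ((isClosed_cells hQc hHc _).union hFcl) (isClosed_cell hQc hHc S)
        ((convex_cell hQ hH S).isExtensor (isClosed_cell hQc hHc S) hSne) fun m => ?_
      have hinter : (cells Q H (𝓥 \ {S}) ∪ cells Q H 𝓦' ∩ F) ∩ cell Q H S =
          cells Q H {U | S ⊂ U} ∪ cell Q H S ∩ F := by
        ext x
        simp only [mem_inter_iff, mem_union, mem_cells']
        constructor
        · rintro ⟨⟨U, hU, hx⟩ | hx, hxS⟩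
          · refine Or.inl ⟨S ∪ U, ?_, ?_⟩
            · refine ⟨subset_union_left, fun h => ?_⟩
              have hUS : U ⊆ S := (subset_union_right).trans h
              exact hrem hUS hU |>.2 rfl
            · rw [mem_cell] at *
              exact ⟨hx.1, fun t ht => ht.elim (hxS.2 t) (hx.2 t)⟩
          · exact Or.inr ⟨hxS, hx.2⟩
        · rintro (⟨U, hU, hx⟩ | hx)
          · exact ⟨Or.inl ⟨U, ⟨h𝓥 hU.1 hS.1, fun h => hU.2 (h ▸ Subset.rfl)⟩, hx⟩,
              cell_anti hU.1 hx⟩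
          · exact ⟨Or.inr ⟨⟨S, h2 hS.1, hx.1⟩, hx.2⟩, hx.1⟩
      rw [hinter]
      exact isExtensor_cells_union hQc hQ hHc hH hFc hF m _
        (fun A B hAB hA => lt_of_lt_of_le hA hAB) S (fun U hU => hU.1) hSne
        (hmeet S (h2 hS.1) hS.2)
  have := key _ 𝓦' h𝓦' hsub Subset.rfl rfl
  rwa [union_eq_self_of_subset_right inter_subset_left] at this

/-- A union of cells with a common point is an extensor. -/
theorem isExtensor_cells_of_mem (hQc : IsClosed Q) (hQ : Convex ℝ Q) (hHc : ∀ t, IsClosed (H t))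
    (hH : ∀ t, Convex ℝ (H t)) {𝓕 : Set (Set τ)} (hne : 𝓕.Nonempty) (v : V)
    (hv : ∀ S ∈ 𝓕, v ∈ cell Q H S) (m : ℕ) : IsExtensor m (cells Q H 𝓕) := by
  have := isExtensor_biUnion_of_mem (toFinite 𝓕).toFinset (by simpa using hne) (cell Q H)
    (fun S _ => isClosed_cell hQc hHc S) (fun S _ => convex_cell hQ hH S) v (by simpa using hv) m
  simpa [cells] using this

theorem isNhdExtensor_cells (hQc : IsClosed Q) (hQ : Convex ℝ Q) (hHc : ∀ t, IsClosed (H t))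
    (hH : ∀ t, Convex ℝ (H t)) (𝓕 : Set (Set τ)) : IsNhdExtensor (cells Q H 𝓕) := by
  have := isNhdExtensor_biUnion (toFinite 𝓕).toFinset (cell Q H)
    (fun S _ => isClosed_cell hQc hHc S) (fun S _ => convex_cell hQ hH S)
  simpa [cells] using this

end CellExpansion

/-! ### Arrangements -/

/-- Finitely many groups of affine functions and finitely many affine inequalities on the affine
subspace through `base` with direction `dir`; only the indices in the given finite sets matter. -/
structure Arr (V : Type) [NormedAddCommGroup V] [InnerProductSpace ℝ V] {J : Type}
    (ι : J → Type) (κ : Type) where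
  base : V
  dir : Submodule ℝ V
  groups : Finset J
  idx : ∀ j, Finset (ι j)
  ineqs : Finset κ
  φ : ∀ j, ι j → V →ᵃ[ℝ] ℝ
  ψ : κ → V →ᵃ[ℝ] ℝ

namespace Arr

section Basic

variable {V : Type} [NormedAddCommGroup V] [InnerProductSpace ℝ V]
  {J : Type} {ι : J → Type} {κ : Type} (A : Arr V ι κ)

/-- The ambient affine subspace. -/
def space : Set V := {x | x - A.base ∈ A.dir}

/-- The indices of a group that attain its maximum at `x`. -/
def IsMax (j : J) (i : ι j) (x : V) : Prop := ∀ l ∈ A.idx j, A.φ j l x ≤ A.φ j i x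

/-- The maximum of every group is attained twice at `x`. -/
def Bent (x : V) : Prop :=
  ∀ j ∈ A.groups, ∃ i ∈ A.idx j, ∃ i' ∈ A.idx j, i ≠ i' ∧ A.IsMax j i x ∧ A.IsMax j i' x

/-- The polyhedron cut out by the inequalities. -/
def domain : Set V := {x | x ∈ A.space ∧ ∀ k ∈ A.ineqs, 0 ≤ A.ψ k x}

/-- The part of the intersection of bend loci in the polyhedron. -/
def body : Set V := {x | x ∈ A.domain ∧ A.Bent x}

/-- The part of the intersection of bend loci in the boundary of the polyhedron. -/
def bdry : Set V := {x | x ∈ A.body ∧ ∃ k ∈ A.ineqs, A.ψ k x = 0}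

/-- The constraints defining the cells. -/
def con : (Σ j, ι j) ⊕ κ → Set V
  | .inl t => {x | t.1 ∈ A.groups → t.2 ∈ A.idx t.1 → A.IsMax t.1 t.2 x}
  | .inr k => {x | k ∈ A.ineqs → A.ψ k x ≤ 0}

/-- The sets of constraints that force a point to be in all bend loci. -/
def fam : Set (Set ((Σ j, ι j) ⊕ κ)) :=
  {S | ∀ j ∈ A.groups, ∃ i ∈ A.idx j, ∃ i' ∈ A.idx j, i ≠ i' ∧ .inl ⟨j, i⟩ ∈ S ∧
    .inl ⟨j, i'⟩ ∈ S}

/-- The members of `A.fam` that contain an inequality satisfying `p`. -/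
def famOn (p : κ → Prop) : Set (Set ((Σ j, ι j) ⊕ κ)) :=
  {S | S ∈ A.fam ∧ ∃ k ∈ A.ineqs, p k ∧ .inr k ∈ S}

/-- The index belongs to the arrangement. -/
def Index : (Σ j, ι j) ⊕ κ → Prop
  | .inl t => t.1 ∈ A.groups ∧ t.2 ∈ A.idx t.1
  | .inr k => k ∈ A.ineqs

/-- The linear parts of the functions other than `t` are independent modulo constants on groups. -/
def IndepExcept (t : (Σ j, ι j) ⊕ κ) : Prop :=
  ∀ (y : ∀ j, ι j → ℝ) (z : κ → ℝ), ∃ w ∈ A.dir, ∃ s : J → ℝ,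
    (∀ j ∈ A.groups, ∀ i ∈ A.idx j, .inl ⟨j, i⟩ ≠ t → (A.φ j i).linear w + s j = y j i) ∧
    ∀ k ∈ A.ineqs, .inr k ≠ t → (A.ψ k).linear w = z k

/-- All the functions in each group agree, and all inequalities are tight. -/
def Tight (x : V) : Prop :=
  (∀ j ∈ A.groups, ∀ i ∈ A.idx j, ∀ i' ∈ A.idx j, A.φ j i x = A.φ j i' x) ∧
    ∀ k ∈ A.ineqs, A.ψ k x = 0

/-- The arrangement behaves like the facets of a simplex. -/
structure Simplicial : Prop where
  two_le : ∀ j ∈ A.groups, 2 ≤ (A.idx j).card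
  indep : ∀ t, A.Index t → A.IndepExcept t
  not_tight : ∀ x ∈ A.space, ¬ A.Tight x

/-- The number of superfluous functions in the groups. -/
def excess : ℕ := ∑ j ∈ A.groups, ((A.idx j).card - 2)

/-- The total number of functions. -/
def size : ℕ := ∑ j ∈ A.groups, (A.idx j).card + A.ineqs.card

variable {A}

theorem add_mem_space {x w : V} (hx : x ∈ A.space) (hw : w ∈ A.dir) : x + w ∈ A.space := by
  have := A.dir.add_mem hx hw
  simpa [space, add_sub_right_comm] using this

theorem base_mem_space : A.base ∈ A.space := by simp [space]

theorem map_add (f : V →ᵃ[ℝ] ℝ) (x w : V) : f (x + w) = f x + f.linear w := by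
  rw [add_comm x w, ← vadd_eq_add, f.map_vadd, vadd_eq_add, add_comm]

theorem isUpperSet_fam : IsUpperSet A.fam := by
  intro S T hST hS j hj
  obtain ⟨i, hi, i', hi', h, h1, h2⟩ := hS j hj
  exact ⟨i, hi, i', hi', h, hST h1, hST h2⟩

theorem isUpperSet_famOn (p : κ → Prop) : IsUpperSet (A.famOn p) := by
  rintro S T hST ⟨hS, k, hk, hp, hkS⟩
  exact ⟨isUpperSet_fam hST hS, k, hk, hp, hST hkS⟩

theorem bent_iff {x : V} : {t | x ∈ A.con t} ∈ A.fam ↔ A.Bent x := by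
  refine forall₂_congr fun j hj => ?_
  constructor
  · rintro ⟨i, hi, i', hi', h, h1, h2⟩
    exact ⟨i, hi, i', hi', h, h1 hj hi, h2 hj hi'⟩
  · rintro ⟨i, hi, i', hi', h, h1, h2⟩
    exact ⟨i, hi, i', hi', h, fun _ _ => h1, fun _ _ => h2⟩

theorem cells_fam : cells A.domain A.con A.fam = A.body := by
  ext x
  rw [mem_cells isUpperSet_fam, bent_iff]
  rfl

theorem cells_famOn (p : κ → Prop) :
    cells A.domain A.con (A.famOn p) = {x | x ∈ A.body ∧ ∃ k ∈ A.ineqs, p k ∧ A.ψ k x = 0} := by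
  ext x
  rw [mem_cells (isUpperSet_famOn p)]
  simp only [famOn, mem_ofPred_eq, ← bent_iff, body]
  constructor
  · rintro ⟨hx, h1, k, hk, hp, h2⟩
    exact ⟨⟨hx, h1⟩, k, hk, hp, le_antisymm (h2 hk) (hx.2 k hk)⟩
  · rintro ⟨⟨hx, h1⟩, k, hk, hp, h2⟩
    exact ⟨hx, h1, k, hk, hp, fun _ => h2.le⟩

theorem cells_famOn_true : cells A.domain A.con (A.famOn fun _ => True) = A.bdry := by
  rw [cells_famOn]
  simp [bdry]

theorem convex_space : Convex ℝ A.space := by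
  intro x hx y hy a b _ _ hab
  have : a • x + b • y - A.base = a • (x - A.base) + b • (y - A.base) := by
    rw [smul_sub, smul_sub, sub_add_sub_comm, ← add_smul, hab, one_smul]
  simp only [space, mem_ofPred_eq, this]
  exact A.dir.add_mem (A.dir.smul_mem a hx) (A.dir.smul_mem b hy)

theorem convex_le (f g : V →ᵃ[ℝ] ℝ) : Convex ℝ {x | f x ≤ g x} := by
  have : {x | f x ≤ g x} = (f - g) ⁻¹' Iic 0 := by
    ext x
    simp
  rw [this]
  exact (convex_Iic 0).affine_preimage (f - g)

theorem convex_nonneg (f : V →ᵃ[ℝ] ℝ) : Convex ℝ {x | 0 ≤ f x} :=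
  (convex_Ici 0).affine_preimage f

theorem convex_nonpos (f : V →ᵃ[ℝ] ℝ) : Convex ℝ {x | f x ≤ 0} :=
  (convex_Iic 0).affine_preimage f

theorem convex_isMax (j : J) (i : ι j) : Convex ℝ {x | A.IsMax j i x} := by
  simp only [IsMax, ofPred_forall]
  exact convex_iInter₂ fun l _ => convex_le _ _

theorem domain_eq : A.domain = A.space ∩ ⋂ k ∈ A.ineqs, {x | 0 ≤ A.ψ k x} := by
  ext x
  simp [domain]

theorem convex_domain : Convex ℝ A.domain := by
  rw [domain_eq]
  exact convex_space.inter (convex_iInter₂ fun k _ => convex_nonneg _)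

theorem convex_con (t) : Convex ℝ (A.con t) := by
  rcases t with t | k
  · simp only [con, ofPred_forall]
    exact convex_iInter fun _ => convex_iInter fun _ => convex_isMax _ _
  · simp only [con, ofPred_forall]
    exact convex_iInter fun _ => convex_nonpos _

variable [FiniteDimensional ℝ V]

theorem isClosed_space : IsClosed A.space :=
  A.dir.closed_of_finiteDimensional.preimage (continuous_id.sub continuous_const)

theorem continuous_affine (f : V →ᵃ[ℝ] ℝ) : Continuous f := f.continuous_of_finiteDimensional

theorem isClosed_isMax (j : J) (i : ι j) : IsClosed {x | A.IsMax j i x} := by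
  simp only [IsMax, ofPred_forall]
  exact isClosed_iInter fun l => isClosed_iInter fun _ =>
    isClosed_le (continuous_affine _) (continuous_affine _)

theorem isClosed_domain : IsClosed A.domain := by
  rw [domain_eq]
  exact isClosed_space.inter (isClosed_iInter fun k => isClosed_iInter fun _ =>
    isClosed_le continuous_const (continuous_affine _))

theorem isClosed_con (t) : IsClosed (A.con t) := by
  rcases t with t | k
  · simp only [con, ofPred_forall]
    exact isClosed_iInter fun _ => isClosed_iInter fun _ => isClosed_isMax _ _
  · simp only [con, ofPred_forall]
    exact isClosed_iInter fun _ => isClosed_le (continuous_affine _) continuous_const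

end Basic

section Recursion

variable {V : Type} [NormedAddCommGroup V] [InnerProductSpace ℝ V]
  {J : Type} {ι : J → Type} {κ : Type} {A : Arr V ι κ}

/-- There is a point at which everything but the given index is tight. -/
theorem IndepExcept.exists_tight {t : (Σ j, ι j) ⊕ κ} (h : A.IndepExcept t) :
    ∃ x ∈ A.space, (∀ j ∈ A.groups, ∀ i ∈ A.idx j, ∀ i' ∈ A.idx j, .inl ⟨j, i⟩ ≠ t →
      .inl ⟨j, i'⟩ ≠ t → A.φ j i x = A.φ j i' x) ∧
      ∀ k ∈ A.ineqs, .inr k ≠ t → A.ψ k x = 0 := by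
  obtain ⟨w, hw, s, h1, h2⟩ := h (fun j i => -A.φ j i A.base) fun k => -A.ψ k A.base
  refine ⟨A.base + w, add_mem_space base_mem_space hw, fun j hj i hi i' hi' ht ht' => ?_,
    fun k hk ht => ?_⟩
  · have e1 := h1 j hj i hi ht
    have e2 := h1 j hj i' hi' ht'
    rw [map_add, map_add]
    linarith
  · rw [map_add, h2 k hk ht]
    ring

section Facet

variable [DecidableEq κ]

/-- Turn the inequality `k` into an equation, satisfied at `x`. -/
@[reducible] def facet (A : Arr V ι κ) (k : κ) (x : V) : Arr V ι κ where
  base := x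
  dir := A.dir ⊓ LinearMap.ker (A.ψ k).linear
  groups := A.groups
  idx := A.idx
  ineqs := A.ineqs.erase k
  φ := A.φ
  ψ := A.ψ

theorem mem_facet_space {k : κ} {x y : V} (hx : x ∈ A.space) (hxk : A.ψ k x = 0) :
    y ∈ (A.facet k x).space ↔ y ∈ A.space ∧ A.ψ k y = 0 := by
  have h1 : A.ψ k y = (A.ψ k).linear (y - x) := by
    have := map_add (A.ψ k) x (y - x)
    rw [add_sub_cancel, hxk, zero_add] at this
    exact this
  have h2 : y - A.base = (y - x) + (x - A.base) := by abel
  simp only [space, mem_ofPred_eq, Submodule.mem_inf, LinearMap.mem_ker, h1]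
  refine and_congr_left fun _ => ?_
  rw [h2]
  exact (A.dir.add_mem_iff_left hx).symm

theorem Simplicial.facet (hA : A.Simplicial) {k : κ} (hk : k ∈ A.ineqs) {x : V}
    (hx : x ∈ A.space) (hxk : A.ψ k x = 0) : (A.facet k x).Simplicial where
  two_le := hA.two_le
  indep := by
    intro t ht y z
    have ht' : A.Index t ∧ .inr k ≠ t := by
      rcases t with t | l
      · exact ⟨ht, by simp⟩
      · exact ⟨Finset.mem_of_mem_erase ht, fun h => (Finset.ne_of_mem_erase ht)
          (Sum.inr_injective h).symm⟩
    obtain ⟨w, hw, s, h1, h2⟩ := hA.indep t ht'.1 y fun l => if l = k then 0 else z l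
    refine ⟨w, ⟨hw, ?_⟩, s, h1, fun l hl hlt => ?_⟩
    · simpa using h2 k hk ht'.2
    · have := h2 l (Finset.mem_of_mem_erase hl) hlt
      rwa [if_neg (Finset.ne_of_mem_erase hl)] at this
  not_tight := by
    intro y hy hyt
    rw [mem_facet_space hx hxk] at hy
    refine hA.not_tight y hy.1 ⟨hyt.1, fun l hl => ?_⟩
    by_cases h : l = k
    · rw [h, hy.2]
    · exact hyt.2 l (Finset.mem_erase.2 ⟨h, hl⟩)

theorem size_facet {k : κ} (hk : k ∈ A.ineqs) (x : V) : (A.facet k x).size + 1 = A.size := by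
  have := Finset.card_erase_add_one hk
  simp only [size]
  omega

end Facet

section Region

variable [DecidableEq J] [∀ j, DecidableEq (ι j)]

/-- Drop the group `j` and restrict to the region in which its index `i` is maximal. -/
@[reducible] def region (A : Arr V ι κ) (j : J) (i : ι j) : Arr V ι (ι j) where
  base := A.base
  dir := A.dir
  groups := A.groups.erase j
  idx := A.idx
  ineqs := (A.idx j).erase i
  φ := A.φ
  ψ := fun i' => A.φ j i - A.φ j i'

theorem Simplicial.region (hA : A.Simplicial) (hκ : A.ineqs = ∅) {j : J} (hj : j ∈ A.groups)
    {i : ι j} (hi : i ∈ A.idx j) : (A.region j i).Simplicial where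
  two_le := fun l hl => hA.two_le l (Finset.mem_of_mem_erase hl)
  indep := by
    intro t ht y z
    obtain ⟨t', ht', h1, h2⟩ : ∃ t' : (Σ j, ι j) ⊕ κ, A.Index t' ∧
        (∀ l ∈ A.groups.erase j, ∀ i, (.inl ⟨l, i⟩ : (Σ j, ι j) ⊕ ι j) ≠ t →
          (.inl ⟨l, i⟩ : (Σ j, ι j) ⊕ κ) ≠ t') ∧
        (.inl ⟨j, i⟩ ≠ t') ∧ ∀ i' : ι j, (.inr i' : (Σ j, ι j) ⊕ ι j) ≠ t →
          (.inl ⟨j, i'⟩ : (Σ j, ι j) ⊕ κ) ≠ t' := by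
      rcases t with ⟨l, a⟩ | a
      · have hlj : l ≠ j := Finset.ne_of_mem_erase ht.1
        refine ⟨.inl ⟨l, a⟩, ⟨Finset.mem_of_mem_erase ht.1, ht.2⟩, fun l' _ i' h h' => h ?_, ?_,
          fun i' _ h => ?_⟩
        · simpa using h'
        · intro h
          simp only [Sum.inl.injEq, Sigma.mk.injEq] at h
          exact hlj h.1.symm
        · simp only [Sum.inl.injEq, Sigma.mk.injEq] at h
          exact hlj h.1.symm
      · refine ⟨.inl ⟨j, a⟩, ⟨hj, Finset.mem_of_mem_erase ht⟩, fun l' hl' i' _ h => ?_, ?_,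
          fun i' h h' => h ?_⟩
        · simp only [Sum.inl.injEq, Sigma.mk.injEq] at h
          exact Finset.ne_of_mem_erase hl' h.1
        · intro h
          simp only [Sum.inl.injEq, Sigma.mk.injEq, heq_eq_eq, true_and] at h
          exact Finset.ne_of_mem_erase ht h.symm
        · simpa using h'
    obtain ⟨w, hw, s, e1, -⟩ := hA.indep t' ht' (Function.update y j fun a => if a = i then 0 else
      -z a) fun _ => 0
    refine ⟨w, hw, s, fun l hl a ha hat => ?_, fun a ha hat => ?_⟩
    · have := e1 l (Finset.mem_of_mem_erase hl) a ha (h1 l hl a hat)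
      rwa [Function.update_of_ne (Finset.ne_of_mem_erase hl)] at this
    · have e2 := e1 j hj i hi h2.1
      have e3 := e1 j hj a (Finset.mem_of_mem_erase ha) (h2.2 a hat)
      simp only [Function.update_self, if_true] at e2
      simp only [Function.update_self, if_neg (Finset.ne_of_mem_erase ha)] at e3
      simp only [AffineMap.sub_linear, LinearMap.sub_apply]
      linarith
  not_tight := by
    intro y hy hyt
    have key : ∀ a ∈ A.idx j, A.φ j a y = A.φ j i y := by
      intro a ha
      by_cases h : a = i
      · rw [h]
      · have := hyt.2 a (Finset.mem_erase.2 ⟨h, ha⟩)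
        simp only [AffineMap.coe_sub, Pi.sub_apply] at this
        linarith
    refine hA.not_tight y hy ⟨fun l hl a ha a' ha' => ?_, by simp [hκ]⟩
    by_cases h : l = j
    · subst h
      rw [key a ha, key a' ha']
    · exact hyt.1 l (Finset.mem_erase.2 ⟨h, hl⟩) a ha a' ha'

theorem size_region (hκ : A.ineqs = ∅) {j : J} (hj : j ∈ A.groups) {i : ι j} (hi : i ∈ A.idx j) :
    (A.region j i).size + 1 = A.size := by
  have h1 := Finset.card_erase_add_one hi
  have h2 := Finset.sum_erase_add A.groups (fun j => (A.idx j).card) hj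
  simp only [size, hκ, Finset.card_empty]
  omega

theorem excess_region (hA : A.Simplicial) {j : J} (hj : j ∈ A.groups) {i : ι j}
    (hi : i ∈ A.idx j) :
    (A.region j i).excess + (A.region j i).ineqs.card - 1 = A.excess := by
  have h1 := Finset.card_erase_add_one hi
  have h2 := Finset.sum_erase_add A.groups (fun j => (A.idx j).card - 2) hj
  have h3 := hA.two_le j hj
  simp only [excess]
  omega

end Region

end Recursion

end Arr

/-! ### Connectivity of simplicial arrangements -/

/-- A union of cells, each contained in a cell of the family through a common point, is an
extensor. -/
theorem isExtensor_cells_of_exists {V : Type} [NormedAddCommGroup V] [InnerProductSpace ℝ V]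
    [FiniteDimensional ℝ V] {τ : Type*} [Finite τ] {Q : Set V} {H : τ → Set V} (hQc : IsClosed Q)
    (hQ : Convex ℝ Q) (hHc : ∀ t, IsClosed (H t)) (hH : ∀ t, Convex ℝ (H t)) {𝓕 : Set (Set τ)}
    (hne : 𝓕.Nonempty) (v : V) (hv : ∀ S ∈ 𝓕, ∃ S' ∈ 𝓕, S' ⊆ S ∧ v ∈ cell Q H S') (m : ℕ) :
    IsExtensor m (cells Q H 𝓕) := by
  have h : cells Q H 𝓕 = cells Q H {S | S ∈ 𝓕 ∧ v ∈ cell Q H S} := by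
    refine Subset.antisymm (fun x hx => ?_) (cells_mono fun S hS => hS.1)
    obtain ⟨S, hS, hx⟩ := mem_cells'.1 hx
    obtain ⟨S', hS', hsub, hvS⟩ := hv S hS
    exact mem_cells_of_mem ⟨hS', hvS⟩ (cell_anti hsub hx)
  rw [h]
  refine isExtensor_cells_of_mem hQc hQ hHc hH ?_ v (fun S hS => hS.2) m
  obtain ⟨S, hS⟩ := hne
  obtain ⟨S', hS', -, hvS⟩ := hv S hS
  exact ⟨S', hS', hvS⟩

namespace Arr

variable {V : Type} [NormedAddCommGroup V] [InnerProductSpace ℝ V]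
  {J : Type} {ι : J → Type} {κ : Type} {A : Arr V ι κ}

/-- All the functions in each group agree, and all inequalities but `k` are tight. -/
def TightExcept (A : Arr V ι κ) (k : κ) (x : V) : Prop :=
  (∀ j ∈ A.groups, ∀ i ∈ A.idx j, ∀ i' ∈ A.idx j, A.φ j i x = A.φ j i' x) ∧
    ∀ l ∈ A.ineqs, l ≠ k → A.ψ l x = 0

theorem Simplicial.exists_tightExcept (hA : A.Simplicial) {k : κ} (hk : k ∈ A.ineqs) :
    ∃ x ∈ A.space, A.TightExcept k x := by
  obtain ⟨x, hx, h1, h2⟩ := (hA.indep (.inr k) hk).exists_tight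
  exact ⟨x, hx, fun j hj i hi i' hi' => h1 j hj i hi i' hi' (by simp) (by simp),
    fun l hl hlk => h2 l hl (by simpa using hlk)⟩

theorem Simplicial.apply_ne_zero (hA : A.Simplicial) {k : κ} {x : V}
    (hx : x ∈ A.space) (h : A.TightExcept k x) : A.ψ k x ≠ 0 := by
  intro h0
  refine hA.not_tight x hx ⟨h.1, fun l hl => ?_⟩
  by_cases hlk : l = k
  · rw [hlk, h0]
  · exact h.2 l hl hlk

theorem isMax_of_tied {x : V}
    (h : ∀ j ∈ A.groups, ∀ i ∈ A.idx j, ∀ i' ∈ A.idx j, A.φ j i x = A.φ j i' x) {j : J}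
    (hj : j ∈ A.groups) {i : ι j} (hi : i ∈ A.idx j) : A.IsMax j i x :=
  fun l hl => (h j hj l hl i hi).le

theorem mem_con_inl_of_tied {x : V}
    (h : ∀ j ∈ A.groups, ∀ i ∈ A.idx j, ∀ i' ∈ A.idx j, A.φ j i x = A.φ j i' x) (t : Σ j, ι j) :
    x ∈ A.con (.inl t) := fun h1 h2 => isMax_of_tied h h1 h2

theorem TightExcept.mem_con {k : κ} {x : V} (h : A.TightExcept k x) {t : (Σ j, ι j) ⊕ κ}
    (ht : t ≠ .inr k) : x ∈ A.con t := by
  rcases t with t | l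
  · exact mem_con_inl_of_tied h.1 t
  · exact fun hl => (h.2 l hl (by simpa using ht)).le

theorem TightExcept.mem_domain {k : κ} {x : V} (h : A.TightExcept k x) (hx : x ∈ A.space)
    (h0 : 0 ≤ A.ψ k x) : x ∈ A.domain := by
  refine ⟨hx, fun l hl => ?_⟩
  by_cases hlk : l = k
  · rwa [hlk]
  · exact (h.2 l hl hlk).ge

theorem TightExcept.mem_cell_sdiff {k : κ} {x : V} (h : A.TightExcept k x) (hx : x ∈ A.space)
    (h0 : 0 ≤ A.ψ k x) (S : Set ((Σ j, ι j) ⊕ κ)) :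
    x ∈ cell A.domain A.con (S \ {.inr k}) :=
  mem_cell.2 ⟨h.mem_domain hx h0, fun _ ht => h.mem_con ht.2⟩

theorem fam_sdiff_inr {S : Set ((Σ j, ι j) ⊕ κ)} (hS : S ∈ A.fam) (k : κ) :
    S \ {.inr k} ∈ A.fam := by
  intro j hj
  obtain ⟨i, hi, i', hi', h, h1, h2⟩ := hS j hj
  exact ⟨i, hi, i', hi', h, ⟨h1, by simp⟩, ⟨h2, by simp⟩⟩

theorem Simplicial.univ_mem_fam (hA : A.Simplicial) : univ ∈ A.fam := by
  intro j hj
  obtain ⟨i, hi, i', hi', h⟩ := Finset.one_lt_card.1 (hA.two_le j hj)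
  exact ⟨i, hi, i', hi', h, trivial, trivial⟩

section FacetBody

variable [DecidableEq κ]

theorem body_facet {k : κ} {x : V} (hx : x ∈ A.space) (hxk : A.ψ k x = 0) :
    (A.facet k x).body = {y | y ∈ A.body ∧ A.ψ k y = 0} := by
  ext y
  simp only [body, domain, mem_ofPred_eq, mem_facet_space hx hxk]
  constructor
  · rintro ⟨⟨⟨h1, h2⟩, h3⟩, h4⟩
    refine ⟨⟨⟨h1, fun l hl => ?_⟩, h4⟩, h2⟩
    by_cases hlk : l = k
    · rw [hlk, h2]
    · exact h3 l (Finset.mem_erase.2 ⟨hlk, hl⟩)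
  · rintro ⟨⟨⟨h1, h3⟩, h4⟩, h2⟩
    exact ⟨⟨⟨h1, h2⟩, fun l hl => h3 l (Finset.mem_of_mem_erase hl)⟩, h4⟩

theorem bdry_facet {k : κ} {x : V} (hx : x ∈ A.space) (hxk : A.ψ k x = 0) :
    (A.facet k x).bdry =
      {y | y ∈ A.body ∧ ∃ l ∈ A.ineqs, l ≠ k ∧ A.ψ l y = 0} ∩ {y | y ∈ A.body ∧ A.ψ k y = 0} := by
  ext y
  simp only [bdry, body_facet hx hxk, mem_ofPred_eq, mem_inter_iff, Finset.mem_erase]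
  constructor
  · rintro ⟨⟨h1, h2⟩, l, ⟨hlk, hl⟩, h3⟩
    exact ⟨⟨h1, l, hl, hlk, h3⟩, h1, h2⟩
  · rintro ⟨⟨h1, l, hl, hlk, h3⟩, -, h2⟩
    exact ⟨⟨h1, h2⟩, l, ⟨hlk, hl⟩, h3⟩

theorem bdry_eq_union {k : κ} (hk : k ∈ A.ineqs) :
    A.bdry = {y | y ∈ A.body ∧ ∃ l ∈ A.ineqs, l ≠ k ∧ A.ψ l y = 0} ∪
      {y | y ∈ A.body ∧ A.ψ k y = 0} := by
  ext y
  simp only [bdry, mem_ofPred_eq, mem_union]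
  constructor
  · rintro ⟨h1, l, hl, h3⟩
    by_cases hlk : l = k
    · exact Or.inr ⟨h1, hlk ▸ h3⟩
    · exact Or.inl ⟨h1, l, hl, hlk, h3⟩
  · rintro (⟨h1, l, hl, hlk, h3⟩ | ⟨h1, h3⟩)
    · exact ⟨h1, l, hl, h3⟩
    · exact ⟨h1, k, hk, h3⟩

end FacetBody

section RegionBody

variable [DecidableEq J]

/-- Drop the group `j`. -/
@[reducible] def drop (A : Arr V ι κ) (j : J) : Arr V ι κ where
  base := A.base
  dir := A.dir
  groups := A.groups.erase j
  idx := A.idx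
  ineqs := A.ineqs
  φ := A.φ
  ψ := A.ψ

theorem body_subset_drop {j : J} : A.body ⊆ (A.drop j).body :=
  fun _ hy => ⟨hy.1, fun l hl => hy.2 l (Finset.mem_of_mem_erase hl)⟩

variable [∀ j, DecidableEq (ι j)]

theorem body_region (hκ : A.ineqs = ∅) {j : J} {i : ι j} :
    (A.region j i).body = {y | y ∈ (A.drop j).body ∧ A.IsMax j i y} := by
  ext y
  simp only [body, domain, mem_ofPred_eq, hκ, Finset.notMem_empty, false_imp_iff, implies_true,
    and_true]
  constructor
  · rintro ⟨⟨h1, h2⟩, h3⟩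
    refine ⟨⟨h1, h3⟩, fun l hl => ?_⟩
    by_cases hli : l = i
    · rw [hli]
    · have := h2 l (Finset.mem_erase.2 ⟨hli, hl⟩)
      simpa using this
  · rintro ⟨⟨h1, h3⟩, h2⟩
    exact ⟨⟨h1, fun l hl => by simpa using h2 l (Finset.mem_of_mem_erase hl)⟩, h3⟩

theorem bdry_region (hκ : A.ineqs = ∅) {j : J} (hj : j ∈ A.groups) {i : ι j} (hi : i ∈ A.idx j) :
    (A.region j i).bdry = {y | y ∈ A.body ∧ A.IsMax j i y} := by
  ext y
  simp only [bdry, body_region hκ, mem_ofPred_eq, AffineMap.coe_sub, Pi.sub_apply]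
  constructor
  · rintro ⟨⟨h1, h2⟩, l, hl, h3⟩
    refine ⟨⟨h1.1, fun j' hj' => ?_⟩, h2⟩
    by_cases hjj : j' = j
    · subst hjj
      refine ⟨i, hi, l, Finset.mem_of_mem_erase hl, (Finset.ne_of_mem_erase hl).symm, h2,
        fun a ha => ?_⟩
      have := h2 a ha
      linarith
    · exact h1.2 j' (Finset.mem_erase.2 ⟨hjj, hj'⟩)
  · rintro ⟨h1, h2⟩
    refine ⟨⟨body_subset_drop h1, h2⟩, ?_⟩
    obtain ⟨a, ha, b, hb, hab, hma, hmb⟩ := h1.2 j hj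
    obtain ⟨c, hc, hci, hmc⟩ : ∃ c ∈ A.idx j, c ≠ i ∧ A.IsMax j c y := by
      by_cases hai : a = i
      · exact ⟨b, hb, fun h => hab (hai.trans h.symm), hmb⟩
      · exact ⟨a, ha, hai, hma⟩
    refine ⟨c, Finset.mem_erase.2 ⟨hci, hc⟩, ?_⟩
    have h3 := h2 c hc
    have h4 := hmc i hi
    linarith

end RegionBody

section Main

variable [FiniteDimensional ℝ V] [Finite J] [∀ j, Finite (ι j)] [Finite κ]

theorem isClosed_body : IsClosed A.body := by
  rw [← cells_fam]
  exact isClosed_cells isClosed_domain isClosed_con _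

theorem isClosed_body_on (p : κ → Prop) :
    IsClosed {x | x ∈ A.body ∧ ∃ k ∈ A.ineqs, p k ∧ A.ψ k x = 0} := by
  rw [← cells_famOn]
  exact isClosed_cells isClosed_domain isClosed_con _

theorem isNhdExtensor_bdry : IsNhdExtensor A.bdry := by
  rw [← cells_famOn_true]
  exact isNhdExtensor_cells isClosed_domain convex_domain isClosed_con convex_con _

/-- The inductive step for arrangements without inequalities. -/
theorem Simplicial.isExtensor_body (hA : A.Simplicial) (hκ : A.ineqs = ∅)
    [DecidableEq J] [∀ j, DecidableEq (ι j)]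
    (ih : ∀ j ∈ A.groups, ∀ i ∈ A.idx j, Compressible A.excess (A.region j i).body
      (A.region j i).bdry) : IsExtensor A.excess A.body := by
  obtain ⟨j, hj⟩ : A.groups.Nonempty := by
    rw [Finset.nonempty_iff_ne_empty]
    intro he
    exact hA.not_tight A.base base_mem_space ⟨by simp [he], by simp [hκ]⟩
  obtain ⟨i₀, hi₀⟩ : (A.idx j).Nonempty := Finset.card_pos.1 (by have := hA.two_le j hj; omega)
  obtain ⟨v, hv, hvt, -⟩ := (hA.indep (.inl ⟨j, i₀⟩) ⟨hj, hi₀⟩).exists_tight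
  have hvt' : ∀ l ∈ (A.drop j).groups, ∀ i ∈ A.idx l, ∀ i' ∈ A.idx l,
      A.φ l i v = A.φ l i' v := by
    intro l hl i hi i' hi'
    have hne : ∀ a : ι l, (.inl ⟨l, a⟩ : (Σ j, ι j) ⊕ κ) ≠ .inl ⟨j, i₀⟩ := by
      intro a h
      simp only [Sum.inl.injEq, Sigma.mk.injEq] at h
      exact Finset.ne_of_mem_erase hl h.1
    exact hvt l (Finset.mem_of_mem_erase hl) i hi i' hi' (hne i) (hne i')
  have hvQ : v ∈ (A.drop j).domain := ⟨hv, by simp [hκ]⟩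
  have hY : ∀ m, IsExtensor m (A.drop j).body := by
    intro m
    rw [← cells_fam]
    have hne : (A.drop j).fam.Nonempty :=
      ⟨univ, fun l hl => hA.univ_mem_fam l (Finset.mem_of_mem_erase hl)⟩
    refine isExtensor_cells_of_mem (Q := (A.drop j).domain) (H := (A.drop j).con)
      (𝓕 := (A.drop j).fam) isClosed_domain convex_domain isClosed_con convex_con
      hne v (fun S _ => ?_) m
    refine mem_cell.2 ⟨hvQ, fun t _ => ?_⟩
    rcases t with t | k
    · exact mem_con_inl_of_tied hvt' t
    · exact fun hk => by simp [hκ] at hk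
  refine Compressible.isExtensor ?_ (hY _) body_subset_drop
  have key : ∀ s : Finset (ι j), s ⊆ A.idx j →
      Compressible A.excess (A.body ∪ ⋃ i ∈ s, (A.region j i).body) A.body := by
    intro s
    induction s using Finset.induction_on with
    | empty => simpa using compressible_refl _ _
    | insert a s has ihs =>
      intro hs
      have ha : a ∈ A.idx j := hs (Finset.mem_insert_self _ _)
      have hs' : s ⊆ A.idx j := (Finset.subset_insert _ _).trans hs
      have heq : A.body ∪ ⋃ i ∈ insert a s, (A.region j i).body =
          (A.body ∪ ⋃ i ∈ s, (A.region j i).body) ∪ (A.region j a).body := by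
        rw [Finset.set_biUnion_insert, union_assoc, union_comm (A.region j a).body]
      rw [heq]
      refine Compressible.trans ?_ (ihs hs') subset_union_left subset_union_left
      refine Compressible.union
        (isClosed_body.union (isClosed_biUnion_finset_of fun i _ => isClosed_body))
        isClosed_body ?_
      have hinter : (A.body ∪ ⋃ i ∈ s, (A.region j i).body) ∩ (A.region j a).body =
          (A.region j a).bdry := by
        rw [bdry_region hκ hj ha]
        ext y
        simp only [body_region hκ, mem_inter_iff, mem_union, mem_iUnion, mem_ofPred_eq]
        constructor
        · rintro ⟨h | ⟨i, hi, h⟩, h'⟩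
          · exact ⟨h, h'.2⟩
          · refine ⟨⟨h.1.1, fun l hl => ?_⟩, h'.2⟩
            by_cases hlj : l = j
            · subst hlj
              exact ⟨i, hs' hi, a, ha, fun h => has (h ▸ hi), h.2, h'.2⟩
            · exact h.1.2 l (Finset.mem_erase.2 ⟨hlj, hl⟩)
        · rintro ⟨h, h'⟩
          exact ⟨Or.inl h, body_subset_drop h, h'⟩
      rw [hinter]
      exact ih j hj a ha
  have hcov : A.body ∪ ⋃ i ∈ A.idx j, (A.region j i).body = (A.drop j).body := by
    refine Subset.antisymm (union_subset body_subset_drop (iUnion₂_subset fun i _ => ?_)) ?_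
    · rw [body_region hκ]
      exact fun y hy => hy.1
    · intro y hy
      obtain ⟨i, hi, hmax⟩ := (A.idx j).exists_max_image (fun i => A.φ j i y) ⟨i₀, hi₀⟩
      refine Or.inr (mem_iUnion₂.2 ⟨i, hi, ?_⟩)
      rw [body_region hκ]
      exact ⟨hy, hmax⟩
  rw [← hcov]
  exact key _ Subset.rfl

/-- The inductive step for the boundary of a simplicial arrangement. -/
theorem Simplicial.isExtensor_bdry [DecidableEq κ] (hA : A.Simplicial) {k : κ} (hk : k ∈ A.ineqs)
    {v : V} (hv : v ∈ A.space) (hvt : A.TightExcept k v) (hpos : 0 < A.ψ k v)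
    (ih₁ : ∀ x ∈ A.space, A.ψ k x = 0 → (A.facet k x).ineqs = ∅ →
      IsExtensor A.excess (A.facet k x).body)
    (ih₂ : ∀ x ∈ A.space, A.ψ k x = 0 → (A.facet k x).ineqs.Nonempty →
      Compressible (A.excess + (A.facet k x).ineqs.card - 1) (A.facet k x).body
        (A.facet k x).bdry) :
    IsExtensor (A.excess + A.ineqs.card - 1) A.bdry := by
  have hcard := Finset.card_erase_add_one hk
  rcases Nat.eq_zero_or_pos (A.excess + A.ineqs.card - 1) with h0 | hm
  · rw [h0]
    exact isExtensor_zero _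
  obtain ⟨t, ht, htk⟩ : ∃ t, A.Index t ∧ .inr k ≠ t := by
    by_cases he : (A.ineqs.erase k).Nonempty
    · obtain ⟨l, hl⟩ := he
      refine ⟨.inr l, Finset.mem_of_mem_erase hl, fun h => ?_⟩
      exact Finset.ne_of_mem_erase hl (Sum.inr_injective h).symm
    · rw [Finset.not_nonempty_iff_eq_empty] at he
      rw [he, Finset.card_empty] at hcard
      have hne : A.groups.Nonempty := by
        rw [Finset.nonempty_iff_ne_empty]
        intro h
        simp [excess, h] at hm
        omega
      obtain ⟨j, hj⟩ := hne
      obtain ⟨i, hi⟩ : (A.idx j).Nonempty :=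
        Finset.card_pos.1 (by have := hA.two_le j hj; omega)
      exact ⟨.inl ⟨j, i⟩, ⟨hj, hi⟩, by simp⟩
  obtain ⟨x, hx, -, hx2⟩ := (hA.indep t ht).exists_tight
  have hxk : A.ψ k x = 0 := hx2 k hk htk
  rcases (A.facet k x).ineqs.eq_empty_or_nonempty with he | hne
  · have he' : A.ineqs.erase k = ∅ := he
    have h1 : A.bdry = (A.facet k x).body := by
      rw [body_facet hx hxk, bdry_eq_union hk]
      refine union_eq_self_of_subset_left ?_
      rintro y ⟨-, l, hl, hlk, -⟩
      have : l ∈ A.ineqs.erase k := Finset.mem_erase.2 ⟨hlk, hl⟩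
      rw [he'] at this
      simp at this
    rw [h1]
    have h2 : (A.ineqs.erase k).card = 0 := by rw [he', Finset.card_empty]
    exact (ih₁ x hx hxk he).mono (by omega)
  · have hne' : (A.ineqs.erase k).Nonempty := hne
    have h1 := Finset.card_pos.2 hne'
    obtain ⟨m, hm'⟩ : ∃ m, A.excess + A.ineqs.card - 1 = m + 1 := ⟨_, (Nat.sub_add_cancel hm).symm⟩
    rw [hm']
    have hB : ∀ m, IsExtensor m {y | y ∈ A.body ∧ ∃ l ∈ A.ineqs, l ≠ k ∧ A.ψ l y = 0} := by
      intro m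
      rw [← cells_famOn]
      obtain ⟨l, hl⟩ := hne'
      have hfam : (A.famOn fun l => l ≠ k).Nonempty :=
        ⟨univ, hA.univ_mem_fam, l, Finset.mem_of_mem_erase hl, Finset.ne_of_mem_erase hl, trivial⟩
      refine isExtensor_cells_of_exists (Q := A.domain) (H := A.con)
        (𝓕 := A.famOn fun l => l ≠ k) isClosed_domain convex_domain isClosed_con convex_con
        hfam v (fun S hS => ?_) m
      obtain ⟨hS, a, ha, hak, haS⟩ := hS
      have h1 : S \ {.inr k} ∈ A.famOn fun l => l ≠ k :=
        ⟨fam_sdiff_inr hS k, a, ha, hak, haS, fun h => hak (Sum.inr_injective h)⟩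
      have h2 := hvt.mem_cell_sdiff hv hpos.le S
      exact ⟨_, h1, fun x hx => hx.1, h2⟩
    refine isNhdExtensor_bdry.isExtensor_succ (B := {y | y ∈ A.body ∧ ∃ l ∈ A.ineqs, l ≠ k ∧
      A.ψ l y = 0}) ?_ (hB _) ?_
    · rw [bdry_eq_union hk]
      exact subset_union_left
    · rw [bdry_eq_union hk]
      refine Compressible.union (isClosed_body_on _) ?_ ?_
      · rw [← body_facet hx hxk]
        exact isClosed_body
      · rw [← bdry_facet hx hxk, ← body_facet hx hxk]
        have he : (A.facet k x).ineqs.card = (A.ineqs.erase k).card := rfl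
        exact (ih₂ x hx hxk hne).mono (by omega)

/-- The inductive step for the pair of a simplicial arrangement and its boundary. -/
theorem Simplicial.compressible_body (hA : A.Simplicial) {k : κ} (hk : k ∈ A.ineqs)
    (ih : ∀ v ∈ A.space, A.TightExcept k v → 0 < A.ψ k v →
      IsExtensor (A.excess + A.ineqs.card - 1) A.bdry) :
    Compressible (A.excess + A.ineqs.card - 1) A.body A.bdry := by
  obtain ⟨v, hv, hvt⟩ := hA.exists_tightExcept hk
  rcases lt_or_gt_of_ne (hA.apply_ne_zero hv hvt) with hneg | hpos
  · have h := expands_cells (Q := A.domain) (H := A.con) (F := {x | A.ψ k x ≤ 0})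
      isClosed_domain convex_domain isClosed_con convex_con
      (isClosed_le (continuous_affine _) continuous_const) (convex_nonpos _)
      (𝓦 := A.famOn fun _ => True) (𝓦' := A.fam) (isUpperSet_famOn _) isUpperSet_fam
      (fun S hS => hS.1) (by
        rintro S - - T - ⟨x, hx⟩
        rw [mem_cell] at hx
        have hx0 := hx.1.2 k hk
        set r := A.ψ k x / (A.ψ k x - A.ψ k v) with hr
        have hden : 0 < A.ψ k x - A.ψ k v := by linarith
        have hr0 : 0 ≤ r := div_nonneg hx0 hden.le
        have hr1 : r ≤ 1 := (div_le_one hden).2 (by linarith)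
        have hψ : ∀ l, A.ψ l (AffineMap.lineMap x v r) = (1 - r) * A.ψ l x + r * A.ψ l v := by
          intro l
          rw [AffineMap.apply_lineMap, AffineMap.lineMap_apply]
          simp only [vsub_eq_sub, vadd_eq_add, smul_eq_mul]
          ring
        have hk0 : A.ψ k (AffineMap.lineMap x v r) = 0 := by
          rw [hψ, hr]
          field_simp
          ring
        have hseg : ∀ C : Set V, Convex ℝ C → x ∈ C → v ∈ C → AffineMap.lineMap x v r ∈ C :=
          fun C hC hxC hvC => hC.lineMap_mem hxC hvC ⟨hr0, hr1⟩
        refine ⟨AffineMap.lineMap x v r, mem_cell.2 ⟨⟨hseg _ convex_space hx.1.1 hv, fun l hl => ?_⟩,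
          fun t ht => ?_⟩, hk0.le⟩
        · by_cases hlk : l = k
          · rw [hlk, hk0]
          · rw [hψ, hvt.2 l hl hlk]
            have := hx.1.2 l hl
            have : 0 ≤ 1 - r := by linarith
            positivity
        · by_cases htk : t = .inr k
          · rw [htk]
            exact fun _ => hk0.le
          · exact hseg _ (convex_con t) (hx.2 t ht) (hvt.mem_con htk))
    rw [cells_fam, cells_famOn_true, union_eq_self_of_subset_right] at h
    · exact (h.2 _).1
    · rintro x ⟨hx, hx'⟩
      exact ⟨hx, k, hk, le_antisymm hx' (hx.1.2 k hk)⟩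
  · refine (ih v hv hvt hpos).compressible ?_ fun x hx => hx.1
    rw [← cells_fam]
    have hfam : A.fam.Nonempty := ⟨univ, hA.univ_mem_fam⟩
    exact isExtensor_cells_of_exists (Q := A.domain) (H := A.con) (𝓕 := A.fam)
      isClosed_domain convex_domain isClosed_con convex_con hfam v (fun S hS => by
        have h2 := hvt.mem_cell_sdiff hv hpos.le S
        exact ⟨_, fam_sdiff_inr hS k, fun x hx => hx.1, h2⟩) _

end Main

theorem simplicial_induction [FiniteDimensional ℝ V] [Finite J] [∀ j, Finite (ι j)] (N : ℕ) :
    ∀ (κ : Type) [Finite κ] (A : Arr V ι κ), A.Simplicial → A.size = N →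
      (A.ineqs = ∅ → IsExtensor A.excess A.body) ∧
      (∀ k ∈ A.ineqs, ∀ v ∈ A.space, A.TightExcept k v → 0 < A.ψ k v →
        IsExtensor (A.excess + A.ineqs.card - 1) A.bdry) ∧
      (A.ineqs.Nonempty → Compressible (A.excess + A.ineqs.card - 1) A.body A.bdry) := by
  classical
  induction N using Nat.strong_induction_on with
  | _ N ih =>
  intro κ _ A hA hN
  subst hN
  have hbdry : ∀ k ∈ A.ineqs, ∀ v ∈ A.space, A.TightExcept k v → 0 < A.ψ k v →
      IsExtensor (A.excess + A.ineqs.card - 1) A.bdry := by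
    intro k hk v hv hvt hpos
    have hlt : ∀ x, (A.facet k x).size < A.size := fun x => by
      have := size_facet hk x
      omega
    exact hA.isExtensor_bdry hk hv hvt hpos
      (fun x hx hxk => (ih _ (hlt x) κ (A.facet k x) (hA.facet hk hx hxk) rfl).1)
      (fun x hx hxk => (ih _ (hlt x) κ (A.facet k x) (hA.facet hk hx hxk) rfl).2.2)
  refine ⟨fun hκ => hA.isExtensor_body hκ fun j hj i hi => ?_, hbdry, ?_⟩
  · have hlt : (A.region j i).size < A.size := by
      have := size_region hκ hj hi
      omega
    rw [← excess_region hA hj hi]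
    refine (ih _ hlt (ι j) (A.region j i) (hA.region hκ hj hi) rfl).2.2 ?_
    have h1 := Finset.card_erase_add_one hi
    have h2 := hA.two_le j hj
    have h3 : 0 < ((A.idx j).erase i).card := by omega
    exact Finset.card_pos.1 h3
  · rintro ⟨k, hk⟩
    exact hA.compressible_body hk (hbdry k hk)

/-- The boundary part of a simplicial arrangement is highly connected. -/
theorem Simplicial.isExtensor [FiniteDimensional ℝ V] [Finite J] [∀ j, Finite (ι j)] [Finite κ]
    (hA : A.Simplicial) {k : κ} (hk : k ∈ A.ineqs) {v : V} (hv : v ∈ A.space)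
    (hvt : A.TightExcept k v) (hpos : 0 < A.ψ k v) :
    IsExtensor (A.excess + A.ineqs.card - 1) A.bdry :=
  (simplicial_induction A.size κ A hA rfl).2.1 k hk v hv hvt hpos

end Arr

/-! ### Sweeping by the height function -/

/-- Groups of affine functions, affine inequalities, and an affine height function. -/
structure Sweep (V : Type) [NormedAddCommGroup V] [InnerProductSpace ℝ V] {J : Type}
    (ι : J → Type) (κ : Type) where
  φ : ∀ j, ι j → V →ᵃ[ℝ] ℝ
  ψ : κ → V →ᵃ[ℝ] ℝ
  h : V →ᵃ[ℝ] ℝ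

/-- Moving along a ray until one of finitely many affine functions vanishes. -/
theorem exists_ray_exit {V C : Type*} [AddCommGroup V] [Module ℝ V] [Finite C]
    (g : C → V →ᵃ[ℝ] ℝ) {x w : V} (hg : ∀ c, 0 ≤ g c x) (hw : ∀ c, g c x = 0 → (g c).linear w = 0)
    (hneg : ∃ c, (g c).linear w < 0) :
    ∃ r : ℝ, 0 < r ∧ (∀ c, 0 ≤ g c (x + r • w)) ∧ ∃ c, 0 < g c x ∧ g c (x + r • w) = 0 := by
  have hadd : ∀ c (r : ℝ), g c (x + r • w) = g c x + r * (g c).linear w := by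
    intro c r
    rw [add_comm x, ← vadd_eq_add, (g c).map_vadd, vadd_eq_add, add_comm, map_smul, smul_eq_mul]
  obtain ⟨c, hc, hmin⟩ := exists_min_image {c | (g c).linear w < 0}
    (fun c => g c x / -(g c).linear w) (toFinite _) hneg
  have hc' : 0 < -(g c).linear w := by
    have : (g c).linear w < 0 := hc
    linarith
  have hpos : ∀ c', (g c').linear w < 0 → 0 < g c' x := by
    intro c' hc'
    refine lt_of_le_of_ne (hg c') fun h0 => ?_
    rw [hw c' h0.symm] at hc'
    exact lt_irrefl _ hc'
  refine ⟨g c x / -(g c).linear w, div_pos (hpos c hc) hc', fun c' => ?_, c, hpos c hc, ?_⟩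
  · rw [hadd]
    by_cases h' : (g c').linear w < 0
    · have h1 := hmin c' h'
      rw [le_div_iff₀ (by linarith)] at h1
      linarith
    · have h1 : 0 < g c x / -(g c).linear w := div_pos (hpos c hc) hc'
      have h2 := hg c'
      have h3 := not_lt.1 h'
      positivity
  · have hne : (g c).linear w ≠ 0 := by linarith
    rw [hadd]
    field_simp
    ring

namespace Sweep

section Basic

variable {V : Type} [NormedAddCommGroup V] [InnerProductSpace ℝ V]
  {J : Type} {ι : J → Type} {κ : Type} (W : Sweep V ι κ)

/-- The function `i` attains the maximum of the group `j` at `x`. -/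
def Top (j : J) (i : ι j) (x : V) : Prop := ∀ l, W.φ j l x ≤ W.φ j i x

/-- The height function is constant on the stratum of `x`. -/
def Crit (x : V) : Prop :=
  ∀ (w : V) (s : J → ℝ), (∀ j i, W.Top j i x → (W.φ j i).linear w = s j) →
    (∀ k, W.ψ k x = 0 → (W.ψ k).linear w = 0) → W.h.linear w = 0

/-- All maxima are attained twice, and all inequalities hold. -/
def Feas (x : V) : Prop :=
  (∀ j, ∃ i i', i ≠ i' ∧ W.Top j i x ∧ W.Top j i' x) ∧ ∀ k, 0 ≤ W.ψ k x

/-- The indices of the functions active at `x`. -/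
def act (x : V) : Set ((Σ j, ι j) ⊕ κ) :=
  {t | Sum.elim (fun t => W.Top t.1 t.2 x) (fun k => W.ψ k x = 0) t}

theorem isClosed_height_le [FiniteDimensional ℝ V] (b : ℝ) : IsClosed {x | W.h x ≤ b} :=
  isClosed_le (Arr.continuous_affine _) continuous_const

variable {W}

theorem exists_top [∀ j, Finite (ι j)] [∀ j, Nonempty (ι j)] (j : J) (x : V) :
    ∃ i, W.Top j i x := by
  obtain ⟨i, hi⟩ := Finite.exists_max fun i => W.φ j i x
  exact ⟨i, hi⟩

theorem exists_step [Finite J] [∀ j, Finite (ι j)] [∀ j, Nonempty (ι j)] [Finite κ]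
    {a : ℝ} {x : V} (hx : ∀ k, 0 ≤ W.ψ k x)
    (ha : a < W.h x) (hc : ¬ W.Crit x) :
    ∃ y, (∀ k, 0 ≤ W.ψ k y) ∧ a ≤ W.h y ∧ W.h y ≤ W.h x ∧ W.act x ⊆ W.act y ∧
      (W.h y = a ∨ W.act x ≠ W.act y) := by
  classical
  simp only [Crit, not_forall] at hc
  obtain ⟨w₀, s₀, h1₀, h2₀, h3₀⟩ := hc
  obtain ⟨w, s, h1, h2, h3⟩ : ∃ (w : V) (s : J → ℝ), (∀ j i, W.Top j i x →
      (W.φ j i).linear w = s j) ∧ (∀ k, W.ψ k x = 0 → (W.ψ k).linear w = 0) ∧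
      W.h.linear w < 0 := by
    rcases lt_or_gt_of_ne h3₀ with h | h
    · exact ⟨w₀, s₀, h1₀, h2₀, h⟩
    · refine ⟨-w₀, -s₀, fun j i hi => ?_, fun k hk => ?_, ?_⟩
      · simp [h1₀ j i hi]
      · simp [h2₀ k hk]
      · simpa using h
  let g : Option ((Σ j, ι j × ι j) ⊕ κ) → V →ᵃ[ℝ] ℝ := fun c => c.elim (W.h - AffineMap.const ℝ V a)
    (Sum.elim (fun t => if W.Top t.1 t.2.1 x then W.φ t.1 t.2.1 - W.φ t.1 t.2.2 else 0) W.ψ)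
  have hg : ∀ c, 0 ≤ g c x := by
    rintro (_ | ⟨j, i, l⟩ | k)
    · simpa [g] using ha.le
    · simp only [g, Option.elim, Sum.elim_inl]
      split_ifs with hi
      · simpa using hi l
      · simp
    · exact hx k
  have htan : ∀ c, g c x = 0 → (g c).linear w = 0 := by
    rintro (_ | ⟨j, i, l⟩ | k) h0
    · simp [g] at h0
      linarith
    · simp only [g, Option.elim, Sum.elim_inl] at h0 ⊢
      split_ifs at h0 ⊢ with hi
      · have hl : W.Top j l x := by
          intro l'
          have := hi l'
          simp at h0
          linarith
        simp [h1 j i hi, h1 j l hl]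
      · simp
    · exact h2 k h0
  obtain ⟨r, hr, hnn, c, hcx, hcy⟩ := exists_ray_exit g hg htan ⟨none, by simpa [g] using h3⟩
  have hadd : ∀ f : V →ᵃ[ℝ] ℝ, f (x + r • w) = f x + r * f.linear w := fun f => by
    rw [Arr.map_add, map_smul, smul_eq_mul]
  have hmax : ∀ j i l, W.Top j i x → W.φ j l (x + r • w) ≤ W.φ j i (x + r • w) := by
    intro j i l hi
    have := hnn (some (.inl ⟨j, i, l⟩))
    simp only [g, Option.elim, Sum.elim_inl, if_pos hi] at this
    simpa using this
  have hsub : W.act x ⊆ W.act (x + r • w) := by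
    rintro (⟨j, i⟩ | k) ht
    · exact fun l => hmax j i l ht
    · have ht' : W.ψ k x = 0 := ht
      change W.ψ k (x + r • w) = 0
      rw [hadd, h2 k ht', ht']
      ring
  refine ⟨x + r • w, fun k => hnn (some (.inr k)), ?_, ?_, hsub, ?_⟩
  · have := hnn none
    simpa [g] using this
  · rw [hadd]
    nlinarith
  · rcases c with _ | ⟨j, i, l⟩ | k
    · left
      simp [g] at hcy
      linarith
    · right
      intro he
      simp only [g, Option.elim, Sum.elim_inl] at hcx hcy
      split_ifs at hcx hcy with hi
      · simp only [AffineMap.coe_sub, Pi.sub_apply] at hcx hcy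
        have hl : (.inl ⟨j, l⟩ : (Σ j, ι j) ⊕ κ) ∈ W.act (x + r • w) := by
          intro l'
          have := hmax j i l' hi
          simp only
          linarith
        rw [← he] at hl
        have : W.φ j i x ≤ W.φ j l x := hl i
        linarith
      · simp at hcx
    · right
      intro he
      have hk : (.inr k : (Σ j, ι j) ⊕ κ) ∈ W.act (x + r • w) := hcy
      rw [← he] at hk
      have h4 : W.ψ k x = 0 := hk
      have h5 : 0 < W.ψ k x := hcx
      linarith

theorem exists_descent [Finite J] [∀ j, Finite (ι j)] [∀ j, Nonempty (ι j)] [Finite κ]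
    {a : ℝ} {x : V} (hx : ∀ k, 0 ≤ W.ψ k x) (ha : a ≤ W.h x) :
    ∃ y, (∀ k, 0 ≤ W.ψ k y) ∧ a ≤ W.h y ∧ W.h y ≤ W.h x ∧ W.act x ⊆ W.act y ∧
      (W.h y = a ∨ W.Crit y) := by
  induction hN : (W.act x)ᶜ.ncard using Nat.strong_induction_on generalizing x with
  | _ N ih =>
  by_cases hc : W.Crit x
  · exact ⟨x, hx, ha, le_rfl, Subset.rfl, Or.inr hc⟩
  rcases ha.eq_or_lt with hax | hax
  · exact ⟨x, hx, ha, le_rfl, Subset.rfl, Or.inl hax.symm⟩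
  obtain ⟨y, hy, hay, hyx, hsub, h | h⟩ := exists_step hx hax hc
  · exact ⟨y, hy, hay, hyx, hsub, Or.inl h⟩
  · have hss : (W.act y)ᶜ ⊂ (W.act x)ᶜ :=
      compl_lt_compl_iff_lt.2 (hsub.ssubset_of_ne h)
    obtain ⟨z, hz, haz, hzy, hsub', hfin⟩ :=
      ih _ (hN ▸ ncard_lt_ncard hss (toFinite _)) hy hay rfl
    exact ⟨z, hz, haz, hzy.trans hyx, hsub.trans hsub', hfin⟩

theorem Crit.height_eq {x y : V} (hx : W.Crit x) (h : W.act x = W.act y) [∀ j, Finite (ι j)]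
    [∀ j, Nonempty (ι j)] : W.h x = W.h y := by
  choose i hi using fun j => W.exists_top j x
  have hact : ∀ j i, W.Top j i x → W.Top j i y := fun j i hi =>
    (show (.inl ⟨j, i⟩ : (Σ j, ι j) ⊕ κ) ∈ W.act y from h ▸ hi)
  have hsub : ∀ f : V →ᵃ[ℝ] ℝ, f.linear (y - x) = f y - f x := fun f => by
    rw [← vsub_eq_sub, f.linearMap_vsub, vsub_eq_sub]
  have := hx (y - x) (fun j => (W.φ j (i j)).linear (y - x)) (fun j l hl => ?_) fun k hk => ?_
  · rw [hsub] at this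
    linarith
  · rw [hsub, hsub]
    have e1 := hl (i j)
    have e2 := hi j l
    have e3 := hact j l hl (i j)
    have e4 := hact j (i j) (hi j) l
    linarith
  · have hk' : W.ψ k y = 0 := (show (.inr k : (Σ j, ι j) ⊕ κ) ∈ W.act y from h ▸ hk)
    rw [hsub, hk, hk', sub_zero]

end Basic

end Sweep

namespace Sweep

section Slab

variable {V : Type} [NormedAddCommGroup V] [InnerProductSpace ℝ V]
  {J : Type} {ι : J → Type} {κ : Type} [Fintype J] [∀ j, Fintype (ι j)] [Fintype κ]
  (W : Sweep V ι κ)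

/-- The arrangement cut off at the height `a`. -/
@[reducible] noncomputable def slab (a : ℝ) : Arr V ι (Option κ) where
  base := 0
  dir := ⊤
  groups := Finset.univ
  idx := fun _ => Finset.univ
  ineqs := Finset.univ
  φ := W.φ
  ψ := fun o => o.elim (W.h - AffineMap.const ℝ V a) W.ψ

/-- The domain of the part of the arrangement between two heights. -/
def strip (a b : ℝ) : Set V := (W.slab a).domain ∩ {x | W.h x ≤ b}

variable {W} {a b : ℝ} {x : V}

theorem mem_domain_slab : x ∈ (W.slab a).domain ↔ (∀ k, 0 ≤ W.ψ k x) ∧ a ≤ W.h x := by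
  simp [Arr.domain, Arr.space, Option.forall, and_comm]

theorem mem_strip : x ∈ W.strip a b ↔ (∀ k, 0 ≤ W.ψ k x) ∧ a ≤ W.h x ∧ W.h x ≤ b := by
  rw [strip, mem_inter_iff, mem_domain_slab, and_assoc]
  rfl

theorem mem_con_inl {t : Σ j, ι j} : x ∈ (W.slab a).con (.inl t) ↔ W.Top t.1 t.2 x := by
  simp [Arr.con, Arr.IsMax, Top]

theorem mem_con_none : x ∈ (W.slab a).con (.inr none) ↔ W.h x ≤ a := by
  simp [Arr.con]

theorem mem_con_some {k : κ} : x ∈ (W.slab a).con (.inr (some k)) ↔ W.ψ k x ≤ 0 := by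
  simp [Arr.con]

theorem mem_fam {S : Set ((Σ j, ι j) ⊕ Option κ)} : S ∈ (W.slab a).fam ↔
    ∀ j, ∃ i i', i ≠ i' ∧ .inl ⟨j, i⟩ ∈ S ∧ .inl ⟨j, i'⟩ ∈ S := by
  simp [Arr.fam]

theorem mem_famOn {S : Set ((Σ j, ι j) ⊕ Option κ)} : S ∈ (W.slab a).famOn (fun _ => True) ↔
    S ∈ (W.slab a).fam ∧ ∃ o, .inr o ∈ S := by
  simp [Arr.famOn]

theorem bent_slab : (W.slab a).Bent x ↔ ∀ j, ∃ i i', i ≠ i' ∧ W.Top j i x ∧ W.Top j i' x := by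
  simp [Arr.Bent, Arr.IsMax, Top]

theorem mem_body_slab : x ∈ (W.slab a).body ↔ W.Feas x ∧ a ≤ W.h x := by
  simp only [Arr.body, mem_ofPred_eq, mem_domain_slab, bent_slab, Feas]
  tauto

theorem mem_bdry_slab : x ∈ (W.slab a).bdry ↔ W.Feas x ∧ a ≤ W.h x ∧
    (W.h x = a ∨ ∃ k, W.ψ k x = 0) := by
  simp only [Arr.bdry, mem_ofPred_eq, mem_body_slab]
  simp [and_assoc, sub_eq_zero, Option.exists]

theorem convex_strip : Convex ℝ (W.strip a b) :=
  Arr.convex_domain.inter ((convex_Iic b).affine_preimage W.h)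

theorem isClosed_strip [FiniteDimensional ℝ V] : IsClosed (W.strip a b) :=
  Arr.isClosed_domain.inter (isClosed_height_le W b)

theorem cells_strip_fam :
    cells (W.strip a b) (W.slab a).con (W.slab a).fam = (W.slab a).body ∩ {x | W.h x ≤ b} := by
  ext x
  rw [mem_cells Arr.isUpperSet_fam, Arr.bent_iff]
  simp only [strip, mem_inter_iff, Arr.body, mem_ofPred_eq]
  tauto

theorem cells_strip_famOn :
    cells (W.strip a b) (W.slab a).con ((W.slab a).famOn fun _ => True) =
      (W.slab a).bdry ∩ {x | W.h x ≤ b} := by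
  rw [← Arr.cells_famOn_true]
  ext x
  rw [mem_inter_iff, mem_cells (Arr.isUpperSet_famOn _), mem_cells (Arr.isUpperSet_famOn _)]
  simp only [strip, mem_inter_iff]
  tauto

theorem mem_con_of_act_subset {y : V} (h : W.act x ⊆ W.act y) (hx : ∀ k, 0 ≤ W.ψ k x)
    {t : (Σ j, ι j) ⊕ Option κ} (ht : t ≠ .inr none) (hxt : x ∈ (W.slab a).con t) :
    y ∈ (W.slab a).con t := by
  rcases t with t | _ | k
  · rw [mem_con_inl] at hxt ⊢
    exact h (a := .inl t) hxt
  · exact absurd rfl ht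
  · rw [mem_con_some] at hxt ⊢
    exact (h (a := .inr k) (le_antisymm hxt (hx k))).le

/-- A cell of the strip reaches the bottom unless it contains a critical point. -/
theorem meet_or_crit [∀ j, Nonempty (ι j)] {T : Set ((Σ j, ι j) ⊕ Option κ)}
    (hT : T ∈ (W.slab a).fam) (hne : (cell (W.strip a b) (W.slab a).con T).Nonempty) :
    (cell (W.strip a b) (W.slab a).con T ∩ {x | W.h x ≤ a}).Nonempty ∨
      ∃ v ∈ cell (W.strip a b) (W.slab a).con T, W.Crit v ∧ W.Feas v ∧ a < W.h v := by
  obtain ⟨x, hx⟩ := hne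
  have hx' := mem_cell.1 hx
  have hxs := mem_strip.1 hx'.1
  obtain ⟨y, hy, hay, hyx, hsub, hfin⟩ := exists_descent hxs.1 hxs.2.1
  rcases hxs.2.1.eq_or_lt with h | hlt
  · exact Or.inl ⟨x, hx, h.ge⟩
  have hyT : y ∈ cell (W.strip a b) (W.slab a).con T := by
    refine mem_cell.2 ⟨mem_strip.2 ⟨hy, hay, hyx.trans hxs.2.2⟩, fun t ht => ?_⟩
    refine mem_con_of_act_subset hsub hxs.1 (fun h => ?_) (hx'.2 t ht)
    have := hx'.2 t ht
    rw [h, mem_con_none] at this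
    linarith
  rcases hay.eq_or_lt with h | h
  · exact Or.inl ⟨y, hyT, h.ge⟩
  · refine Or.inr ⟨y, hyT, hfin.resolve_left h.ne', ⟨fun j => ?_, hy⟩, h⟩
    obtain ⟨i, i', hii, h1, h2⟩ := mem_fam.1 hT j
    have := (mem_cell.1 hyT).2
    exact ⟨i, i', hii, mem_con_inl.1 (this _ h1), mem_con_inl.1 (this _ h2)⟩

variable [FiniteDimensional ℝ V]

/-- Without critical points the strip can be pushed to its boundary. -/
theorem compressible_strip_of_no_crit [∀ j, Nonempty (ι j)]
    (hno : ∀ v, W.Crit v → W.Feas v → a < W.h v → b < W.h v) (m : ℕ) :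
    Compressible m ((W.slab a).body ∩ {x | W.h x ≤ b}) ((W.slab a).bdry ∩ {x | W.h x ≤ b}) := by
  have h := expands_cells (Q := W.strip a b) (H := (W.slab a).con) (F := {x | W.h x ≤ a})
    isClosed_strip convex_strip Arr.isClosed_con Arr.convex_con (isClosed_height_le W a)
    ((convex_Iic a).affine_preimage W.h) (𝓦 := (W.slab a).famOn fun _ => True)
    (𝓦' := (W.slab a).fam) (Arr.isUpperSet_famOn _) Arr.isUpperSet_fam (fun S hS => hS.1) (by
      intro S hS _ T hST hne
      refine (meet_or_crit (Arr.isUpperSet_fam hST hS) hne).resolve_right ?_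
      rintro ⟨v, hv, hc, hf, hav⟩
      have := (mem_strip.1 (mem_cell.1 hv).1).2.2
      exact absurd (hno v hc hf hav) (by linarith))
  rw [cells_strip_fam, cells_strip_famOn, union_eq_self_of_subset_right] at h
  · exact (h.2 m).1
  · rintro x ⟨⟨hx, hxb⟩, hxa⟩
    rw [mem_body_slab] at hx
    exact ⟨mem_bdry_slab.2 ⟨hx.1, hx.2, Or.inl (le_antisymm hxa hx.2)⟩, hxb⟩

end Slab

end Sweep

namespace Sweep

section Germ

variable {V : Type} [NormedAddCommGroup V] [InnerProductSpace ℝ V]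
  {J : Type} {ι : J → Type} {κ : Type} (W : Sweep V ι κ)

/-- The constraints that matter near `v`. -/
def LocIdx (v : V) (t : (Σ j, ι j) ⊕ Option κ) : Prop :=
  Sum.elim (fun t => W.Top t.1 t.2 v) (fun o => ∀ k ∈ o, W.ψ k v = 0) t

/-- A convex region near `v` on which only the functions active at `v` matter. -/
def germ (v : V) (b : ℝ) : Set V :=
  {x | (∀ j i l, W.Top j i v → ¬ W.Top j l v → W.φ j l x ≤ W.φ j i x) ∧
    (∀ k, 0 ≤ W.ψ k x) ∧ W.h x ≤ b}

variable {W} {v : V} {b : ℝ}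

theorem germ_eq : W.germ v b = (⋂ (j) (i) (l) (_ : W.Top j i v) (_ : ¬ W.Top j l v),
    {x | W.φ j l x ≤ W.φ j i x}) ∩ ((⋂ k, {x | 0 ≤ W.ψ k x}) ∩ {x | W.h x ≤ b}) := by
  ext x
  simp [germ]

theorem convex_germ : Convex ℝ (W.germ v b) := by
  rw [germ_eq]
  refine Convex.inter ?_ ((convex_iInter fun k => Arr.convex_nonneg _).inter
    ((convex_Iic b).affine_preimage W.h))
  exact convex_iInter fun j => convex_iInter fun i => convex_iInter fun l =>
    convex_iInter fun _ => convex_iInter fun _ => Arr.convex_le _ _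

theorem isClosed_germ [FiniteDimensional ℝ V] : IsClosed (W.germ v b) := by
  rw [germ_eq]
  refine IsClosed.inter ?_ ((isClosed_iInter fun k => isClosed_le continuous_const
    (Arr.continuous_affine _)).inter (isClosed_height_le W b))
  exact isClosed_iInter fun j => isClosed_iInter fun i => isClosed_iInter fun l =>
    isClosed_iInter fun _ => isClosed_iInter fun _ => isClosed_le (Arr.continuous_affine _)
      (Arr.continuous_affine _)

theorem Top.eq {j : J} {i l : ι j} (hi : W.Top j i v) (hl : W.Top j l v) :
    W.φ j i v = W.φ j l v := le_antisymm (hl i) (hi l)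

theorem mem_germ_self (hv : W.Feas v) (hb : W.h v ≤ b) : v ∈ W.germ v b :=
  ⟨fun _ _ l hi _ => hi l, hv.2, hb⟩

end Germ

section Local

variable {V : Type} [NormedAddCommGroup V] [InnerProductSpace ℝ V]
  {J : Type} {ι : J → Type} {κ : Type} [Fintype J] [∀ j, Fintype (ι j)] [Fintype κ]
  (W : Sweep V ι κ)

open scoped Classical in
/-- The arrangement of the functions active at `v`, cut off at the height `a`. -/
@[reducible] noncomputable def loc (v : V) (a : ℝ) : Arr V ι (Option κ) where
  base := 0
  dir := ⊤
  groups := Finset.univ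
  idx := fun j => {i | W.Top j i v}
  ineqs := {o | ∀ k ∈ o, W.ψ k v = 0}
  φ := W.φ
  ψ := fun o => o.elim (W.h - AffineMap.const ℝ V a) W.ψ

variable {W} {v : V} {a b : ℝ} {x : V}

theorem mem_domain_loc : x ∈ (W.loc v a).domain ↔
    a ≤ W.h x ∧ ∀ k, W.ψ k v = 0 → 0 ≤ W.ψ k x := by
  simp [Arr.domain, Arr.space, Option.forall]

theorem isMax_loc {j : J} {i : ι j} : (W.loc v a).IsMax j i x ↔
    ∀ l, W.Top j l v → W.φ j l x ≤ W.φ j i x := by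
  simp [Arr.IsMax]

theorem mem_con_loc_inl {j : J} {i : ι j} : x ∈ (W.loc v a).con (.inl ⟨j, i⟩) ↔
    (W.Top j i v → ∀ l, W.Top j l v → W.φ j l x ≤ W.φ j i x) := by
  simp [Arr.con, Arr.IsMax]

theorem mem_con_loc_none : x ∈ (W.loc v a).con (.inr none) ↔ W.h x ≤ a := by
  simp [Arr.con]

theorem mem_con_loc_some {k : κ} : x ∈ (W.loc v a).con (.inr (some k)) ↔
    (W.ψ k v = 0 → W.ψ k x ≤ 0) := by
  simp [Arr.con]

theorem locIdx_of_mem_con (hv : W.Feas v) {t : (Σ j, ι j) ⊕ Option κ}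
    (h : v ∈ (W.slab a).con t) : W.LocIdx v t := by
  rcases t with t | _ | k
  · exact mem_con_inl.1 h
  · intro k hk
    simp at hk
  · intro l hl
    obtain rfl : k = l := by simpa using hl
    exact le_antisymm (mem_con_some.1 h) (hv.2 k)

theorem mem_con_of_locIdx {t : (Σ j, ι j) ⊕ Option κ} (h : W.LocIdx v t) (ht : t ≠ .inr none) :
    v ∈ (W.slab a).con t := by
  rcases t with t | _ | k
  · exact mem_con_inl.2 h
  · exact absurd rfl ht
  · exact mem_con_some.2 (h k rfl).le

/-- Cutting close to `v`, all nonempty local cells have points near `v`. -/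
theorem eventually_meet_germ [FiniteDimensional ℝ V] (hv : W.Feas v) (hb : W.h v ≤ b) :
    ∀ᶠ a in 𝓝[<] (W.h v), ∀ T, (cell (W.loc v a).domain (W.loc v a).con T).Nonempty →
      (cell (W.loc v a).domain (W.loc v a).con T ∩ W.germ v b).Nonempty := by
  refine eventually_all.2 fun T => ?_
  by_cases hT : .inr none ∈ T
  swap
  · filter_upwards [self_mem_nhdsWithin] with a ha _
    have ha' : a < W.h v := ha
    refine ⟨v, mem_cell.2 ⟨mem_domain_loc.2 ⟨ha'.le, fun k _ => hv.2 k⟩, fun t ht => ?_⟩,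
      mem_germ_self hv hb⟩
    rcases t with ⟨j, i⟩ | _ | k
    · exact mem_con_loc_inl.2 fun hi l _ => hi l
    · exact absurd ht hT
    · exact mem_con_loc_some.2 fun h => h.le
  by_cases hw : ∃ w, W.h.linear w = -1 ∧
      (∀ j i l, .inl ⟨j, i⟩ ∈ T → W.Top j i v → W.Top j l v →
        (W.φ j l).linear w ≤ (W.φ j i).linear w) ∧
      (∀ k, W.ψ k v = 0 → 0 ≤ (W.ψ k).linear w) ∧
      ∀ k, .inr (some k) ∈ T → W.ψ k v = 0 → (W.ψ k).linear w ≤ 0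
  · obtain ⟨w, hw0, hw1, hw2, hw3⟩ := hw
    have hadd : ∀ (f : V →ᵃ[ℝ] ℝ) (r : ℝ), f (v + r • w) = f v + r * f.linear w := fun f r => by
      rw [Arr.map_add, map_smul, smul_eq_mul]
    have hnear : ∀ᶠ x in 𝓝 v, (∀ j i l, W.Top j i v → ¬ W.Top j l v → W.φ j l x < W.φ j i x) ∧
        ∀ k, W.ψ k v ≠ 0 → 0 < W.ψ k x := by
      refine Filter.Eventually.and (eventually_all.2 fun j => eventually_all.2 fun i =>
        eventually_all.2 fun l => ?_) (eventually_all.2 fun k => ?_)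
      · by_cases h : W.Top j i v ∧ ¬ W.Top j l v
        · have hlt : W.φ j l v < W.φ j i v := by
            refine lt_of_le_of_ne (h.1 l) fun he => h.2 fun l' => ?_
            rw [he]
            exact h.1 l'
          filter_upwards [(Arr.continuous_affine (W.φ j l)).continuousAt.eventually_lt
            (Arr.continuous_affine (W.φ j i)).continuousAt hlt] with x hx _ _ using hx
        · exact Eventually.of_forall fun x h1 h2 => absurd ⟨h1, h2⟩ h
      · by_cases h : W.ψ k v = 0
        · exact Eventually.of_forall fun x h1 => absurd h h1
        · have hlt : 0 < W.ψ k v := lt_of_le_of_ne (hv.2 k) (Ne.symm h)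
          filter_upwards [continuousAt_const.eventually_lt
            (Arr.continuous_affine (W.ψ k)).continuousAt hlt] with x hx _ using hx
    have htend : Tendsto (fun a => v + (W.h v - a) • w) (𝓝[<] (W.h v)) (𝓝 v) := by
      have : Continuous fun a : ℝ => v + (W.h v - a) • w := by fun_prop
      have h2 := this.tendsto (W.h v)
      simp only [sub_self, zero_smul, add_zero] at h2
      exact h2.mono_left nhdsWithin_le_nhds
    filter_upwards [self_mem_nhdsWithin, htend.eventually hnear] with a ha hx _
    have ha' : 0 ≤ W.h v - a := by
      have : a < W.h v := ha
      linarith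
    have hh : W.h (v + (W.h v - a) • w) = a := by
      rw [hadd, hw0]
      ring
    have hψ : ∀ k, W.ψ k v = 0 → 0 ≤ W.ψ k (v + (W.h v - a) • w) := fun k hk => by
      rw [hadd, hk, zero_add]
      exact mul_nonneg ha' (hw2 k hk)
    refine ⟨v + (W.h v - a) • w, mem_cell.2 ⟨mem_domain_loc.2 ⟨hh.ge, hψ⟩, fun t ht => ?_⟩,
      fun j i l hi hl => (hx.1 j i l hi hl).le, fun k => ?_, ?_⟩
    · rcases t with ⟨j, i⟩ | _ | k
      · refine mem_con_loc_inl.2 fun hi l hl => ?_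
        rw [hadd, hadd, hi.eq hl]
        have := mul_le_mul_of_nonneg_left (hw1 j i l ht hi hl) ha'
        linarith
      · exact mem_con_loc_none.2 hh.le
      · refine mem_con_loc_some.2 fun hk => ?_
        rw [hadd, hk, zero_add]
        exact mul_nonpos_of_nonneg_of_nonpos ha' (hw3 k ht hk)
    · by_cases hk : W.ψ k v = 0
      · exact hψ k hk
      · exact (hx.2 k hk).le
    · rw [hh]
      linarith
  · filter_upwards [self_mem_nhdsWithin] with a ha hne
    refine absurd ?_ hw
    obtain ⟨x, hx⟩ := hne
    have hx' := mem_cell.1 hx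
    have hxd := mem_domain_loc.1 hx'.1
    have ha' : 0 < W.h v - a := by
      have : a < W.h v := ha
      linarith
    have hh : W.h x = a := le_antisymm (mem_con_loc_none.1 (hx'.2 _ hT)) hxd.1
    have hlin : ∀ f : V →ᵃ[ℝ] ℝ, f.linear ((W.h v - a)⁻¹ • (x - v)) =
        (W.h v - a)⁻¹ * (f x - f v) := fun f => by
      rw [map_smul, smul_eq_mul, ← vsub_eq_sub x v, f.linearMap_vsub, vsub_eq_sub]
    have hinv : 0 ≤ (W.h v - a)⁻¹ := (inv_pos.2 ha').le
    refine ⟨(W.h v - a)⁻¹ • (x - v), ?_, fun j i l hT' hi hl => ?_, fun k hk => ?_,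
      fun k hT' hk => ?_⟩
    · rw [hlin, hh]
      field_simp
      ring
    · rw [hlin, hlin, hi.eq hl]
      refine mul_le_mul_of_nonneg_left ?_ hinv
      have := mem_con_loc_inl.1 (hx'.2 _ hT') hi l hl
      linarith
    · rw [hlin, hk, sub_zero]
      exact mul_nonneg hinv (hxd.2 k hk)
    · rw [hlin, hk, sub_zero]
      exact mul_nonpos_of_nonneg_of_nonpos hinv (mem_con_loc_some.1 (hx'.2 _ hT') hk)

end Local

end Sweep

namespace Sweep

section Passing

variable {V : Type} [NormedAddCommGroup V] [InnerProductSpace ℝ V]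
  {J : Type} {ι : J → Type} {κ : Type} [Fintype J] [∀ j, Fintype (ι j)] [Fintype κ]
  {W : Sweep V ι κ} {v : V} {a b : ℝ}

/-- The functions active at `v` are independent, with a prescribed number of them. -/
def Regular (W : Sweep V ι κ) (m : ℕ) (v : V) : Prop :=
  ∀ a, (∀ t, (W.loc v a).Index t → (W.loc v a).IndepExcept t) ∧
    (W.loc v a).excess + (W.loc v a).ineqs.card - 1 = m

theorem simplicial_loc {m : ℕ} (hv : W.Feas v) (hc : W.Crit v) (hreg : W.Regular m v)
    (ha : a < W.h v) : (W.loc v a).Simplicial where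
  two_le := by
    intro j _
    obtain ⟨i, i', hne, hi, hi'⟩ := hv.1 j
    exact Finset.one_lt_card.2 ⟨i, by simpa using hi, i', by simpa using hi', hne⟩
  indep := (hreg a).1
  not_tight := by
    rintro x - ⟨h1, h2⟩
    have hsub : ∀ f : V →ᵃ[ℝ] ℝ, f.linear (x - v) = f x - f v := fun f => by
      rw [← vsub_eq_sub, f.linearMap_vsub, vsub_eq_sub]
    choose i i' hne hi hi' using hv.1
    have h0 := hc (x - v) (fun j => (W.φ j (i j)).linear (x - v)) (fun j l hl => by
      have := h1 j (Finset.mem_univ _) l (by simpa using hl) (i j) (by simpa using hi j)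
      rw [hsub, hsub, hl.eq (hi j), this]) (fun k hk => by
      have : W.ψ k x = 0 := h2 (some k) (by simpa using hk)
      rw [hsub, hk, this, sub_zero])
    have h3 : W.h x - a = 0 := by simpa using h2 none (by simp)
    rw [hsub] at h0
    linarith

theorem bdry_loc_inter_germ : (W.loc v a).bdry ∩ W.germ v b =
    {x | x ∈ W.germ v b ∧ a ≤ W.h x ∧
      (∀ j, ∃ i i', i ≠ i' ∧ (W.Top j i v ∧ W.Top j i x) ∧ W.Top j i' v ∧ W.Top j i' x) ∧
      (W.h x = a ∨ ∃ k, W.ψ k v = 0 ∧ W.ψ k x = 0)} := by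
  ext x
  have htop : x ∈ W.germ v b → ∀ j i, W.Top j i v →
      ((W.loc v a).IsMax j i x ↔ W.Top j i x) := by
    intro hx j i hi
    rw [isMax_loc]
    refine ⟨fun h l => ?_, fun h l _ => h l⟩
    by_cases hl : W.Top j l v
    · exact h l hl
    · exact hx.1 j i l hi hl
  simp only [mem_inter_iff, Arr.bdry, Arr.body, mem_ofPred_eq, mem_domain_loc, Arr.Bent,
    Finset.mem_univ, true_imp_iff, Finset.mem_filter, true_and, Option.exists]
  constructor
  · rintro ⟨⟨⟨⟨h1, h2⟩, h3⟩, h4⟩, hx⟩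
    refine ⟨hx, h1, fun j => ?_, ?_⟩
    · obtain ⟨i, hi, i', hi', hne, h5, h6⟩ := h3 j
      exact ⟨i, i', hne, ⟨hi, (htop hx j i hi).1 h5⟩, hi', (htop hx j i' hi').1 h6⟩
    · rcases h4 with h4 | ⟨k, hk, h4⟩
      · exact Or.inl (by simpa [sub_eq_zero] using h4)
      · exact Or.inr ⟨k, hk k rfl, h4⟩
  · rintro ⟨hx, h1, h3, h4⟩
    refine ⟨⟨⟨⟨h1, fun k _ => hx.2.1 k⟩, fun j => ?_⟩, ?_⟩, hx⟩
    · obtain ⟨i, i', hne, ⟨hi, h5⟩, hi', h6⟩ := h3 j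
      exact ⟨i, hi, i', hi', hne, (htop hx j i hi).2 h5, (htop hx j i' hi').2 h6⟩
    · rcases h4 with h4 | ⟨k, hk, h4⟩
      · exact Or.inl ⟨by simp, by simpa [sub_eq_zero] using h4⟩
      · exact Or.inr ⟨k, by simpa using hk, h4⟩

/-- The sets of constraints met by the part of the boundary near `v`. -/
def linkFam (W : Sweep V ι κ) (v : V) (a : ℝ) : Set (Set ((Σ j, ι j) ⊕ Option κ)) :=
  {U | U ∩ {t | W.LocIdx v t} ∈ (W.slab a).fam ∧ ∃ o, W.LocIdx v (.inr o) ∧ .inr o ∈ U}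

theorem isUpperSet_linkFam : IsUpperSet (W.linkFam v a) := by
  rintro S T hST ⟨h1, o, h2, h3⟩
  exact ⟨Arr.isUpperSet_fam (inter_subset_inter_left _ hST) h1, o, h2, hST h3⟩

variable [FiniteDimensional ℝ V]

theorem isExtensor_loc {m : ℕ} (hv : W.Feas v) (hc : W.Crit v) (hreg : W.Regular m v)
    (ha : a < W.h v) : IsExtensor m (W.loc v a).bdry := by
  have h := (simplicial_loc hv hc hreg ha).isExtensor (k := none) (v := v) (by simp)
    (by simp [Arr.space]) ⟨fun j _ i hi i' hi' => ?_, fun o ho hne => ?_⟩ (by simpa using ha)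
  · rwa [(hreg a).2] at h
  · exact Top.eq (by simpa using hi) (by simpa using hi')
  · obtain ⟨k, rfl⟩ := Option.ne_none_iff_exists'.1 hne
    simpa using ho

/-- Near a regular critical point, the link is highly connected. -/
theorem isExtensor_linkFam {m : ℕ} (hv : W.Feas v) (hc : W.Crit v) (hreg : W.Regular m v)
    (ha : a < W.h v)
    (hmeet : ∀ T, (cell (W.loc v a).domain (W.loc v a).con T).Nonempty →
      (cell (W.loc v a).domain (W.loc v a).con T ∩ W.germ v b).Nonempty) :
    IsExtensor m (cells (W.strip a b) (W.slab a).con (W.linkFam v a)) := by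
  classical
  have h1 : IsExtensor m ((W.loc v a).bdry ∩ W.germ v b) := by
    have h := expands_cells (Q := (W.loc v a).domain) (H := (W.loc v a).con) (F := W.germ v b)
      Arr.isClosed_domain Arr.convex_domain Arr.isClosed_con Arr.convex_con isClosed_germ
      convex_germ (𝓦 := ∅) (𝓦' := (W.loc v a).famOn fun _ => True) isUpperSet_empty
      (Arr.isUpperSet_famOn _) (empty_subset _) fun S _ _ T _ => hmeet T
    rw [Arr.cells_famOn_true] at h
    simp only [cells, mem_empty_iff_false, iUnion_of_empty, iUnion_empty, empty_union] at h
    exact (h.isExtensor_iff m).1 (isExtensor_loc hv hc hreg ha)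
  set H' : (Σ j, ι j) ⊕ Option κ → Set V := fun t => if W.LocIdx v t then (W.slab a).con t else univ
    with hH'
  have hcells : cells (W.strip a b) (W.slab a).con (W.linkFam v a) =
      cells (W.strip a b) H' (W.linkFam v a) := by
    ext x
    rw [mem_cells isUpperSet_linkFam, mem_cells isUpperSet_linkFam]
    have hset : {t | x ∈ (W.slab a).con t} ∩ {t | W.LocIdx v t} =
        {t | x ∈ H' t} ∩ {t | W.LocIdx v t} := by
      ext t
      simp only [hH', mem_inter_iff, mem_ofPred_eq]
      refine and_congr_left fun ht => ?_
      rw [if_pos ht]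
    simp only [linkFam, mem_ofPred_eq, hset]
    refine and_congr_right fun _ => and_congr_right fun _ => exists_congr fun o =>
      and_congr_right fun ho => ?_
    rw [hH']
    simp only [if_pos ho]
  have hHc : ∀ t, IsClosed (H' t) := fun t => by
    by_cases h : W.LocIdx v t
    · simpa [hH', h] using Arr.isClosed_con t
    · simp [hH', h]
  have hHx : ∀ t, Convex ℝ (H' t) := fun t => by
    by_cases h : W.LocIdx v t
    · simpa [hH', h] using Arr.convex_con t
    · simpa [hH', h] using convex_univ
  rw [hcells]
  have h := expands_cells (Q := W.strip a b) (H := H') (F := W.germ v b) isClosed_strip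
    convex_strip hHc hHx isClosed_germ convex_germ (𝓦 := ∅) (𝓦' := W.linkFam v a)
    isUpperSet_empty isUpperSet_linkFam (empty_subset _) (by
      rintro S - - T - ⟨x, hx⟩
      have hx' := mem_cell.1 hx
      have hxs := mem_strip.1 hx'.1
      obtain ⟨y, hy, hyg⟩ := hmeet T ⟨x, mem_cell.2 ⟨mem_domain_loc.2 ⟨hxs.2.1, fun k _ =>
        hxs.1 k⟩, fun t ht => by
          have hxt := hx'.2 t ht
          rcases t with ⟨j, i⟩ | _ | k
          · refine mem_con_loc_inl.2 fun hi l _ => ?_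
            rw [hH'] at hxt
            simp only at hxt
            rw [if_pos (show W.LocIdx v (.inl ⟨j, i⟩) from hi), mem_con_inl] at hxt
            exact hxt l
          · rw [hH'] at hxt
            simp only at hxt
            rw [if_pos (by simp [LocIdx]), mem_con_none] at hxt
            exact mem_con_loc_none.2 hxt
          · refine mem_con_loc_some.2 fun hk => ?_
            rw [hH'] at hxt
            simp only at hxt
            rwa [if_pos (by simpa [LocIdx] using hk), mem_con_some] at hxt⟩⟩
      have hy' := mem_cell.1 hy
      refine ⟨y, mem_cell.2 ⟨mem_strip.2 ⟨hyg.2.1, (mem_domain_loc.1 hy'.1).1, hyg.2.2⟩,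
        fun t ht => ?_⟩, hyg⟩
      have hyt := hy'.2 t ht
      rw [hH']
      simp only
      split_ifs with hloc
      · rcases t with ⟨j, i⟩ | _ | k
        · refine mem_con_inl.2 fun l => ?_
          by_cases hl : W.Top j l v
          · exact mem_con_loc_inl.1 hyt hloc l hl
          · exact hyg.1 j i l hloc hl
        · exact mem_con_none.2 (mem_con_loc_none.1 hyt)
        · exact mem_con_some.2 (mem_con_loc_some.1 hyt (hloc k rfl))
      · trivial)
  simp only [cells, mem_empty_iff_false, iUnion_of_empty, iUnion_empty, empty_union] at h
  refine (h.isExtensor_iff m).2 ?_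
  change IsExtensor m (cells (W.strip a b) H' (W.linkFam v a) ∩ W.germ v b)
  rw [← hcells]
  convert h1 using 1
  rw [bdry_loc_inter_germ]
  ext x
  rw [mem_inter_iff, mem_cells isUpperSet_linkFam]
  simp only [linkFam, mem_ofPred_eq, mem_fam, mem_inter_iff, mem_con_inl, mem_strip,
    Option.exists, mem_con_none, mem_con_some]
  constructor
  · rintro ⟨⟨⟨h2, h3, h4⟩, h5, h6⟩, h7⟩
    refine ⟨h7, h3, fun j => ?_, ?_⟩
    · obtain ⟨i, i', hne, h8, h9⟩ := h5 j
      exact ⟨i, i', hne, h8.symm, h9.symm⟩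
    · rcases h6 with h6 | ⟨k, hk, h6⟩
      · exact Or.inl (le_antisymm h6.2 h3)
      · exact Or.inr ⟨k, hk k rfl, le_antisymm h6 (h2 k)⟩
  · rintro ⟨h7, h3, h5, h6⟩
    refine ⟨⟨⟨h7.2.1, h3, h7.2.2⟩, fun j => ?_, ?_⟩, h7⟩
    · obtain ⟨i, i', hne, h8, h9⟩ := h5 j
      exact ⟨i, i', hne, h8.symm, h9.symm⟩
    · rcases h6 with h6 | ⟨k, hk, h6⟩
      · exact Or.inl ⟨by simp [LocIdx], h6.le⟩
      · exact Or.inr ⟨k, by simpa [LocIdx] using hk, h6.le⟩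

/-- A strip with a single regular critical point can be pushed to its boundary. -/
theorem compressible_strip_of_crit [∀ j, Nonempty (ι j)] {m : ℕ} (hv : W.Feas v) (hc : W.Crit v)
    (hreg : W.Regular m v) (ha : a < W.h v) (hb : W.h v ≤ b)
    (hmeet : ∀ T, (cell (W.loc v a).domain (W.loc v a).con T).Nonempty →
      (cell (W.loc v a).domain (W.loc v a).con T ∩ W.germ v b).Nonempty)
    (honly : ∀ u, W.Crit u → W.Feas u → a < W.h u → W.h u ≤ b → u = v) :
    Compressible m ((W.slab a).body ∩ {x | W.h x ≤ b}) ((W.slab a).bdry ∩ {x | W.h x ≤ b}) := by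
  have hreach : ∀ S, ¬ S ⊆ {t | W.LocIdx v t} → S ∈ (W.slab a).fam → ∀ T, S ⊆ T →
      (cell (W.strip a b) (W.slab a).con T).Nonempty →
      (cell (W.strip a b) (W.slab a).con T ∩ {x | W.h x ≤ a}).Nonempty := by
    intro S hS hSf T hST hne
    refine (meet_or_crit (Arr.isUpperSet_fam hST hSf) hne).resolve_right ?_
    rintro ⟨u, hu, huc, huf, hau⟩
    have hu' := mem_cell.1 hu
    obtain rfl := honly u huc huf hau (mem_strip.1 hu'.1).2.2
    exact hS fun t ht => locIdx_of_mem_con hv (hu'.2 t (hST ht))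
  set 𝓡 : Set (Set ((Σ j, ι j) ⊕ Option κ)) := {S | S ∈ (W.slab a).fam ∧
    ((∃ o, .inr o ∈ S) ∨ ¬ S ⊆ {t | W.LocIdx v t})} with h𝓡
  set 𝓣 : Set (Set ((Σ j, ι j) ⊕ Option κ)) := {S | S ∈ (W.slab a).fam ∧
    S ⊆ {t | W.LocIdx v t}} with h𝓣
  set 𝓠 : Set (Set ((Σ j, ι j) ⊕ Option κ)) := {U | U ∩ {t | W.LocIdx v t} ∈ (W.slab a).fam ∧
    ((∃ o, .inr o ∈ U) ∨ ¬ U ⊆ {t | W.LocIdx v t})} with h𝓠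
  have hup : IsUpperSet 𝓡 := by
    rintro S T hST ⟨h1, h2⟩
    refine ⟨Arr.isUpperSet_fam hST h1, h2.imp ?_ ?_⟩
    · rintro ⟨o, ho⟩
      exact ⟨o, hST ho⟩
    · exact fun h h' => h (hST.trans h')
  have hup' : IsUpperSet 𝓠 := by
    rintro S T hST ⟨h1, h2⟩
    refine ⟨Arr.isUpperSet_fam (inter_subset_inter_left _ hST) h1, h2.imp ?_ ?_⟩
    · rintro ⟨o, ho⟩
      exact ⟨o, hST ho⟩
    · exact fun h h' => h (hST.trans h')
  have hbot : ∀ 𝓖 : Set (Set ((Σ j, ι j) ⊕ Option κ)), IsUpperSet 𝓖 → ∀ x,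
      x ∈ cells (W.strip a b) (W.slab a).con 𝓖 ∩ {x | W.h x ≤ a} →
      x ∈ W.strip a b ∧ {t | x ∈ (W.slab a).con t} ∈ 𝓖 ∧
        .inr none ∈ {t | x ∈ (W.slab a).con t} := by
    rintro 𝓖 h𝓖 x ⟨hx, hxa⟩
    rw [mem_cells h𝓖] at hx
    exact ⟨hx.1, hx.2, mem_con_none.2 hxa⟩
  have hR : Compressible m (cells (W.strip a b) (W.slab a).con 𝓡)
      (cells (W.strip a b) (W.slab a).con ((W.slab a).famOn fun _ => True)) := by
    have h := expands_cells (Q := W.strip a b) (H := (W.slab a).con) (F := {x | W.h x ≤ a})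
      isClosed_strip convex_strip Arr.isClosed_con Arr.convex_con (isClosed_height_le W a)
      ((convex_Iic a).affine_preimage W.h) (𝓦 := (W.slab a).famOn fun _ => True) (𝓦' := 𝓡)
      (Arr.isUpperSet_famOn _) hup
      (fun S hS => by
        rw [mem_famOn] at hS
        exact ⟨hS.1, Or.inl hS.2⟩)
      (fun S hS hS' => by
        refine hreach S (hS.2.resolve_left fun h => hS' ?_) hS.1
        exact mem_famOn.2 ⟨hS.1, h⟩)
    rw [union_eq_self_of_subset_right] at h
    · exact (h.2 m).1
    · intro x hx
      obtain ⟨h1, h2, h3⟩ := hbot 𝓡 hup x hx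
      rw [mem_cells (Arr.isUpperSet_famOn _), mem_famOn]
      exact ⟨h1, h2.1, none, h3⟩
  have hQ : IsExtensor m (cells (W.strip a b) (W.slab a).con 𝓠) := by
    have h := expands_cells (Q := W.strip a b) (H := (W.slab a).con) (F := {x | W.h x ≤ a})
      isClosed_strip convex_strip Arr.isClosed_con Arr.convex_con (isClosed_height_le W a)
      ((convex_Iic a).affine_preimage W.h) (𝓦 := W.linkFam v a) (𝓦' := 𝓠)
      isUpperSet_linkFam hup'
      (fun S hS => ⟨hS.1, Or.inl ⟨hS.2.choose, hS.2.choose_spec.2⟩⟩)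
      (fun S hS hS' => by
        refine hreach S (fun hloc => ?_) (Arr.isUpperSet_fam inter_subset_left hS.1)
        rcases hS.2 with ⟨o, ho⟩ | h
        · exact hS' ⟨hS.1, o, hloc ho, ho⟩
        · exact h hloc)
    rw [union_eq_self_of_subset_right] at h
    · exact (h.isExtensor_iff m).2 (isExtensor_linkFam hv hc hreg ha hmeet)
    · intro x hx
      obtain ⟨h1, h2, h3⟩ := hbot 𝓠 hup' x hx
      rw [mem_cells isUpperSet_linkFam]
      exact ⟨h1, h2.1, none, by simp [LocIdx], h3⟩
  have hvs : v ∈ W.strip a b := mem_strip.2 ⟨hv.2, ha.le, hb⟩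
  have hT : IsExtensor (m + 1) (cells (W.strip a b) (W.slab a).con 𝓣) := by
    have hne : 𝓣.Nonempty := by
      refine ⟨{t | W.LocIdx v t}, mem_fam.2 fun j => ?_, Subset.rfl⟩
      exact hv.1 j
    refine isExtensor_cells_of_exists isClosed_strip convex_strip Arr.isClosed_con Arr.convex_con
      hne v (fun S hS => ?_) _
    have h1 : S \ {.inr none} ∈ 𝓣 :=
      ⟨Arr.fam_sdiff_inr hS.1 none, fun t ht => hS.2 ht.1⟩
    exact ⟨_, h1, fun t ht => ht.1, mem_cell.2 ⟨hvs, fun t ht => mem_con_of_locIdx (hS.2 ht.1) ht.2⟩⟩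
  have hinter : cells (W.strip a b) (W.slab a).con 𝓡 ∩ cells (W.strip a b) (W.slab a).con 𝓣 =
      cells (W.strip a b) (W.slab a).con 𝓠 := by
    ext x
    rw [mem_inter_iff, mem_cells hup, mem_cells hup', mem_cells']
    constructor
    · rintro ⟨⟨h1, h2, h3⟩, S, hS, hx⟩
      refine ⟨h1, Arr.isUpperSet_fam (fun t ht => ?_) hS.1, h3⟩
      exact ⟨(mem_cell.1 hx).2 t ht, hS.2 ht⟩
    · rintro ⟨h1, h2, h3⟩
      exact ⟨⟨h1, Arr.isUpperSet_fam inter_subset_left h2, h3⟩, _, ⟨h2, inter_subset_right⟩,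
        mem_cell.2 ⟨h1, fun t ht => ht.1⟩⟩
  have hcov : cells (W.strip a b) (W.slab a).con 𝓡 ∪ cells (W.strip a b) (W.slab a).con 𝓣 =
      cells (W.strip a b) (W.slab a).con (W.slab a).fam := by
    refine Subset.antisymm (union_subset (cells_mono fun S hS => hS.1)
      (cells_mono fun S hS => hS.1)) fun x hx => ?_
    obtain ⟨S, hS, hx⟩ := mem_cells'.1 hx
    by_cases h : S ⊆ {t | W.LocIdx v t}
    · exact Or.inr (mem_cells_of_mem ⟨hS, h⟩ hx)
    · exact Or.inl (mem_cells_of_mem ⟨hS, Or.inr h⟩ hx)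
  rw [← cells_strip_fam, ← cells_strip_famOn, ← hcov]
  refine Compressible.trans ?_ hR (cells_mono fun S hS => ?_) subset_union_left
  · refine Compressible.union (isClosed_cells isClosed_strip Arr.isClosed_con _)
      (isClosed_cells isClosed_strip Arr.isClosed_con _) ?_
    rw [hinter]
    refine hQ.compressible hT ?_
    rw [← hinter]
    exact inter_subset_right
  · rw [mem_famOn] at hS
    exact ⟨hS.1, Or.inl hS.2⟩

end Passing

end Sweep

namespace Sweep

section Descent

variable {V : Type} [NormedAddCommGroup V] [InnerProductSpace ℝ V]
  {J : Type} {ι : J → Type} {κ : Type} [Fintype J] [∀ j, Fintype (ι j)] [Fintype κ]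
  {W : Sweep V ι κ}

/-- The heights of the critical points are finite in number. -/
theorem finite_crit_heights (W : Sweep V ι κ) [∀ j, Nonempty (ι j)] :
    {c | ∃ v, W.Crit v ∧ W.Feas v ∧ W.h v = c}.Finite := by
  refine Set.Finite.of_injOn (t := (univ : Set (Set ((Σ j, ι j) ⊕ κ))))
    (f := fun c => open Classical in
      if hc : ∃ v, W.Crit v ∧ W.Feas v ∧ W.h v = c then W.act hc.choose else ∅)
    (mapsTo_univ _ _) ?_ finite_univ
  intro c hc c' hc' h
  have e := hc.choose_spec
  have e' := hc'.choose_spec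
  simp only at h
  rw [dif_pos (show ∃ v, W.Crit v ∧ W.Feas v ∧ W.h v = c from hc),
    dif_pos (show ∃ v, W.Crit v ∧ W.Feas v ∧ W.h v = c' from hc')] at h
  rw [← e.2.2, ← e'.2.2]
  exact e.1.height_eq h

/-- The part of the body below height `b`, together with the boundary. -/
def lower (W : Sweep V ι κ) (b : ℝ) : Set V :=
  (W.slab 0).body ∩ {x | W.h x ≤ b} ∪ (W.slab 0).bdry

theorem lower_zero : W.lower 0 = (W.slab 0).bdry := by
  ext x
  simp only [lower, mem_inter_iff, mem_union, mem_body_slab, mem_bdry_slab, mem_ofPred_eq]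
  refine ⟨?_, Or.inr⟩
  rintro (⟨⟨h1, h2⟩, h3⟩ | h)
  · exact ⟨h1, h2, Or.inl (le_antisymm h3 h2)⟩
  · exact h

variable [FiniteDimensional ℝ V]

theorem compressible_lower_of_strip {m : ℕ} {a b : ℝ} (ha : 0 ≤ a) (hab : a ≤ b)
    (h : Compressible m ((W.slab a).body ∩ {x | W.h x ≤ b}) ((W.slab a).bdry ∩ {x | W.h x ≤ b})) :
    Compressible m (W.lower b) (W.lower a) := by
  have h1 : W.lower a ∩ ((W.slab a).body ∩ {x | W.h x ≤ b}) =
      (W.slab a).bdry ∩ {x | W.h x ≤ b} := by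
    ext x
    simp only [lower, mem_inter_iff, mem_union, mem_body_slab, mem_bdry_slab, mem_ofPred_eq]
    constructor
    · rintro ⟨⟨-, h1⟩ | ⟨-, -, h1 | h1⟩, ⟨h2, h3⟩, h4⟩
      · exact ⟨⟨h2, h3, Or.inl (le_antisymm h1 h3)⟩, h4⟩
      · exact ⟨⟨h2, h3, Or.inl (le_antisymm (h1.le.trans ha) h3)⟩, h4⟩
      · exact ⟨⟨h2, h3, Or.inr h1⟩, h4⟩
    · rintro ⟨⟨h2, h3, h1 | h1⟩, h4⟩
      · exact ⟨Or.inl ⟨⟨h2, ha.trans h3⟩, h1.le⟩, ⟨h2, h3⟩, h4⟩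
      · exact ⟨Or.inr ⟨h2, ha.trans h3, Or.inr h1⟩, ⟨h2, h3⟩, h4⟩
  have h2 : W.lower b = W.lower a ∪ ((W.slab a).body ∩ {x | W.h x ≤ b}) := by
    ext x
    simp only [lower, mem_inter_iff, mem_union, mem_body_slab, mem_ofPred_eq]
    constructor
    · rintro (⟨⟨h1, h2⟩, h3⟩ | h1)
      · rcases le_total a (W.h x) with h4 | h4
        · exact Or.inr ⟨⟨h1, h4⟩, h3⟩
        · exact Or.inl (Or.inl ⟨⟨h1, h2⟩, h4⟩)
      · exact Or.inl (Or.inr h1)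
    · rintro ((⟨h1, h2⟩ | h1) | ⟨⟨h1, h2⟩, h3⟩)
      · exact Or.inl ⟨h1, h2.trans hab⟩
      · exact Or.inr h1
      · exact Or.inl ⟨⟨h1, ha.trans h2⟩, h3⟩
  rw [h2]
  refine Compressible.union ?_ (Arr.isClosed_body.inter (isClosed_height_le W b)) ?_
  · refine (Arr.isClosed_body.inter (isClosed_height_le W a)).union ?_
    rw [← Arr.cells_famOn_true]
    exact isClosed_cells Arr.isClosed_domain Arr.isClosed_con _
  · rwa [h1]

variable [∀ j, Nonempty (ι j)]

theorem compressible_lower {m : ℕ} (hreg : ∀ v, W.Feas v → W.Crit v → 0 < W.h v → W.Regular m v)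
    (huniq : ∀ v v', W.Feas v → W.Crit v → W.Feas v' → W.Crit v' → 0 < W.h v →
      W.h v = W.h v' → v = v') {b : ℝ} (hb : 0 ≤ b) :
    Compressible m (W.lower b) (W.slab 0).bdry := by
  set C := {c | ∃ v, W.Crit v ∧ W.Feas v ∧ W.h v = c} with hC
  have hfin : C.Finite := W.finite_crit_heights
  induction hN : (C ∩ Ioc 0 b).ncard using Nat.strong_induction_on generalizing b with
  | _ N ih =>
  by_cases hne : (C ∩ Ioc 0 b).Nonempty
  swap
  · have := compressible_lower_of_strip le_rfl hb
      (compressible_strip_of_no_crit (W := W) (a := 0) (b := b) (fun v hc hf h0 => ?_) m)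
    · rwa [lower_zero] at this
    · by_contra hle
      exact hne ⟨W.h v, ⟨v, hc, hf, rfl⟩, h0, not_lt.1 hle⟩
  have hfin' : (C ∩ Ioc 0 b).Finite := hfin.subset inter_subset_left
  obtain ⟨c, ⟨⟨v, hc, hf, rfl⟩, h0, hcb⟩, hmax⟩ := exists_max_image _ id hfin' hne
  have hev : ∀ᶠ a in 𝓝[<] (W.h v), ∀ c ∈ C, c < W.h v → c < a :=
    hfin.eventually_all.2 fun c _ => by
      by_cases h : c < W.h v
      · filter_upwards [nhdsWithin_le_nhds (Ioi_mem_nhds h)] with a ha _ using ha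
      · exact Eventually.of_forall fun a h' => absurd h' h
  obtain ⟨a, ⟨⟨hmeet, hlt⟩, ha0⟩, hav⟩ := (((eventually_meet_germ hf hcb).and hev).and
    (nhdsWithin_le_nhds (Ioi_mem_nhds h0)) |>.and self_mem_nhdsWithin).exists
  have ha0' : 0 < a := ha0
  have hav' : a < W.h v := hav
  have hstep := compressible_lower_of_strip ha0'.le (hav'.le.trans hcb)
    (compressible_strip_of_crit hf hc (hreg v hf hc h0) hav' hcb hmeet fun u hu hu' h1 h2 => by
      have hle := hmax (W.h u) ⟨⟨u, hu, hu', rfl⟩, ha0'.trans h1, h2⟩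
      simp only [id] at hle
      refine huniq u v hu' hu hf hc (ha0'.trans h1) (le_antisymm hle (not_lt.1 fun h3 => ?_))
      exact lt_asymm h1 (hlt _ ⟨u, hu, hu', rfl⟩ h3))
  refine hstep.trans (ih _ ?_ ha0'.le rfl) subset_union_right ?_
  · rw [← hN]
    refine ncard_lt_ncard ⟨?_, fun h => ?_⟩ hfin'
    · exact inter_subset_inter_right _ (Ioc_subset_Ioc_right (hav'.le.trans hcb))
    · exact absurd (h ⟨⟨v, hc, hf, rfl⟩, h0, hcb⟩).2.2 (not_le.2 hav')
  · exact union_subset_union_left _ (inter_subset_inter_right _ fun x hx =>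
      le_trans hx (hav'.le.trans hcb))

/-- The whole body can be pushed to its boundary. -/
theorem compressible_body {m : ℕ} (hreg : ∀ v, W.Feas v → W.Crit v → 0 < W.h v → W.Regular m v)
    (huniq : ∀ v v', W.Feas v → W.Crit v → W.Feas v' → W.Crit v' → 0 < W.h v →
      W.h v = W.h v' → v = v') :
    Compressible m (W.slab 0).body (W.slab 0).bdry := by
  intro X _ D E g hD hE hED hg hgZ hgA
  obtain ⟨b, hb⟩ := (hD.isCompact.image_of_continuousOn
    ((Arr.continuous_affine W.h).comp_continuousOn hg)).bddAbove
  obtain ⟨H, h1, h2, h3⟩ := compressible_lower hreg huniq (le_max_right b 0) X D E g hD hE hED hg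
    (fun x hx => Or.inl ⟨hgZ hx, (hb (mem_image_of_mem _ hx)).trans (le_max_left _ _)⟩) hgA
  refine ⟨H, h1, fun p hp => ?_, h3⟩
  rcases h2 hp with h | h
  · exact h.1
  · exact h.1

end Descent

end Sweep

/-! ### Sweeps in general position -/

/-- Independent functionals take arbitrary values. -/
theorem LinearIndepOn.exists_apply_eq {U τ : Type*} [AddCommGroup U] [Module ℝ U] [Finite τ]
    {f : τ → Module.Dual ℝ U} {S : Set τ} (hf : LinearIndepOn ℝ f S) (c : τ → ℝ) :
    ∃ x, ∀ t ∈ S, f t x = c t := by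
  classical
  have := Fintype.ofFinite τ
  set F : U →ₗ[ℝ] (S → ℝ) := LinearMap.pi fun t => f t with hF
  have hsurj : LinearMap.range F = ⊤ := by
    by_contra hne
    obtain ⟨g, hg0, hg⟩ := (LinearMap.range F).exists_le_ker_of_lt_top (lt_top_iff_ne_top.2 hne)
    refine hg0 (LinearMap.pi_ext' fun t => LinearMap.ext_ring ?_)
    refine Fintype.linearIndependent_iff.1 hf (fun t => g (Pi.single t 1)) ?_ t
    ext x
    have h1 : g (F x) = 0 := hg (LinearMap.mem_range_self F x)
    rw [pi_eq_sum_univ' (F x), map_sum] at h1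
    simpa [hF, mul_comm] using h1
  obtain ⟨x, hx⟩ := LinearMap.range_eq_top.1 hsurj fun t => c t
  exact ⟨x, fun t ht => congrFun hx ⟨t, ht⟩⟩

section GeneralPosition

variable {E : Type} [NormedAddCommGroup E] [InnerProductSpace ℝ E]
  {J : Type} {ι : J → Type} {κ : Type}

/-- The affine function `x ↦ ⟪x, p.1⟫ + p.2`. -/
noncomputable def affineOf (p : E × ℝ) : E →ᵃ[ℝ] ℝ :=
  (innerₗ E p.1).toAffineMap + AffineMap.const ℝ E p.2

@[simp] theorem affineOf_apply (p : E × ℝ) (x : E) : affineOf p x = ⟪x, p.1⟫ + p.2 := by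
  simp [affineOf, real_inner_comm]

@[simp] theorem affineOf_linear (p : E × ℝ) (x : E) : (affineOf p).linear x = ⟪x, p.1⟫ := by
  simp [affineOf, real_inner_comm]

/-- The sweep with given coefficients. -/
noncomputable def sweepOf (ω : (Σ j, ι j) ⊕ Option κ → E × ℝ) : Sweep E ι κ where
  φ := fun j i => affineOf (ω (.inl ⟨j, i⟩))
  ψ := fun k => affineOf (ω (.inr (some k)))
  h := affineOf (ω (.inr none))

/-- The linear part of a function, with an auxiliary variable for each group. -/
noncomputable def covec (ω : (Σ j, ι j) ⊕ Option κ → E × ℝ) (t : (Σ j, ι j) ⊕ Option κ) :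
    Module.Dual ℝ (E × (J → ℝ)) :=
  (innerₗ E (ω t).1).coprod (Sum.elim (fun t => LinearMap.proj t.1) (fun _ => 0) t)

@[simp] theorem covec_inl (ω : (Σ j, ι j) ⊕ Option κ → E × ℝ) (t : Σ j, ι j) (y : E × (J → ℝ)) :
    covec ω (.inl t) y = ⟪y.1, (ω (.inl t)).1⟫ + y.2 t.1 := by
  simp [covec, real_inner_comm]

@[simp] theorem covec_inr (ω : (Σ j, ι j) ⊕ Option κ → E × ℝ) (o : Option κ) (y : E × (J → ℝ)) :
    covec ω (.inr o) y = ⟪y.1, (ω (.inr o)).1⟫ := by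
  simp [covec, real_inner_comm]

/-- All the functions with index in `S` vanish at `y`. -/
def TightOn (ω : (Σ j, ι j) ⊕ Option κ → E × ℝ) (S : Set ((Σ j, ι j) ⊕ Option κ))
    (y : E × (J → ℝ)) : Prop :=
  ∀ t ∈ S, covec ω t y + (ω t).2 = 0

/-- The genericity conditions on the coefficients of a sweep. -/
structure GenPos (ω : (Σ j, ι j) ⊕ Option κ → E × ℝ) : Prop where
  indep : ∀ S y, TightOn ω S y → LinearIndepOn ℝ (covec ω) S
  notMem : ∀ S, .inr none ∉ S → (∀ j, ∃ i, .inl ⟨j, i⟩ ∈ S) →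
    S.ncard < Module.finrank ℝ (E × (J → ℝ)) →
    covec ω (.inr none) ∉ Submodule.span ℝ (covec ω '' S)
  sep : ∀ S S' y y', .inr none ∉ S → .inr none ∉ S' →
    Submodule.span ℝ (covec ω '' S) = ⊤ → Submodule.span ℝ (covec ω '' S') = ⊤ →
    TightOn ω S y → TightOn ω S' y' → covec ω (.inr none) y = covec ω (.inr none) y' → y.1 = y'.1

namespace GenPos

variable {ω : (Σ j, ι j) ⊕ Option κ → E × ℝ} {v : E}

/-- The indices of the functions active at `v`, apart from the height. -/
def activeSet (ω : (Σ j, ι j) ⊕ Option κ → E × ℝ) (v : E) : Set ((Σ j, ι j) ⊕ Option κ) :=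
  {t | (sweepOf ω).LocIdx v t} \ {.inr none}

theorem exists_tightOn_activeSet (hv : (sweepOf ω).Feas v) :
    ∃ y : E × (J → ℝ), y.1 = v ∧ TightOn ω (activeSet ω v) y := by
  choose i i' hne hi hi' using hv.1
  refine ⟨(v, fun j => - (sweepOf ω).φ j (i j) v), rfl, ?_⟩
  rintro (⟨j, l⟩ | _ | k) ⟨ht, hne⟩
  · have h1 : (sweepOf ω).φ j l v = (sweepOf ω).φ j (i j) v := Sweep.Top.eq ht (hi j)
    rw [covec_inl]
    simp only [← h1]
    simp [sweepOf]
  · simp at hne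
  · have h1 : (sweepOf ω).ψ k v = 0 := ht k rfl
    simpa [sweepOf] using h1

variable [Fintype J] [∀ j, Fintype (ι j)] [Fintype κ]

theorem covec_mem_span (hc : (sweepOf ω).Crit v) :
    covec ω (.inr none) ∈ Submodule.span ℝ (covec ω '' activeSet ω v) := by
  rw [image_eq_range]
  refine mem_span_of_iInf_ker_le_ker fun y hy => ?_
  have hy' : ∀ t ∈ activeSet ω v, covec ω t y = 0 := fun t ht => by
    simpa using (Submodule.mem_iInf _).1 hy ⟨t, ht⟩
  have := hc y.1 (fun j => - y.2 j) (fun j i hi => by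
    have h1 := hy' (.inl ⟨j, i⟩) ⟨hi, by simp⟩
    rw [covec_inl] at h1
    simp only [sweepOf, affineOf_linear]
    linarith) (fun k hk => by
    have h1 := hy' (.inr (some k)) ⟨by rintro k' ⟨⟩; exact hk, by simp⟩
    rw [covec_inr] at h1
    simpa only [sweepOf, affineOf_linear] using h1)
  simpa [sweepOf] using this

variable [FiniteDimensional ℝ E]

theorem ncard_activeSet (hω : GenPos ω) (hv : (sweepOf ω).Feas v) (hc : (sweepOf ω).Crit v) :
    (activeSet ω v).ncard = Module.finrank ℝ (E × (J → ℝ)) := by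
  obtain ⟨y, -, hy⟩ := exists_tightOn_activeSet hv
  have hind := hω.indep _ y hy
  refine le_antisymm ?_ (not_lt.1 fun hlt => ?_)
  · have := Fintype.ofFinite (activeSet ω v)
    rw [← Subspace.dual_finrank_eq, ← Nat.card_coe_set_eq, Nat.card_eq_fintype_card]
    exact LinearIndependent.fintype_card_le_finrank hind
  · refine hω.notMem _ (fun h => h.2 rfl) (fun j => ?_) hlt (covec_mem_span hc)
    obtain ⟨i, i', -, hi, -⟩ := hv.1 j
    exact ⟨i, hi, by simp⟩

theorem span_activeSet (hω : GenPos ω) (hv : (sweepOf ω).Feas v) (hc : (sweepOf ω).Crit v) :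
    Submodule.span ℝ (covec ω '' activeSet ω v) = ⊤ := by
  obtain ⟨y, -, hy⟩ := exists_tightOn_activeSet hv
  have := Fintype.ofFinite (activeSet ω v)
  rw [image_eq_range]
  refine LinearIndependent.span_eq_top_of_card_eq_finrank' (hω.indep _ y hy) ?_
  rw [Subspace.dual_finrank_eq, ← hω.ncard_activeSet hv hc, ← Nat.card_coe_set_eq,
    Nat.card_eq_fintype_card]

theorem eq_of_height_eq (hω : GenPos ω) {v' : E} (hv : (sweepOf ω).Feas v)
    (hc : (sweepOf ω).Crit v) (hv' : (sweepOf ω).Feas v') (hc' : (sweepOf ω).Crit v')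
    (h : (sweepOf ω).h v = (sweepOf ω).h v') : v = v' := by
  obtain ⟨y, rfl, hy⟩ := exists_tightOn_activeSet hv
  obtain ⟨y', rfl, hy'⟩ := exists_tightOn_activeSet hv'
  refine hω.sep _ _ y y' (fun h => h.2 rfl) (fun h => h.2 rfl) (hω.span_activeSet hv hc)
    (hω.span_activeSet hv' hc') hy hy' ?_
  simpa [sweepOf] using h

theorem indepExcept (hω : GenPos ω) (hv : (sweepOf ω).Feas v) (hc : (sweepOf ω).Crit v) (a : ℝ)
    (t : (Σ j, ι j) ⊕ Option κ) (ht : (sweepOf ω).LocIdx v t) :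
    ((sweepOf ω).loc v a).IndepExcept t := by
  obtain ⟨y₀, -, hy₀⟩ := exists_tightOn_activeSet hv
  have hind := hω.indep _ y₀ hy₀
  have hT : LinearIndepOn ℝ (covec ω) ({t | (sweepOf ω).LocIdx v t} \ {t}) := by
    by_cases h0 : t = .inr none
    · rwa [h0]
    have hnone : (sweepOf ω).LocIdx v (.inr none) := by simp [Sweep.LocIdx]
    have heq : {t | (sweepOf ω).LocIdx v t} \ {t} = insert (.inr none) (activeSet ω v \ {t}) := by
      ext t'
      simp only [activeSet, Set.mem_sdiff, mem_singleton_iff, mem_insert_iff, mem_ofPred_eq]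
      by_cases h1 : t' = .inr none
      · subst h1
        simp [hnone, Ne.symm h0]
      · simp [h1]
    rw [heq]
    refine (hind.mono sdiff_subset).insert (hω.notMem _ (fun h => h.1.2 rfl) (fun j => ?_) ?_)
    · obtain ⟨i, i', hne, hi, hi'⟩ := hv.1 j
      by_cases h1 : .inl ⟨j, i⟩ = t
      · refine ⟨i', ⟨hi', by simp⟩, fun h2 => hne ?_⟩
        have h3 := h1.trans (mem_singleton_iff.1 h2).symm
        simpa using h3
      · exact ⟨i, ⟨hi, by simp⟩, h1⟩
    · rw [← hω.ncard_activeSet hv hc]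
      exact ncard_sdiff_singleton_lt_of_mem ⟨ht, h0⟩
  intro y z
  obtain ⟨x, hx⟩ := hT.exists_apply_eq (Sum.elim (fun t => y t.1 t.2) z)
  refine ⟨x.1, trivial, x.2, fun j _ i hi hne => ?_, fun o ho hne => ?_⟩
  · have h1 := hx (.inl ⟨j, i⟩) ⟨by simpa [Sweep.LocIdx] using hi, hne⟩
    simpa [sweepOf] using h1
  · have h1 := hx (.inr o) ⟨by simpa [Sweep.LocIdx] using ho, hne⟩
    cases o <;> simpa [sweepOf] using h1

theorem regular (hω : GenPos ω) (hv : (sweepOf ω).Feas v) (hc : (sweepOf ω).Crit v) {m : ℕ}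
    (hm : Module.finrank ℝ E = Fintype.card J + m) : (sweepOf ω).Regular m v := by
  classical
  intro a
  refine ⟨fun t ht => hω.indepExcept hv hc a t ?_, ?_⟩
  · rcases t with ⟨j, i⟩ | o
    · simpa [Sweep.LocIdx] using ht.2
    · simpa [Sweep.LocIdx, Arr.Index] using ht
  have hcard := hω.ncard_activeSet hv hc
  rw [Module.finrank_prod, Module.finrank_fintype_fun_eq_card, hm] at hcard
  set A := (sweepOf ω).loc v a
  have h1 : activeSet ω v =
      ↑((Finset.univ.sigma A.idx).disjSum (A.ineqs.erase none)) := by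
    ext t
    rcases t with ⟨j, i⟩ | o
    · simp [activeSet, A, Sweep.LocIdx]
    · simp [activeSet, A, Sweep.LocIdx, and_comm]
  have hnone : none ∈ A.ineqs := by simp [A]
  rw [h1, ncard_coe_finset, Finset.card_disjSum, Finset.card_sigma, Finset.card_erase_of_mem hnone]
    at hcard
  have h2 : ∑ j, (A.idx j).card = A.excess + 2 * Fintype.card J := by
    have h3 : ∀ j, 2 ≤ (A.idx j).card := fun j => by
      obtain ⟨i, i', hne, hi, hi'⟩ := hv.1 j
      exact Finset.one_lt_card.2 ⟨i, by simpa [A] using hi, i', by simpa [A] using hi', hne⟩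
    have h4 : A.excess = ∑ j, ((A.idx j).card - 2) := rfl
    rw [h4, show 2 * Fintype.card J = ∑ _j : J, 2 by simp [mul_comm], ← Finset.sum_add_distrib]
    exact Finset.sum_congr rfl fun j _ => (Nat.sub_add_cancel (h3 j)).symm
  have h5 : 0 < A.ineqs.card := Finset.card_pos.2 ⟨_, hnone⟩
  omega

/-- In general position, the body of a sweep can be pushed to its boundary. -/
theorem compressible (hω : GenPos ω) [∀ j, Nonempty (ι j)] {m : ℕ}
    (hm : Module.finrank ℝ E = Fintype.card J + m) :
    Compressible m ((sweepOf ω).slab 0).body ((sweepOf ω).slab 0).bdry :=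
  Sweep.compressible_body (fun _ hv hc _ => hω.regular hv hc hm)
    fun _ _ hv hc hv' hc' _ h => hω.eq_of_height_eq hv hc hv' hc' h

end GenPos

end GeneralPosition

/-! ### Almost every sweep is in general position -/

section Measure

/-- Projections of closed sets along `σ`-compact spaces are measurable. -/
theorem measurableSet_exists_of_isClosed {Ω Y : Type*} [TopologicalSpace Ω] [T2Space Ω]
    [SigmaCompactSpace Ω] [MeasurableSpace Ω] [OpensMeasurableSpace Ω] [TopologicalSpace Y]
    [SigmaCompactSpace Y] {p : Ω → Y → Prop} (h : IsClosed {z : Ω × Y | p z.1 z.2}) :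
    MeasurableSet {ω | ∃ y, p ω y} := by
  have hσ : SigmaCompactSpace {z : Ω × Y | p z.1 z.2} :=
    h.isClosedEmbedding_subtypeVal.sigmaCompactSpace
  obtain ⟨K, hK, hU⟩ := (isSigmaCompact_iff_sigmaCompactSpace.2 hσ).image continuous_fst
  have : {ω | ∃ y, p ω y} = ⋃ n, K n := by
    rw [hU]
    ext ω
    simp
  rw [this]
  exact MeasurableSet.iUnion fun n => (hK n).measurableSet

/-- A set meeting all translates of a measured space in null sets is null. -/
theorem measure_eq_zero_of_translates {Ω F : Type*} [AddGroup Ω] [MeasurableSpace Ω]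
    [MeasurableAdd₂ Ω] {μ : Measure Ω} [SFinite μ] [μ.IsAddRightInvariant] [MeasurableSpace F]
    {ν : Measure F} [SFinite ν] (hν : ν ≠ 0) {i : F → Ω} (hi : Measurable i) {B : Set Ω}
    (hB : MeasurableSet B) (h : ∀ ω, ν {x | ω + i x ∈ B} = 0) : μ B = 0 := by
  have hm : Measurable fun z : Ω × F => z.1 + i z.2 := measurable_fst.add (hi.comp measurable_snd)
  have h1 : (μ.prod ν) ((fun z : Ω × F => z.1 + i z.2) ⁻¹' B) = 0 :=
    (Measure.measure_prod_null (hm hB)).2 (Eventually.of_forall h)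
  rw [← Measure.prod_swap, Measure.map_apply measurable_swap (hm hB),
    Measure.measure_prod_null (measurable_swap (hm hB))] at h1
  have : NeZero ν := ⟨hν⟩
  obtain ⟨x, hx⟩ := h1.exists
  have h2 : μ ((fun ω => ω + i x) ⁻¹' B) = 0 := hx
  rwa [measure_preimage_add_right] at h2

end Measure

section Generic

variable {E : Type} [NormedAddCommGroup E] {J : Type} {ι : J → Type} {κ : Type}

open Classical in
/-- The family of coefficients supported at a single index. -/
noncomputable def bump (t : (Σ j, ι j) ⊕ Option κ) (p : E × ℝ) :
    (Σ j, ι j) ⊕ Option κ → E × ℝ :=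
  Pi.single t p

@[simp] theorem bump_same (t : (Σ j, ι j) ⊕ Option κ) (p : E × ℝ) : bump t p t = p := by
  simp [bump]

theorem bump_of_ne {s t : (Σ j, ι j) ⊕ Option κ} (p : E × ℝ) (h : s ≠ t) : bump t p s = 0 := by
  simp [bump, h]

theorem measurable_bump [MeasurableSpace E] (t : (Σ j, ι j) ⊕ Option κ) :
    Measurable (bump t : E × ℝ → _) := by
  refine measurable_pi_lambda _ fun s => ?_
  by_cases h : s = t
  · subst h
    simp only [bump_same]
    exact measurable_id
  · simp [bump_of_ne _ h]

variable [InnerProductSpace ℝ E]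

theorem covec_congr {ω ω' : (Σ j, ι j) ⊕ Option κ → E × ℝ} {t : (Σ j, ι j) ⊕ Option κ}
    (h : (ω t).1 = (ω' t).1) : covec ω t = covec ω' t := by
  rw [covec, covec, h]

theorem continuous_covec (t : (Σ j, ι j) ⊕ Option κ) :
    Continuous fun z : ((Σ j, ι j) ⊕ Option κ → E × ℝ) × (E × (J → ℝ)) => covec z.1 t z.2 := by
  rcases t with t | o
  · simp only [covec_inl]
    fun_prop
  · simp only [covec_inr]
    fun_prop

theorem isClosed_tightOn {Y : Type*} [TopologicalSpace Y]
    {f : Y → (Σ j, ι j) ⊕ Option κ → E × ℝ} (hf : Continuous f) {g : Y → E × (J → ℝ)}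
    (hg : Continuous g) (S : Set ((Σ j, ι j) ⊕ Option κ)) :
    IsClosed {z : Y | TightOn (f z) S (g z)} := by
  simp only [TightOn, ofPred_forall]
  refine isClosed_iInter fun t => isClosed_iInter fun _ => isClosed_eq ?_ continuous_const
  exact ((continuous_covec t).comp (hf.prodMk hg)).add
    (continuous_snd.comp ((continuous_apply t).comp hf))

/-- Membership in a span, expressed by closed conditions. -/
theorem covec_mem_span_iff {ω : (Σ j, ι j) ⊕ Option κ → E × ℝ} {t : (Σ j, ι j) ⊕ Option κ}
    {S : Finset ((Σ j, ι j) ⊕ Option κ)} :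
    covec ω t ∈ Submodule.span ℝ (covec ω '' S) ↔
      ∃ c : (Σ j, ι j) ⊕ Option κ → ℝ, ∀ y, ∑ s ∈ S, c s * covec ω s y = covec ω t y := by
  rw [Submodule.mem_span_image_finset_iff_exists_fun']
  refine exists_congr fun c => ⟨fun h y => ?_, fun h => LinearMap.ext fun y => ?_⟩
  · simp [← h]
  · simpa using h y

theorem isClosed_covec_eq (t : (Σ j, ι j) ⊕ Option κ) (S : Finset ((Σ j, ι j) ⊕ Option κ))
    {Y : Type*} [TopologicalSpace Y] {f : Y → (Σ j, ι j) ⊕ Option κ → E × ℝ} (hf : Continuous f)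
    {c : Y → (Σ j, ι j) ⊕ Option κ → ℝ} (hc : Continuous c) :
    IsClosed {z : Y | ∀ y, ∑ s ∈ S, c z s * covec (f z) s y = covec (f z) t y} := by
  simp only [ofPred_forall]
  have h : ∀ s y, Continuous fun z => covec (f z) s y := fun s y =>
    (continuous_covec s).comp (hf.prodMk continuous_const)
  exact isClosed_iInter fun y => isClosed_eq (continuous_finsetSum _ fun s _ =>
    ((continuous_apply s).comp hc).mul (h s y)) (h t y)

theorem eq_of_mem_span {U : Type*} [AddCommGroup U] [Module ℝ U] {T : Set (Module.Dual ℝ U)}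
    {f : Module.Dual ℝ U} (hf : f ∈ Submodule.span ℝ T) {y y' : U} (h : ∀ g ∈ T, g y = g y') :
    f y = f y' := by
  induction hf using Submodule.span_induction with
  | mem g hg => exact h g hg
  | zero => simp
  | add g g' _ _ h1 h2 => simp [h1, h2]
  | smul c g _ h1 => simp [h1]

variable [Finite J] [∀ j, Finite (ι j)] [Finite κ] [ProperSpace E] [MeasurableSpace E] [BorelSpace E]
  (μ : Measure ((Σ j, ι j) ⊕ Option κ → E × ℝ)) [μ.IsAddHaarMeasure]

theorem ae_indep : ∀ᵐ ω ∂μ, ∀ S y, TightOn ω S y → LinearIndepOn ℝ (covec ω) S := by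
  classical
  have := Fintype.ofFinite ((Σ j, ι j) ⊕ Option κ)
  have := Fintype.ofFinite J
  have hbad : ∀ᵐ ω ∂μ, ∀ (t : (Σ j, ι j) ⊕ Option κ) (S : Finset ((Σ j, ι j) ⊕ Option κ)),
      t ∉ S → ∀ y, TightOn ω (insert t ↑S) y → covec ω t ∉ Submodule.span ℝ (covec ω '' S) := by
    refine ae_all_iff.2 fun t => ae_all_iff.2 fun S => ?_
    by_cases htS : t ∈ S
    · exact Eventually.of_forall fun ω h => absurd htS h
    have hB : MeasurableSet {ω : (Σ j, ι j) ⊕ Option κ → E × ℝ |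
        ∃ z : (E × (J → ℝ)) × ((Σ j, ι j) ⊕ Option κ → ℝ), TightOn ω (insert t ↑S) z.1 ∧
          ∀ y, ∑ s ∈ S, z.2 s * covec ω s y = covec ω t y} :=
      measurableSet_exists_of_isClosed ((isClosed_tightOn (by fun_prop) (by fun_prop) _).inter
        (isClosed_covec_eq t S (by fun_prop) (by fun_prop)))
    have h0 := measure_eq_zero_of_translates (μ := μ) (ν := (volume : Measure ℝ)) (NeZero.ne _)
      (i := fun x : ℝ => bump t (0, x)) ((measurable_bump t).comp (measurable_const.prodMk measurable_id)) hB (fun ω => by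
        refine Set.Subsingleton.measure_zero ?_ _
        rintro x ⟨⟨y, c⟩, hy, hc⟩ x' ⟨⟨y', c'⟩, hy', -⟩
        have hcov : ∀ (x : ℝ) s, covec (ω + bump t (0, x)) s = covec ω s := fun x s =>
          covec_congr (by
            by_cases h : s = t
            · subst h
              simp
            · simp [bump_of_ne _ h])
        simp only [hcov] at hc
        have hspan : covec ω t ∈ Submodule.span ℝ (covec ω '' S) := covec_mem_span_iff.2 ⟨c, hc⟩
        have heq : covec ω t y = covec ω t y' := eq_of_mem_span hspan (by
          rintro _ ⟨s, hs, rfl⟩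
          have h1 := hy s (mem_insert_of_mem _ hs)
          have h2 := hy' s (mem_insert_of_mem _ hs)
          have hne : s ≠ t := fun h => htS (h ▸ hs)
          simp only [hcov, Pi.add_apply, bump_of_ne _ hne, add_zero] at h1 h2
          linarith)
        have h1 := hy t (mem_insert _ _)
        have h2 := hy' t (mem_insert _ _)
        simp only [hcov, Pi.add_apply, bump_same, Prod.snd_add] at h1 h2
        linarith)
    filter_upwards [measure_eq_zero_iff_ae_notMem.1 h0] with ω hω _ y hy hspan
    obtain ⟨c, hc⟩ := covec_mem_span_iff.1 hspan
    exact hω ⟨(y, c), hy, hc⟩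
  filter_upwards [hbad] with ω hω S y hy
  have key : ∀ T : Finset ((Σ j, ι j) ⊕ Option κ), TightOn ω ↑T y →
      LinearIndepOn ℝ (covec ω) (T : Set ((Σ j, ι j) ⊕ Option κ)) := by
    intro T
    induction T using Finset.induction_on with
    | empty => intro _; simp
    | insert t T ht ih =>
      intro hT
      rw [Finset.coe_insert] at hT ⊢
      exact (ih fun s hs => hT s (mem_insert_of_mem _ hs)).insert (hω t T ht y hT)
  simpa using key S.toFinset (by simpa using hy)

variable [FiniteDimensional ℝ E]

theorem ae_notMem : ∀ᵐ ω ∂μ, ∀ S : Set ((Σ j, ι j) ⊕ Option κ), .inr none ∉ S →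
    (∀ j, ∃ i, .inl ⟨j, i⟩ ∈ S) → S.ncard < Module.finrank ℝ (E × (J → ℝ)) →
    covec ω (.inr none) ∉ Submodule.span ℝ (covec ω '' S) := by
  classical
  have := Fintype.ofFinite ((Σ j, ι j) ⊕ Option κ)
  have := Fintype.ofFinite J
  refine ae_all_iff.2 fun S => ?_
  by_cases hS : .inr none ∉ S ∧ (∀ j, ∃ i, .inl ⟨j, i⟩ ∈ S) ∧
    S.ncard < Module.finrank ℝ (E × (J → ℝ))
  swap
  · exact Eventually.of_forall fun ω h1 h2 h3 => absurd ⟨h1, h2, h3⟩ hS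
  obtain ⟨h1, h2, h3⟩ := hS
  have hB : MeasurableSet {ω : (Σ j, ι j) ⊕ Option κ → E × ℝ |
      ∃ c : (Σ j, ι j) ⊕ Option κ → ℝ,
        ∀ y, ∑ s ∈ S.toFinset, c s * covec ω s y = covec ω (.inr none) y} :=
    measurableSet_exists_of_isClosed
      (isClosed_covec_eq (.inr none) S.toFinset (by fun_prop) (by fun_prop))
  have hBeq : {ω : (Σ j, ι j) ⊕ Option κ → E × ℝ |
      ∃ c : (Σ j, ι j) ⊕ Option κ → ℝ,
        ∀ y, ∑ s ∈ S.toFinset, c s * covec ω s y = covec ω (.inr none) y} =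
      {ω | covec ω (.inr none) ∈ Submodule.span ℝ (covec ω '' S)} := by
    ext ω
    have h := covec_mem_span_iff (ω := ω) (t := .inr none) (S := S.toFinset)
    rw [coe_toFinset] at h
    exact h.symm
  rw [hBeq] at hB
  have h0 := measure_eq_zero_of_translates (μ := μ) (ν := (volume : Measure E)) (NeZero.ne _)
    (i := fun x : E => bump (.inr none) (x, 0)) ((measurable_bump _).comp (measurable_id.prodMk measurable_const)) hB (fun ω => by
      set P := Submodule.span ℝ (covec ω '' S) with hP
      set Λ : E →ₗ[ℝ] Module.Dual ℝ (E × (J → ℝ)) :=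
        (LinearMap.lcomp ℝ ℝ (LinearMap.fst ℝ E (J → ℝ))).comp (innerₗ E) with hΛ
      have hΛa : ∀ x y, Λ x y = ⟪x, y.1⟫ := fun x y => rfl
      have hset : {x : E | ω + bump (.inr none) (x, 0) ∈
          {ω | covec ω (.inr none) ∈ Submodule.span ℝ (covec ω '' S)}} =
          (fun x => (ω (.inr none)).1 + x) ⁻¹' (P.comap Λ : Set E) := by
        ext x
        have himg : covec (ω + bump (.inr none) (x, 0)) '' S = covec ω '' S :=
          image_congr fun s hs => covec_congr (by
            have hne : s ≠ .inr none := fun h => h1 (h ▸ hs)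
            simp [bump_of_ne _ hne])
        have hcov : covec (ω + bump (.inr none) (x, 0)) (.inr none) =
            Λ ((ω (.inr none)).1 + x) := by
          ext y <;> simp [hΛa, real_inner_comm, inner_add_right]
        simp only [mem_ofPred_eq, himg, hcov, mem_preimage, SetLike.mem_coe,
          Submodule.mem_comap]
        rfl
      rw [hset, measure_preimage_add]
      refine Measure.addHaar_submodule _ _ fun htop => ?_
      have hPtop : P = ⊤ := by
        refine eq_top_iff.2 fun f _ => ?_
        have h := FiniteDimensional.mem_span_of_iInf_ker_le_ker (L := fun g : P => (g : _ →ₗ[ℝ] ℝ))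
          (K := f) (fun y hy => ?_)
        · simpa using h
        have hy' : ∀ g ∈ P, g y = 0 := fun g hg => by
          simpa using (Submodule.mem_iInf _).1 hy ⟨g, hg⟩
        have hy1 : y.1 = 0 := by
          have h4 : y.1 ∈ P.comap Λ := htop ▸ Submodule.mem_top
          have h5 := hy' _ h4
          rw [hΛa] at h5
          exact inner_self_eq_zero.1 h5
        have hy2 : y.2 = 0 := by
          funext j
          obtain ⟨i, hi⟩ := h2 j
          have h5 := hy' _ (Submodule.subset_span (mem_image_of_mem _ hi))
          simpa [hy1] using h5
        have : y = 0 := Prod.ext hy1 hy2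
        simp [this]
      have h4 : Module.finrank ℝ P ≤ S.ncard := by
        have h5 := finrank_span_le_card (R := ℝ) (covec ω '' S)
        rw [← ncard_eq_toFinset_card'] at h5
        exact h5.trans (ncard_image_le S.toFinite)
      rw [hPtop, finrank_top, Subspace.dual_finrank_eq] at h4
      exact absurd h3 (not_lt.2 h4))
  filter_upwards [measure_eq_zero_iff_ae_notMem.1 h0] with ω hω _ _ _ using hω

theorem ae_sep : ∀ᵐ ω ∂μ, ∀ (S S' : Set ((Σ j, ι j) ⊕ Option κ)) (y y' : E × (J → ℝ)),
    .inr none ∉ S → .inr none ∉ S' →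
    Submodule.span ℝ (covec ω '' S) = ⊤ → Submodule.span ℝ (covec ω '' S') = ⊤ →
    TightOn ω S y → TightOn ω S' y' → covec ω (.inr none) y = covec ω (.inr none) y' →
    y.1 = y'.1 := by
  classical
  have := Fintype.ofFinite ((Σ j, ι j) ⊕ Option κ)
  have := Fintype.ofFinite J
  refine ae_all_iff.2 fun S => ae_all_iff.2 fun S' => ?_
  by_cases hS : .inr none ∉ S ∧ .inr none ∉ S'
  swap
  · exact Eventually.of_forall fun ω y y' h1 h2 => absurd ⟨h1, h2⟩ hS
  obtain ⟨hS, hS'⟩ := hS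
  have hker : ∀ T : Set ((Σ j, ι j) ⊕ Option κ),
      MeasurableSet {ω : (Σ j, ι j) ⊕ Option κ → E × ℝ |
        ∃ z : E × (J → ℝ), (∀ t ∈ T, covec ω t z = 0) ∧ ‖z‖ = 1} := fun T => by
    refine measurableSet_exists_of_isClosed (IsClosed.inter ?_
      (isClosed_eq (continuous_norm.comp continuous_snd) continuous_const))
    change IsClosed {z : ((Σ j, ι j) ⊕ Option κ → E × ℝ) × (E × (J → ℝ)) |
      ∀ t ∈ T, covec z.1 t z.2 = 0}
    simp only [ofPred_forall]
    exact isClosed_iInter fun t => isClosed_iInter fun _ =>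
      isClosed_eq (continuous_covec t) continuous_const
  have hinj : ∀ (ω : (Σ j, ι j) ⊕ Option κ → E × ℝ) (T : Set ((Σ j, ι j) ⊕ Option κ)),
      (¬ ∃ z : E × (J → ℝ), (∀ t ∈ T, covec ω t z = 0) ∧ ‖z‖ = 1) →
      ∀ z z', TightOn ω T z → TightOn ω T z' → z = z' := by
    intro ω T hT z z' hz hz'
    by_contra hne
    have hpos : ‖z - z'‖ ≠ 0 := norm_ne_zero_iff.2 (sub_ne_zero.2 hne)
    refine hT ⟨‖z - z'‖⁻¹ • (z - z'), fun t ht => ?_, ?_⟩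
    · have h1 := hz t ht
      have h2 := hz' t ht
      rw [map_smul, map_sub, show covec ω t z - covec ω t z' = 0 by linarith, smul_zero]
    · rw [norm_smul, norm_inv, norm_norm, inv_mul_cancel₀ hpos]
  have hB : MeasurableSet {ω : (Σ j, ι j) ⊕ Option κ → E × ℝ |
      ∃ z : ((E × (J → ℝ)) × (E × (J → ℝ))) × ℝ, TightOn ω S z.1.1 ∧ TightOn ω S' z.1.2 ∧
        covec ω (.inr none) z.1.1 = covec ω (.inr none) z.1.2 ∧
        z.2 * ‖z.1.1.1 - z.1.2.1‖ = 1} :=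
    measurableSet_exists_of_isClosed ((isClosed_tightOn (by fun_prop) (by fun_prop) _).inter
      ((isClosed_tightOn (by fun_prop) (by fun_prop) _).inter ((isClosed_eq
        ((continuous_covec _).comp (by fun_prop : Continuous fun z :
          ((Σ j, ι j) ⊕ Option κ → E × ℝ) × ((E × (J → ℝ)) × (E × (J → ℝ))) × ℝ =>
            (z.1, z.2.1.1)))
        ((continuous_covec _).comp (by fun_prop : Continuous fun z :
          ((Σ j, ι j) ⊕ Option κ → E × ℝ) × ((E × (J → ℝ)) × (E × (J → ℝ))) × ℝ =>
            (z.1, z.2.1.2)))).inter (isClosed_eq (by fun_prop) continuous_const))))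
  have h0 := measure_eq_zero_of_translates (μ := μ) (ν := (volume : Measure E)) (NeZero.ne _)
    (i := fun x : E => bump (.inr none) (x, 0)) ((measurable_bump _).comp (measurable_id.prodMk measurable_const))
    ((hB.diff (hker S)).diff (hker S')) (fun ω => by
      have hcov : ∀ T : Set ((Σ j, ι j) ⊕ Option κ), .inr none ∉ T → ∀ t ∈ T, ∀ x : E,
          (ω + bump (.inr none) (x, 0) : (Σ j, ι j) ⊕ Option κ → E × ℝ) t = ω t := by
        intro T hT t ht x
        have hne : t ≠ .inr none := fun h => hT (h ▸ ht)
        simp [bump_of_ne _ hne]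
      have htight : ∀ T : Set ((Σ j, ι j) ⊕ Option κ), .inr none ∉ T → ∀ (x : E) z,
          TightOn (ω + bump (.inr none) (x, 0)) T z → TightOn ω T z := by
        intro T hT x z hz t ht
        have h := hz t ht
        rwa [hcov T hT t ht, covec_congr (congrArg Prod.fst (hcov T hT t ht x))] at h
      have hkerω : ∀ T : Set ((Σ j, ι j) ⊕ Option κ), .inr none ∉ T → ∀ (x : E),
          (¬ ∃ z : E × (J → ℝ), (∀ t ∈ T, covec (ω + bump (.inr none) (x, 0)) t z = 0) ∧
            ‖z‖ = 1) → ¬ ∃ z : E × (J → ℝ), (∀ t ∈ T, covec ω t z = 0) ∧ ‖z‖ = 1 := by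
        rintro T hT x h ⟨z, h1, h2⟩
        refine h ⟨z, fun t ht => ?_, h2⟩
        rw [covec_congr (congrArg Prod.fst (hcov T hT t ht x))]
        exact h1 t ht
      by_cases hne : ∃ x : E, ω + bump (.inr none) (x, 0) ∈
        ({ω | ∃ z : ((E × (J → ℝ)) × (E × (J → ℝ))) × ℝ, TightOn ω S z.1.1 ∧ TightOn ω S' z.1.2 ∧
          covec ω (.inr none) z.1.1 = covec ω (.inr none) z.1.2 ∧
          z.2 * ‖z.1.1.1 - z.1.2.1‖ = 1} \ {ω : (Σ j, ι j) ⊕ Option κ → E × ℝ |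
        ∃ z : E × (J → ℝ), (∀ t ∈ S, covec ω t z = 0) ∧ ‖z‖ = 1}) \
        {ω : (Σ j, ι j) ⊕ Option κ → E × ℝ |
        ∃ z : E × (J → ℝ), (∀ t ∈ S', covec ω t z = 0) ∧ ‖z‖ = 1}
      swap
      · exact measure_mono_null (fun x hx => hne ⟨x, hx⟩) measure_empty
      obtain ⟨x₀, ⟨⟨⟨⟨y, y'⟩, r⟩, hy, hy', -, hr⟩, hk⟩, hk'⟩ := hne
      have hw : y.1 - y'.1 ≠ 0 := fun h => by
        simp [h] at hr
      have hyω := htight S hS x₀ _ hy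
      have hyω' := htight S' hS' x₀ _ hy'
      have hkω := hkerω S hS x₀ hk
      have hkω' := hkerω S' hS' x₀ hk'
      refine measure_mono_null (t := (fun x => (ω (.inr none)).1 + x) ⁻¹'
        (LinearMap.ker (innerₗ E (y.1 - y'.1)) : Set E)) ?_ ?_
      · rintro x ⟨⟨⟨⟨⟨u, u'⟩, r'⟩, hu, hu', heq, -⟩, -⟩, -⟩
        obtain rfl : u = y := hinj ω S hkω _ _ (htight S hS x _ hu) hyω
        obtain rfl : u' = y' := hinj ω S' hkω' _ _ (htight S' hS' x _ hu') hyω'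
        simp only [covec_inr, Pi.add_apply, bump_same, Prod.fst_add] at heq
        simp only [mem_preimage, SetLike.mem_coe, LinearMap.mem_ker, innerₗ_apply_apply,
          inner_sub_left]
        linarith
      · rw [measure_preimage_add]
        refine Measure.addHaar_submodule _ _ fun htop => hw ?_
        have h1 : y.1 - y'.1 ∈ LinearMap.ker (innerₗ E (y.1 - y'.1)) := htop ▸ Submodule.mem_top
        exact inner_self_eq_zero.1 h1)
  filter_upwards [measure_eq_zero_iff_ae_notMem.1 h0] with ω hω y y' _ _ hsp hsp' hy hy' heq
  have hsep : ∀ T : Set ((Σ j, ι j) ⊕ Option κ), Submodule.span ℝ (covec ω '' T) = ⊤ →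
      ¬ ∃ z : E × (J → ℝ), (∀ t ∈ T, covec ω t z = 0) ∧ ‖z‖ = 1 := by
    rintro T hT ⟨z, h1, h2⟩
    have h3 : z = 0 := by
      refine (Module.forall_dual_apply_eq_zero_iff ℝ z).1 fun f => ?_
      have h4 := eq_of_mem_span (f := f) (y := z) (y' := 0) (hT ▸ Submodule.mem_top) (by
        rintro _ ⟨t, ht, rfl⟩
        rw [h1 t ht, map_zero])
      simpa using h4
    simp [h3] at h2
  by_contra hne
  exact hω ⟨⟨⟨((y, y'), ‖y.1 - y'.1‖⁻¹), hy, hy', heq,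
    inv_mul_cancel₀ (norm_ne_zero_iff.2 (sub_ne_zero.2 hne))⟩, hsep S hsp⟩, hsep S' hsp'⟩

/-- Almost every choice of coefficients is generic. -/
theorem ae_genPos : ∀ᵐ ω ∂μ, GenPos ω := by
  filter_upwards [ae_indep μ, ae_notMem μ, ae_sep μ] with ω h1 h2 h3 using ⟨h1, h2, h3⟩

end Generic

/-! ### Bend loci and polyhedra in terms of sweeps -/

section Geometry

variable {d r s : ℕ}

theorem le_plMax (b : Fin r → EuclideanSpace ℝ (Fin d)) (a : Fin r → ℝ)
    (x : EuclideanSpace ℝ (Fin d)) (i : Fin r) : ⟪x, b i⟫ + a i ≤ plMax b a x :=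
  le_ciSup (f := fun i => ⟪x, b i⟫ + a i) (finite_range _).bddAbove i

theorem plMax_eq {b : Fin r → EuclideanSpace ℝ (Fin d)} {a : Fin r → ℝ}
    {x : EuclideanSpace ℝ (Fin d)} {i : Fin r} (hi : ∀ l, ⟪x, b l⟫ + a l ≤ ⟪x, b i⟫ + a i) :
    plMax b a x = ⟪x, b i⟫ + a i :=
  have : Nonempty (Fin r) := ⟨i⟩
  le_antisymm (ciSup_le hi) (le_plMax b a x i)

/-- The derivative of a maximum of affine functions is the slope of any of those attaining it. -/
theorem fderiv_plMax {b : Fin r → EuclideanSpace ℝ (Fin d)} {a : Fin r → ℝ}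
    {x : EuclideanSpace ℝ (Fin d)} {i : Fin r} (hx : DifferentiableAt ℝ (plMax b a) x)
    (hi : ∀ l, ⟪x, b l⟫ + a l ≤ ⟪x, b i⟫ + a i) : fderiv ℝ (plMax b a) x = innerSL ℝ (b i) := by
  have h1 : HasFDerivAt (fun y => plMax b a y - innerSL ℝ (b i) y)
      (fderiv ℝ (plMax b a) x - innerSL ℝ (b i)) x :=
    hx.hasFDerivAt.sub (innerSL ℝ (b i)).hasFDerivAt
  refine sub_eq_zero.1 (IsLocalMin.hasFDerivAt_eq_zero (Eventually.of_forall fun y => ?_) h1)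
  have h2 := le_plMax b a y i
  simp only [plMax_eq hi, innerSL_apply_apply, real_inner_comm _ (b i)]
  linarith

theorem mem_bendLocus_iff (hr : 0 < r) {b : Fin r → EuclideanSpace ℝ (Fin d)} {a : Fin r → ℝ}
    {x : EuclideanSpace ℝ (Fin d)}
    (hb : ∀ i i', i ≠ i' → ⟪x, b i⟫ + a i = ⟪x, b i'⟫ + a i' → b i ≠ b i') :
    x ∈ bendLocus b a ↔ ∃ i i', i ≠ i' ∧ (∀ l, ⟪x, b l⟫ + a l ≤ ⟪x, b i⟫ + a i) ∧
      ∀ l, ⟪x, b l⟫ + a l ≤ ⟪x, b i'⟫ + a i' := by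
  constructor
  · intro hx
    by_contra! hne
    have : Nonempty (Fin r) := ⟨⟨0, hr⟩⟩
    obtain ⟨i, hi⟩ := Finite.exists_max fun i => ⟪x, b i⟫ + a i
    have hlt : ∀ l, l ≠ i → ⟪x, b l⟫ + a l < ⟪x, b i⟫ + a i := by
      intro l hl
      obtain ⟨l', hl'⟩ := hne i l hl.symm hi
      exact hl'.trans_le (hi l')
    refine hx (DifferentiableAt.congr_of_eventuallyEq
      (f := fun y => innerSL ℝ (b i) y + a i) (by fun_prop) ?_)
    have h1 : ∀ᶠ y in 𝓝 x, ∀ l, l ≠ i → ⟪y, b l⟫ + a l < ⟪y, b i⟫ + a i := by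
      refine eventually_all.2 fun l => ?_
      by_cases hl : l = i
      · simp [hl]
      · have h2 : ∀ᶠ y in 𝓝 x, ⟪y, b l⟫ + a l < ⟪y, b i⟫ + a i :=
          ContinuousAt.eventually_lt (by fun_prop) (by fun_prop) (hlt l hl)
        exact h2.mono fun y hy _ => hy
    filter_upwards [h1] with y hy
    rw [plMax_eq (i := i) fun l => ?_, innerSL_apply_apply, real_inner_comm]
    by_cases hl : l = i
    · rw [hl]
    · exact (hy l hl).le
  · rintro ⟨i, i', hne, hi, hi'⟩ hx
    refine hb i i' hne (le_antisymm (hi' i) (hi i')) ?_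
    have h1 : innerSL ℝ (b i) = innerSL ℝ (b i') := by
      rw [← fderiv_plMax hx hi, ← fderiv_plMax hx hi']
    exact ext_inner_right ℝ fun v => by simpa using congrArg (fun f => f v) h1

theorem mem_frontier_polyhedron_iff {q : Fin s → EuclideanSpace ℝ (Fin d) × ℝ}
    {x : EuclideanSpace ℝ (Fin d)} (hq : ∀ k, ⟪x, (q k).1⟫ + (q k).2 = 0 → (q k).1 ≠ 0) :
    x ∈ frontier (polyhedron q) ↔ x ∈ polyhedron q ∧ ∃ k, ⟪x, (q k).1⟫ + (q k).2 = 0 := by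
  have hcl : IsClosed (polyhedron q) := by
    simp only [polyhedron, ofPred_forall]
    exact isClosed_iInter fun k => isClosed_le (by fun_prop) (by fun_prop)
  rw [hcl.frontier_eq, Set.mem_sdiff]
  refine and_congr_right fun hx => ⟨fun hinter => ?_, ?_⟩
  · by_contra! hne
    refine hinter (mem_interior_iff_mem_nhds.2 ?_)
    have h1 : ∀ᶠ y in 𝓝 x, ∀ k, ⟪y, (q k).1⟫ + (q k).2 < 0 :=
      eventually_all.2 fun k => ContinuousAt.eventually_lt (by fun_prop) (by fun_prop)
        (lt_of_le_of_ne (hx k) (hne k))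
    exact h1.mono fun y hy k => (hy k).le
  · rintro ⟨k, hk⟩ hinter
    have h1 : IsLocalMax (fun y => innerSL ℝ (q k).1 y) x := by
      filter_upwards [mem_interior_iff_mem_nhds.1 hinter] with y hy
      have := hy k
      simp only [innerSL_apply_apply, real_inner_comm _ (q k).1]
      linarith
    have h2 := h1.hasFDerivAt_eq_zero (innerSL ℝ (q k).1).hasFDerivAt
    refine hq k hk (inner_self_eq_zero (𝕜 := ℝ).1 ?_)
    simpa using congrArg (fun f => f (q k).1) h2

end Geometry

section Transfer

variable {n d s : ℕ} {r : Fin n → ℕ}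

/-- The coefficients of the sweep attached to convex functions and a polyhedron, with the last
sign reversed since the inequalities of a sweep point in the other direction. -/
def coef (r : Fin n → ℕ) (s : ℕ) :
    ((Π j : Fin n, Fin (r j) → EuclideanSpace ℝ (Fin d) × ℝ) ×
      (Fin (s + 1) → EuclideanSpace ℝ (Fin d) × ℝ)) ≃ₗ[ℝ]
    ((Σ j : Fin n, Fin (r j)) ⊕ Option (Fin s) → EuclideanSpace ℝ (Fin d) × ℝ) where
  toFun pq := Sum.elim (fun t => pq.1 t.1 t.2) fun o => - pq.2 ((finSuccEquiv s).symm o)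
  invFun ω := (fun j i => ω (.inl ⟨j, i⟩), fun k => - ω (.inr (finSuccEquiv s k)))
  map_add' pq pq' := by
    ext (t | o) : 1
    · rfl
    · exact neg_add _ _
  map_smul' c pq := by
    ext (t | o) : 1
    · rfl
    · exact (smul_neg c _).symm
  left_inv pq := by simp
  right_inv ω := by
    ext (t | o) : 1 <;> simp

@[simp] theorem coef_inl (pq : (Π j : Fin n, Fin (r j) → EuclideanSpace ℝ (Fin d) × ℝ) ×
    (Fin (s + 1) → EuclideanSpace ℝ (Fin d) × ℝ)) (t : Σ j : Fin n, Fin (r j)) :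
    coef r s pq (.inl t) = pq.1 t.1 t.2 := rfl

@[simp] theorem coef_inr (pq : (Π j : Fin n, Fin (r j) → EuclideanSpace ℝ (Fin d) × ℝ) ×
    (Fin (s + 1) → EuclideanSpace ℝ (Fin d) × ℝ)) (o : Option (Fin s)) :
    coef r s pq (.inr o) = - pq.2 ((finSuccEquiv s).symm o) := rfl

theorem ae_genPos_coef : ∀ᵐ pq ∂(volume : Measure
    ((Π j : Fin n, Fin (r j) → EuclideanSpace ℝ (Fin d) × ℝ) ×
      (Fin (s + 1) → EuclideanSpace ℝ (Fin d) × ℝ))), GenPos (coef r s pq) := by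
  have h0 : (volume : Measure (EuclideanSpace ℝ (Fin d) × ℝ)).IsAddHaarMeasure :=
    Measure.prod.instIsAddHaarMeasure _ _
  have h1 : ∀ j, (volume : Measure (Fin (r j) → EuclideanSpace ℝ (Fin d) × ℝ)).IsAddHaarMeasure :=
    fun j => Measure.pi.isAddHaarMeasure _
  have h2 : (volume : Measure (Fin (s + 1) → EuclideanSpace ℝ (Fin d) × ℝ)).IsAddHaarMeasure :=
    Measure.pi.isAddHaarMeasure _
  have h3 : (volume : Measure
      (Π j : Fin n, Fin (r j) → EuclideanSpace ℝ (Fin d) × ℝ)).IsAddHaarMeasure :=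
    Measure.pi.isAddHaarMeasure _
  have hp : (volume : Measure ((Π j : Fin n, Fin (r j) → EuclideanSpace ℝ (Fin d) × ℝ) ×
      (Fin (s + 1) → EuclideanSpace ℝ (Fin d) × ℝ))).IsAddHaarMeasure :=
    Measure.prod.instIsAddHaarMeasure _ _
  have := (coef (d := d) r s).toContinuousLinearEquiv.isAddHaarMeasure_map volume
  have h1 := ae_genPos (Measure.map (coef (d := d) r s).toContinuousLinearEquiv volume)
  exact ae_of_ae_map
    (coef (d := d) r s).toContinuousLinearEquiv.continuous.measurable.aemeasurable h1

variable {pq : (Π j : Fin n, Fin (r j) → EuclideanSpace ℝ (Fin d) × ℝ) ×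
    (Fin (s + 1) → EuclideanSpace ℝ (Fin d) × ℝ)}

theorem slope_ne (hpq : GenPos (coef r s pq)) (j : Fin n) {x : EuclideanSpace ℝ (Fin d)}
    {i i' : Fin (r j)} (hne : i ≠ i')
    (hx : ⟪x, (pq.1 j i).1⟫ + (pq.1 j i).2 = ⟪x, (pq.1 j i').1⟫ + (pq.1 j i').2) :
    (pq.1 j i).1 ≠ (pq.1 j i').1 := by
  intro heq
  have h1 := hpq.indep {.inl ⟨j, i⟩, .inl ⟨j, i'⟩}
    (x, fun _ => -(⟪x, (pq.1 j i).1⟫ + (pq.1 j i).2)) (by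
      rintro t (rfl | rfl)
      · simp
      · rw [hx]
        simp)
  have h2 : (Sum.inl ⟨j, i⟩ : (Σ j : Fin n, Fin (r j)) ⊕ Option (Fin s)) = .inl ⟨j, i'⟩ :=
    h1.injOn (by simp) (by simp) (by ext y <;> simp [heq])
  simp [hne] at h2

theorem normal_ne_zero (hpq : GenPos (coef r s pq)) {x : EuclideanSpace ℝ (Fin d)}
    (k : Fin (s + 1)) (hx : ⟪x, (pq.2 k).1⟫ + (pq.2 k).2 = 0) : (pq.2 k).1 ≠ 0 := by
  intro heq
  have h1 := hpq.indep {.inr (finSuccEquiv s k)} (x, 0) (by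
    rintro t rfl
    simp only [covec_inr, coef_inr, Equiv.symm_apply_apply, Prod.fst_neg, Prod.snd_neg,
      inner_neg_right]
    linarith)
  refine h1.ne_zero (mem_singleton _) ?_
  ext y <;> simp [heq]

theorem body_eq (hr : ∀ j, 2 ≤ r j) (hpq : GenPos (coef r s pq)) :
    ((sweepOf (coef r s pq)).slab 0).body =
      (⋂ j : Fin n, bendLocus (fun i => (pq.1 j i).1) (fun i => (pq.1 j i).2)) ∩
        polyhedron pq.2 := by
  ext x
  have h1 : x ∈ polyhedron pq.2 ↔
      (∀ k, 0 ≤ (sweepOf (coef r s pq)).ψ k x) ∧ 0 ≤ (sweepOf (coef r s pq)).h x := by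
    have h2 : ∀ k, -⟪x, (pq.2 k).1⟫ + -(pq.2 k).2 = -(⟪x, (pq.2 k).1⟫ + (pq.2 k).2) :=
      fun k => by ring
    simp only [polyhedron, mem_ofPred_eq, sweepOf, affineOf_apply, coef_inr, Prod.fst_neg,
      Prod.snd_neg, inner_neg_right, h2, Left.nonneg_neg_iff, Fin.forall_fin_succ]
    simp [and_comm]
  rw [Sweep.mem_body_slab, mem_inter_iff, h1, Sweep.Feas, and_assoc, mem_iInter]
  refine and_congr_left fun _ => forall_congr' fun j => ?_
  rw [mem_bendLocus_iff (by have := hr j; lia) fun i i' hne heq => slope_ne hpq j hne heq]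
  simp [Sweep.Top, sweepOf]

theorem bdry_eq (hr : ∀ j, 2 ≤ r j) (hpq : GenPos (coef r s pq)) :
    ((sweepOf (coef r s pq)).slab 0).bdry =
      ((sweepOf (coef r s pq)).slab 0).body ∩ frontier (polyhedron pq.2) := by
  ext x
  have h1 : (∃ k, ⟪x, (pq.2 k).1⟫ + (pq.2 k).2 = 0) ↔
      (sweepOf (coef r s pq)).h x = 0 ∨ ∃ k, (sweepOf (coef r s pq)).ψ k x = 0 := by
    have h2 : ∀ k, -⟪x, (pq.2 k).1⟫ + -(pq.2 k).2 = -(⟪x, (pq.2 k).1⟫ + (pq.2 k).2) :=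
      fun k => by ring
    simp only [sweepOf, affineOf_apply, coef_inr, Prod.fst_neg, Prod.snd_neg, inner_neg_right, h2,
      neg_eq_zero, Fin.exists_fin_succ]
    simp
  rw [Sweep.mem_bdry_slab, mem_inter_iff,
    mem_frontier_polyhedron_iff fun k => normal_ne_zero hpq k, h1, ← and_assoc,
    ← Sweep.mem_body_slab, body_eq hr hpq]
  simp only [mem_inter_iff]
  tauto

end Transfer

/-! ### From compressibility to homotopy groups -/

section Homotopy

theorem Thin.of_injective {X : Type} [MetricSpace X] [CompactSpace X] {N : ℕ} {φ : X → Fin N → ℝ}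
    (hφ : Continuous φ) (hinj : Function.Injective φ) : Thin (N + 1) (univ : Set X) :=
  ⟨isCompact_univ, N, φ, ∅, hφ, hinj.injOn, fun x _ => by simp⟩

variable {V : Type} [NormedAddCommGroup V] {Z B : Set V} {m : ℕ}

/-- Compressibility for maps of a compact space, in terms of relative homotopies. -/
theorem Compressible.exists_homotopyRel (h : Compressible m Z B) {X : Type} [MetricSpace X]
    (hX : Thin m (univ : Set X)) {S : Set X} (hS : IsClosed S) (g : C(X, Z))
    (hg : ∀ x ∈ S, (g x : V) ∈ B) :
    ∃ g' : C(X, {y : Z | (y : V) ∈ B}), Nonempty (g.HomotopyRel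
      (ContinuousMap.comp ⟨Subtype.val, continuous_subtype_val⟩ g') S) := by
  obtain ⟨H, hHc, hHZ, hH0, hH1, hHS⟩ := h X univ S (fun x => g x) hX hS (subset_univ S)
    (by fun_prop) (fun x _ => (g x).2) hg
  have hc : Continuous fun z : unitInterval × X => H (z.2, z.1) :=
    hHc.comp_continuous (by fun_prop) fun z => ⟨mem_univ _, z.1.2⟩
  let F : C(unitInterval × X, Z) := ⟨fun z => ⟨H (z.2, z.1), hHZ ⟨mem_univ _, z.1.2⟩⟩,
    hc.subtype_mk _⟩
  refine ⟨⟨fun x => ⟨F (1, x), hH1 x (mem_univ x)⟩, by fun_prop⟩,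
    ⟨⟨⟨F, fun x => Subtype.ext ?_, fun x => rfl⟩, fun t x hx => Subtype.ext ?_⟩⟩⟩
  · exact hH0 x (mem_univ x)
  · exact hHS x hx t t.2

theorem isClosed_cube_boundary (k : ℕ) : IsClosed (Cube.boundary (Fin k)) := by
  have h1 : Cube.boundary (Fin k) = ⋃ i, ({y | y i = 0} ∪ {y | y i = 1}) := by
    ext y
    simp [Cube.boundary]
  rw [h1]
  exact isClosed_iUnion_of_finite fun i => (isClosed_eq (continuous_apply i) continuous_const).union
    (isClosed_eq (continuous_apply i) continuous_const)

theorem Compressible.surjective_map (h : Compressible (m + 1) Z B) {k : ℕ} (hk : k ≤ m)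
    (a : {y : Z | (y : V) ∈ B}) : Function.Surjective
      (HomotopyGroup.map (Fin k) ⟨Subtype.val, continuous_subtype_val⟩ a) := by
  intro c
  obtain ⟨p, rfl⟩ := Quotient.exists_rep c
  have hX : Thin (k + 1) (univ : Set (Fin k → unitInterval)) :=
    Thin.of_injective (φ := fun x i => (x i : ℝ)) (by fun_prop) fun x y hxy =>
      funext fun i => Subtype.ext (congrFun hxy i)
  obtain ⟨g', ⟨F⟩⟩ := h.exists_homotopyRel (hX.mono (by lia)) (isClosed_cube_boundary k) p.1
    (fun x hx => by rw [p.2 x hx]; exact a.2)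
  refine ⟨Quotient.mk _ ⟨g', fun x hx => Subtype.ext ?_⟩, Quotient.sound ⟨F.symm⟩⟩
  exact (F.fst_eq_snd hx).symm.trans (p.2 x hx)

theorem Compressible.injective_map (h : Compressible (m + 1) Z B) {k : ℕ} (hk : k < m)
    (a : {y : Z | (y : V) ∈ B}) : Function.Injective
      (HomotopyGroup.map (Fin k) ⟨Subtype.val, continuous_subtype_val⟩ a) := by
  intro c c' hcc
  obtain ⟨p, rfl⟩ := Quotient.exists_rep c
  obtain ⟨q, rfl⟩ := Quotient.exists_rep c'
  obtain ⟨F⟩ := Quotient.exact hcc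
  have hX : Thin (k + 1 + 1) (univ : Set (unitInterval × (Fin k → unitInterval))) :=
    Thin.of_injective
      (φ := fun x => Fin.cons (α := fun _ => ℝ) (x.1 : ℝ) fun i => (x.2 i : ℝ))
      (by fun_prop) fun x y hxy => by
        obtain ⟨h1, h2⟩ := Fin.cons_injective2 hxy
        exact Prod.ext (Subtype.ext h1) (funext fun i => Subtype.ext (congrFun h2 i))
  have hS : IsClosed {x : unitInterval × (Fin k → unitInterval) |
      (x.1 = 0 ∨ x.1 = 1) ∨ x.2 ∈ Cube.boundary (Fin k)} :=
    ((isClosed_eq continuous_fst continuous_const).union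
      (isClosed_eq continuous_fst continuous_const)).union
        ((isClosed_cube_boundary k).preimage continuous_snd)
  obtain ⟨g', ⟨G⟩⟩ := h.exists_homotopyRel (hX.mono (by lia)) hS F.toContinuousMap (by
    rintro ⟨t, x⟩ ((rfl | rfl) | hx)
    · have h1 : F (0, x) = p x := F.apply_zero x
      change (F (0, x) : V) ∈ B
      rw [h1]
      exact (p x).2
    · have h1 : F (1, x) = q x := F.apply_one x
      change (F (1, x) : V) ∈ B
      rw [h1]
      exact (q x).2
    · have h1 : F (t, x) = p x := F.eq_fst t hx
      change (F (t, x) : V) ∈ B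
      rw [h1]
      exact (p x).2)
  refine Quotient.sound ⟨⟨⟨g', fun x => Subtype.ext ?_, fun x => Subtype.ext ?_⟩,
    fun t x hx => Subtype.ext ?_⟩⟩
  · exact (G.fst_eq_snd (Or.inl (Or.inl rfl))).symm.trans (F.apply_zero x)
  · exact (G.fst_eq_snd (Or.inl (Or.inr rfl))).symm.trans (F.apply_one x)
  · exact (G.fst_eq_snd (Or.inr hx)).symm.trans (F.eq_fst t hx)

theorem Compressible.pairMConnected (h : Compressible (m + 1) Z B) :
    PairMConnected m {y : Z | (y : V) ∈ B} :=
  fun a => ⟨fun _ hk => ⟨h.injective_map hk a, h.surjective_map hk.le a⟩,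
    h.surjective_map le_rfl a⟩

end Homotopy

/-- For Lebesgue-almost-every choice of the coefficients of `n` convex PL functions on `ℝ^d`
(`2 ≤ d`, `1 ≤ n < d`, each a maximum of `r j ≥ 2` affine functions) and of the `s` affine
functionals cutting out a polyhedron `P`, if `P` is full-dimensional then the pair
`(X ∩ P, X ∩ ∂P)` is `(d - n - 1)`-connected, where `X` is the intersection of the bend loci. -/
theorem pair_intersection_polyhedron_connected (d n s : ℕ) (hd : 2 ≤ d) (hn : 1 ≤ n)
    (hnd : n < d) (r : Fin n → ℕ) (hr : ∀ j, 2 ≤ r j) :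
    ∀ᵐ pq ∂(volume : Measure ((Π j : Fin n, Fin (r j) → EuclideanSpace ℝ (Fin d) × ℝ) ×
        (Fin s → EuclideanSpace ℝ (Fin d) × ℝ))),
      (interior (polyhedron pq.2)).Nonempty →
        PairMConnected (d - n - 1)
          {y : ↥((⋂ j : Fin n, bendLocus (fun i => (pq.1 j i).1) (fun i => (pq.1 j i).2)) ∩
              polyhedron pq.2) | ↑y ∈ frontier (polyhedron pq.2)} := by
  rcases s with _ | s
  · refine Eventually.of_forall fun pq _ a => absurd a.2 ?_
    have h1 : polyhedron pq.2 = univ := eq_univ_of_forall fun x k => k.elim0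
    simp [h1]
  · filter_upwards [ae_genPos_coef] with pq hpq _
    have : ∀ j, Nonempty (Fin (r j)) := fun j => ⟨⟨0, by have := hr j; lia⟩⟩
    have h1 := hpq.compressible (m := d - n - 1 + 1) (by
      rw [finrank_euclideanSpace_fin, Fintype.card_fin]
      lia)
    rw [bdry_eq hr hpq, body_eq hr hpq] at h1
    convert h1.pairMConnected using 1
    ext y
    exact ⟨fun h => ⟨y.2, h⟩, fun h => h.2⟩
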